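/- For each number field K, each real number z, and each σ ≥ 1, one has ∫_0^T |ζ_K(σ + it)|^{2z} dt ≪ T for T ≥ 2, where the implied constant may depend on K, z, and σ. -/

import Mathlib

/-!
STATEMENT 13 (Balasubramanian–Ivić–Ramachandra): For a number field K, a real
number z and σ ≥ 1, ∫_0^T |ζ_K(σ+it)|^{2z} dt ≪ T for T ≥ 2.

The Dedekind zeta function is represented by any function Z : ℂ → ℂ that is
differentiable away from s = 1 and agrees with the Dirichlet series on Re s > 1.
-/

open Complex

/-- The Dedekind zeta Dirichlet series of a number field, `Σ_{I ≠ 0} N(I)^{-s}`. -/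
noncomputable def dedekindZetaSeries (K : Type*) [Field K] [NumberField K] (s : ℂ) : ℂ :=
  ∑' I : Ideal (NumberField.RingOfIntegers K), (Ideal.absNorm I : ℂ) ^ (-s)

section EulerProduct

open Filter Topology

variable {M : Type*} [CommMonoidWithZero M] [UniqueFactorizationMonoid M]
  [Subsingleton Mˣ]

theorem prod_one_sub_mul_tsum_eq_tsum_indicator (f : M →*₀ ℂ) (hf : Summable f)
    (S : Finset {p : M // Prime p}) :
    (∏ p ∈ S, (1 - f p)) * ∑' I, f I =
      ∑' I, Set.indicator {I : M | ∀ p ∈ S, ¬ p.1 ∣ I} f I := by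
  classical
  induction S using Finset.induction_on with
  | empty => simp
  | insert p S hp ih =>
    rw [Finset.prod_insert hp, mul_assoc, ih, sub_mul, one_mul, ← tsum_mul_left]
    have hmem (I : M) : (∀ q ∈ S, ¬ q.1 ∣ p.1 * I) ↔ ∀ q ∈ S, ¬ q.1 ∣ I := by
      refine forall₂_congr fun q hq ↦ not_congr ⟨fun h ↦ ?_, fun h ↦ h.mul_left _⟩
      refine (q.2.dvd_or_dvd h).resolve_left fun h' ↦ hp ?_
      have := associated_iff_eq.mp (q.2.associated_of_dvd p.2 h')
      rwa [← Subtype.ext this]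
    have hinj : Function.Injective fun I : M ↦ p.1 * I := mul_right_injective₀ p.2.ne_zero
    have key : ∑' I, f p * Set.indicator {I : M | ∀ p ∈ S, ¬ p.1 ∣ I} f I =
        ∑' J, Set.indicator {I : M | (∀ p ∈ S, ¬ p.1 ∣ I) ∧ p.1 ∣ I} f J := by
      refine Eq.trans ?_ (hinj.tsum_eq (f := Set.indicator
        {I : M | (∀ p ∈ S, ¬ p.1 ∣ I) ∧ p.1 ∣ I} f) fun I hI ↦ ?_)
      · refine tsum_congr fun I ↦ ?_
        by_cases h : ∀ q ∈ S, ¬ q.1 ∣ I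
        · rw [Set.indicator_of_mem (by exact h),
            Set.indicator_of_mem (by exact ⟨(hmem I).mpr h, dvd_mul_right _ _⟩), map_mul]
        · rw [Set.indicator_of_notMem (by exact h), mul_zero, Set.indicator_of_notMem]
          exact fun h' ↦ h ((hmem I).mp h'.1)
      · obtain ⟨⟨_, J, rfl⟩, _⟩ := Set.indicator_apply_ne_zero.mp (Function.mem_support.mp hI)
        exact ⟨J, rfl⟩
    rw [key, ← (hf.indicator _).tsum_sub (hf.indicator _)]
    refine tsum_congr fun I ↦ ?_
    by_cases h' : p.1 ∣ I <;> simp [Set.indicator_apply, h']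

theorem tendsto_prod_one_sub_mul_tsum (f : M →*₀ ℂ) (hf : Summable f) :
    Tendsto (fun S : Finset {p : M // Prime p} ↦ (∏ p ∈ S, (1 - f p)) * ∑' I, f I) atTop
      (𝓝 1) := by
  classical
  simp_rw [prod_one_sub_mul_tsum_eq_tsum_indicator f hf]
  have h1 : ∑' I : M, (if I = 1 then (1 : ℂ) else 0) = 1 := tsum_ite_eq 1 1
  rw [show 𝓝 (1 : ℂ) = 𝓝 (∑' I : M, (if I = 1 then (1 : ℂ) else 0)) by rw [h1]]
  refine tendsto_tsum_of_dominated_convergence hf.norm (fun I ↦ ?_)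
    (.of_forall fun S I ↦ ?_)
  · refine tendsto_nhds_of_eventually_eq ?_
    by_cases h : I = 1
    · refine .of_forall fun S ↦ ?_
      subst h
      rw [Set.indicator_of_mem, map_one, if_pos rfl]
      exact fun p _ h ↦ p.2.not_isUnit (isUnit_of_dvd_one h)
    · rw [if_neg h]
      by_cases h0 : I = 0
      · exact .of_forall fun S ↦ by simp [h0, Set.indicator_apply]
      · obtain ⟨p, hp, hpI⟩ := WfDvdMonoid.exists_irreducible_factor
          (fun hu ↦ h (isUnit_iff_eq_one.mp hu)) h0
        filter_upwards [eventually_ge_atTop {⟨p, hp.prime⟩}] with S hS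
        rw [Set.indicator_of_notMem]
        exact fun h' ↦ h' ⟨p, hp.prime⟩ (hS (Finset.mem_singleton_self _)) hpI
  · exact norm_indicator_le_norm_self _ _

theorem tsum_ne_zero_of_summable (f : M →*₀ ℂ) (hf : Summable f) : ∑' I, f I ≠ 0 := by
  intro h
  have := tendsto_prod_one_sub_mul_tsum f hf
  simp only [h, mul_zero] at this
  exact zero_ne_one (tendsto_nhds_unique tendsto_const_nhds this)

theorem hasProd_one_sub_prime (f : M →*₀ ℂ) (hf : Summable f) :
    HasProd (fun p : {p : M // Prime p} ↦ 1 - f p) (∑' I, f I)⁻¹ := by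
  have h := (tendsto_prod_one_sub_mul_tsum f hf).mul_const (∑' I, f I)⁻¹
  have h0 := tsum_ne_zero_of_summable f hf
  simpa [HasProd, mul_assoc, h0] using h

theorem prod_prime_injective :
    Function.Injective fun S : Finset {p : M // Prime p} ↦ ∏ p ∈ S, p.1 := by
  have key (S : Finset {p : M // Prime p}) (q : {p : M // Prime p}) :
      q.1 ∣ ∏ p ∈ S, p.1 ↔ q ∈ S := by
    rw [q.2.dvd_finsetProd_iff]
    refine ⟨fun ⟨p, hp, h⟩ ↦ ?_, fun h ↦ ⟨q, h, dvd_rfl⟩⟩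
    rwa [Subtype.ext (associated_iff_eq.mp (q.2.associated_of_dvd p.2 h))]
  intro S T h
  ext q
  rw [← key, ← key, show ∏ p ∈ S, p.1 = ∏ p ∈ T, p.1 from h]

theorem hasSum_inv_tsum (f : M →*₀ ℂ) (hf : Summable f) :
    HasSum (fun S : Finset {p : M // Prime p} ↦ (-1) ^ S.card * f (∏ p ∈ S, p.1))
      (∑' I, f I)⁻¹ := by
  have h1 (S : Finset {p : M // Prime p}) :
      (-1) ^ S.card * f (∏ p ∈ S, p.1) = ∏ p ∈ S, (-f p.1) := by
    rw [Finset.prod_neg, map_prod]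
  have hs : Summable fun S : Finset {p : M // Prime p} ↦ ∏ p ∈ S, (-f p.1) := by
    refine .of_norm ?_
    simp_rw [← h1, norm_mul, norm_pow, norm_neg, norm_one, one_pow, one_mul]
    exact hf.norm.comp_injective prod_prime_injective
  simp_rw [h1]
  have := hasProd_one_add_of_hasSum_prod hs.hasSum
  simp_rw [← sub_eq_add_neg] at this
  rw [(hasProd_one_sub_prime f hf).unique this]
  exact hs.hasSum

theorem one_le_norm_product_of_norm_lt_one {a : ℝ} (ha₀ : 0 ≤ a) (ha₁ : a < 1) {z : ℂ}
    (hz : ‖z‖ = 1) :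
    ‖1 - (a : ℂ)‖ ^ 3 * ‖1 - a * z‖ ^ 4 * ‖1 - a * z ^ 2‖ ≤ 1 := by
  have hac₀ : ‖(a : ℂ)‖ < 1 := by
    simp only [Complex.norm_of_nonneg ha₀, ha₁]
  have hac₁ : ‖a * z‖ < 1 := by rwa [norm_mul, hz, mul_one]
  have hac₂ : ‖a * z ^ 2‖ < 1 := by rwa [norm_mul, norm_pow, hz, one_pow, mul_one]
  have key : 0 ≤ 3 * (-log (1 - a)).re + 4 * (-log (1 - a * z)).re +
      (-log (1 - a * z ^ 2)).re := by
    rw [← ((hasSum_re <| hasSum_taylorSeries_neg_log hac₀).mul_left 3).add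
      ((hasSum_re <| hasSum_taylorSeries_neg_log hac₁).mul_left 4) |>.add
      (hasSum_re <| hasSum_taylorSeries_neg_log hac₂) |>.tsum_eq]
    refine tsum_nonneg fun n ↦ ?_
    simp only [← ofReal_pow, div_natCast_re, ofReal_re, mul_pow, mul_re, ofReal_im, zero_mul,
      sub_zero]
    rcases n.eq_zero_or_pos with rfl | hn
    · simp
    · simp only [← mul_div_assoc, ← add_div]
      refine div_nonneg ?_ n.cast_nonneg
      rw [← pow_mul, pow_mul', sq, mul_re, ← sq, ← sq, ← sq_norm_sub_sq_re, norm_pow, hz]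
      convert! (show 0 ≤ 2 * a ^ n * ((z ^ n).re + 1) ^ 2 by positivity) using 1
      ring
  have hpos {w : ℂ} (hw : ‖w‖ < 1) : 0 < ‖1 - w‖ := by
    rw [norm_pos_iff, sub_ne_zero]
    rintro rfl
    simp at hw
  have h0 := hpos hac₀
  have h1 := hpos hac₁
  have h2 := hpos hac₂
  simp only [neg_re, log_re] at key
  rw [← Real.log_nonpos_iff (by positivity), Real.log_mul (by positivity) (by positivity),
    Real.log_mul (by positivity) (by positivity), Real.log_pow, Real.log_pow]
  push_cast
  linarith

end EulerProduct

section IdealCount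

open NumberField Ideal

variable (K : Type*) [Field K] [NumberField K]

theorem card_dvd_mul_le (I J : Ideal (𝓞 K)) (hI : I ≠ 0) (hJ : J ≠ 0) :
    Nat.card {A // A ∣ I * J} ≤ Nat.card {A // A ∣ I} * Nat.card {A // A ∣ J} := by
  have := UniqueFactorizationMonoid.fintypeSubtypeDvd I hI
  have := UniqueFactorizationMonoid.fintypeSubtypeDvd J hJ
  rw [← Nat.card_prod]
  refine Nat.card_le_card_of_surjective
    (fun x : {A // A ∣ I} × {A // A ∣ J} ↦
      (⟨x.1.1 * x.2.1, mul_dvd_mul x.1.2 x.2.2⟩ : {A // A ∣ I * J})) fun ⟨A, hA⟩ ↦ ?_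
  obtain ⟨B, C, hB, hC, rfl⟩ := exists_dvd_and_dvd_of_dvd_mul hA
  exact ⟨⟨⟨B, hB⟩, ⟨C, hC⟩⟩, rfl⟩

theorem card_dvd_prime_pow_le (P : Ideal (𝓞 K)) (hP : Prime P) (v : ℕ) :
    Nat.card {A // A ∣ P ^ v} ≤ v + 1 := by
  have h := Nat.card_le_card_of_surjective
    (fun i : Fin (v + 1) ↦
      (⟨P ^ i.1, pow_dvd_pow P (Nat.lt_succ_iff.mp i.2)⟩ : {A // A ∣ P ^ v})) fun ⟨A, hA⟩ ↦ by
        obtain ⟨i, hi, h⟩ := (dvd_prime_pow hP v).mp hA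
        exact ⟨⟨i, Nat.lt_succ_of_le hi⟩, Subtype.ext (associated_iff_eq.mp h).symm⟩
  simpa using h

theorem card_dvd_pow_le_of_absNorm {p : ℕ} (hp : p.Prime) (v : ℕ) (I : Ideal (𝓞 K)) :
    ∀ k, absNorm I = p ^ k → Nat.card {A // A ∣ I ^ v} ≤ (v + 1) ^ k := by
  refine UniqueFactorizationMonoid.induction_on_prime I (fun k h ↦ ?_) (fun A hA k _ ↦ ?_)
    (fun J P hJ hP ih k h ↦ ?_)
  · simp only [Ideal.zero_eq_bot, absNorm_bot] at h
    exact absurd h.symm (pow_pos hp.pos k).ne'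
  · rw [isUnit_iff_eq_one.mp hA, one_pow]
    have : Subsingleton {A : Ideal (𝓞 K) // A ∣ 1} :=
      ⟨fun x y ↦ Subtype.ext <| (isUnit_iff_eq_one.mp (isUnit_of_dvd_one x.2)).trans
        (isUnit_iff_eq_one.mp (isUnit_of_dvd_one y.2)).symm⟩
    exact (Finite.card_le_one_iff_subsingleton.mpr this).trans (Nat.one_le_pow _ _ (by omega))
  · rw [map_mul] at h
    obtain ⟨i, hi, hi'⟩ := (Nat.dvd_prime_pow hp).mp (Dvd.intro _ h)
    obtain ⟨j, hj, hj'⟩ := (Nat.dvd_prime_pow hp).mp (Dvd.intro_left _ h)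
    have hij : i + j = k := Nat.pow_right_injective hp.two_le (by simp [pow_add, ← hi', ← hj', h])
    have hi0 : i ≠ 0 := by
      rintro rfl
      exact hP.not_isUnit (isUnit_iff_eq_one.mpr
        ((absNorm_eq_one_iff.mp (by simpa using hi')).trans Ideal.one_eq_top.symm))
    rw [mul_pow]
    calc _ ≤ Nat.card {A // A ∣ P ^ v} * Nat.card {A // A ∣ J ^ v} :=
          card_dvd_mul_le K _ _ (pow_ne_zero _ hP.ne_zero) (pow_ne_zero _ hJ)
      _ ≤ (v + 1) ^ i * (v + 1) ^ j := by
          gcongr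
          · exact (card_dvd_prime_pow_le K P hP v).trans (Nat.le_self_pow hi0 _)
          · exact ih j hj'
      _ = _ := by rw [← pow_add, hij]

theorem card_dvd_span_natCast_le (n : ℕ) (hn : n ≠ 0) :
    Nat.card {A : Ideal (𝓞 K) // A ∣ span {(n : 𝓞 K)}} ≤
      n.divisors.card ^ Module.finrank ℚ K := by
  induction n using Nat.recOnPosPrimePosCoprime with
  | zero => exact absurd rfl hn
  | one =>
    have := card_dvd_pow_le_of_absNorm K Nat.prime_two 1 (1 : Ideal (𝓞 K)) 0 (by simp)
    simpa [Ideal.one_eq_top] using this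
  | prime_pow p v hp hv =>
    have := card_dvd_pow_le_of_absNorm K hp v (span {(p : 𝓞 K)}) (Module.finrank ℚ K) (by
      rw [absNorm_span_singleton, show (p : 𝓞 K) = algebraMap ℤ (𝓞 K) (p : ℤ) by simp,
        Algebra.norm_algebraMap, RingOfIntegers.rank, Int.natAbs_pow, Int.natAbs_natCast])
    rwa [span_singleton_pow, ← Nat.cast_pow, show v + 1 = (p ^ v).divisors.card by
      simp [Nat.divisors_prime_pow hp]] at this
  | coprime a b ha hb hab iha ihb =>
    have h0 (m : ℕ) (hm : m ≠ 0) : span {(m : 𝓞 K)} ≠ 0 := by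
      simpa [Ideal.zero_eq_bot, span_singleton_eq_bot] using hm
    rw [Nat.cast_mul, ← span_singleton_mul_span_singleton, Nat.Coprime.card_divisors_mul hab,
      mul_pow]
    exact (card_dvd_mul_le K _ _ (h0 a (by omega)) (h0 b (by omega))).trans
      (Nat.mul_le_mul (iha (by omega)) (ihb (by omega)))

theorem card_absNorm_eq_le (n : ℕ) (hn : n ≠ 0) :
    Nat.card {I : Ideal (𝓞 K) // absNorm I = n} ≤ n.divisors.card ^ Module.finrank ℚ K := by
  refine le_trans ?_ (card_dvd_span_natCast_le K n hn)
  have := UniqueFactorizationMonoid.fintypeSubtypeDvd (span {(n : 𝓞 K)}) (by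
      simpa [Ideal.zero_eq_bot, span_singleton_eq_bot] using hn)
  refine Nat.card_le_card_of_injective (fun I : {I : Ideal (𝓞 K) // absNorm I = n} ↦
    (⟨I.1, by
      obtain ⟨I, rfl⟩ := I
      exact Ideal.dvd_iff_le.mpr (Ideal.span_singleton_absNorm_le _)⟩ :
      {A : Ideal (𝓞 K) // A ∣ span {(n : 𝓞 K)}})) fun I J h ↦ ?_
  exact Subtype.ext (Subtype.mk.inj h)

end IdealCount

section DivisorPower

open LSeries ComplexOrder

theorem tsum_norm_term_one_le {σ : ℝ} (hσ : 1 < σ) :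
    LSeriesSummable 1 (σ : ℂ) ∧ ∑' n, ‖term 1 (σ : ℂ) n‖ ≤ σ / (σ - 1) := by
  have hs : LSeriesSummable 1 (σ : ℂ) := LSeriesSummable_one_iff.mpr (by simpa using hσ)
  refine ⟨hs, ?_⟩
  rw [hs.norm.tsum_eq_zero_add]
  have h := ZetaAsymptotics.zeta_limit_aux1 hσ
  have h0 : 0 ≤ ZetaAsymptotics.termTSum σ := tsum_nonneg fun n ↦ ZetaAsymptotics.term_nonneg _ _
  have h1 (n : ℕ) : ‖term 1 (σ : ℂ) (n + 1)‖ = 1 / ((n : ℝ) + 1) ^ σ := by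
    rw [norm_term_eq, if_neg (by omega)]
    simp
  simp_rw [h1]
  simp only [term_zero, norm_zero, zero_add]
  have : σ / (σ - 1) = 1 + 1 / (σ - 1) := by field_simp [(by linarith : σ - 1 ≠ 0)]; ring
  rw [this]
  nlinarith

theorem tsum_norm_term_card_divisors_pow_le (j : ℕ) {σ : ℝ} (hσ : 1 < σ) :
    LSeriesSummable (fun n ↦ (n.divisors.card : ℂ) ^ j) (σ : ℂ) ∧
      ∑' n, ‖term (fun n ↦ (n.divisors.card : ℂ) ^ j) (σ : ℂ) n‖ ≤ (σ / (σ - 1)) ^ 2 ^ j := by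
  induction j with
  | zero => simpa [pow_zero] using! tsum_norm_term_one_le hσ
  | succ j ih =>
    set t : ℕ → ℂ := fun n ↦ (n.divisors.card : ℂ) ^ j with ht
    obtain ⟨h1, h2⟩ := ih
    have hc := h1.LSeriesHasSum.convolution h1.LSeriesHasSum
    have hle (n : ℕ) : ‖term (fun n ↦ (n.divisors.card : ℂ) ^ (j + 1)) (σ : ℂ) n‖ ≤
        ‖term (convolution t t) (σ : ℂ) n‖ := by
      refine norm_term_le _ ?_
      rw [convolution_def]
      simp only [ht, norm_pow, norm_natCast]
      have : ∑ p ∈ n.divisorsAntidiagonal,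
          (p.1.divisors.card : ℂ) ^ j * (p.2.divisors.card : ℂ) ^ j =
          ((∑ p ∈ n.divisorsAntidiagonal, p.1.divisors.card ^ j * p.2.divisors.card ^ j : ℕ) : ℂ) := by
        push_cast; rfl
      rw [this, norm_natCast]
      norm_cast
      calc n.divisors.card ^ (j + 1) = ∑ p ∈ n.divisorsAntidiagonal, n.divisors.card ^ j := by
            rw [Finset.sum_const, smul_eq_mul, pow_succ', ← Nat.map_div_right_divisors,
              Finset.card_map]
        _ ≤ _ := by
            refine Finset.sum_le_sum fun p hp ↦ ?_
            obtain ⟨rfl, -⟩ := Nat.mem_divisorsAntidiagonal.mp hp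
            rw [← mul_pow]
            refine Nat.pow_le_pow_left ?_ _
            rw [Nat.divisors_mul]
            exact Finset.card_mul_le
    have hnn (n : ℕ) : 0 ≤ term (convolution t t) (σ : ℂ) n := by
      refine LSeries.term_nonneg ?_ _
      rw [convolution_def]
      refine Finset.sum_nonneg fun p _ ↦ ?_
      simp only [ht]
      positivity
    have hre (n : ℕ) : ‖term (convolution t t) (σ : ℂ) n‖ = (term (convolution t t) (σ : ℂ) n).re := by
      have := norm_of_nonneg' (hnn n)
      rw [← this, ofReal_re, norm_real, norm_norm]
    have hsum : HasSum (fun n ↦ ‖term (convolution t t) (σ : ℂ) n‖) (LSeries t σ * LSeries t σ).re := by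
      simp_rw [hre]
      exact hasSum_re hc
    have hs : Summable fun n ↦ ‖term (fun n ↦ (n.divisors.card : ℂ) ^ (j + 1)) (σ : ℂ) n‖ :=
      .of_nonneg_of_le (fun _ ↦ norm_nonneg _) hle hsum.summable
    refine ⟨hs.of_norm, (hs.tsum_le_tsum hle hsum.summable).trans ?_⟩
    rw [hsum.tsum_eq]
    have hL : ‖LSeries t σ‖ ≤ (σ / (σ - 1)) ^ 2 ^ j := (norm_tsum_le_tsum_norm h1.norm).trans h2
    calc _ ≤ ‖LSeries t σ * LSeries t σ‖ := re_le_norm _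
      _ = ‖LSeries t σ‖ ^ 2 := by rw [norm_mul, sq]
      _ ≤ ((σ / (σ - 1)) ^ 2 ^ j) ^ 2 := by gcongr
      _ = _ := by rw [← pow_mul, pow_succ]

theorem lseriesSummable_of_norm_le {f : ℕ → ℂ} {j : ℕ}
    (hf : ∀ n ≠ 0, ‖f n‖ ≤ (n.divisors.card : ℝ) ^ j) {s : ℂ} (hs : 1 < s.re) :
    LSeriesSummable f s ∧ ∑' n, ‖term f s n‖ ≤ (s.re / (s.re - 1)) ^ 2 ^ j := by
  obtain ⟨h1, h2⟩ := tsum_norm_term_card_divisors_pow_le j hs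
  have hle (n : ℕ) : ‖term f s n‖ ≤ ‖term (fun n ↦ (n.divisors.card : ℂ) ^ j) (s.re : ℂ) n‖ := by
    rcases eq_or_ne n 0 with rfl | hn
    · simp
    · rw [norm_term_eq, norm_term_eq, if_neg hn, if_neg hn, ofReal_re]
      gcongr
      simpa using hf n hn
  have h3 : Summable fun n ↦ ‖term f s n‖ := .of_nonneg_of_le (fun _ ↦ norm_nonneg _) hle h1.norm
  exact ⟨h3.of_norm, (h3.tsum_le_tsum hle h1.norm).trans h2⟩

theorem exists_lseries_pow_eq {f : ℕ → ℂ} {j : ℕ}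
    (hf : ∀ n ≠ 0, ‖f n‖ ≤ (n.divisors.card : ℝ) ^ j) (k : ℕ) :
    ∃ (a : ℕ → ℂ) (i : ℕ), (∀ n ≠ 0, ‖a n‖ ≤ (n.divisors.card : ℝ) ^ i) ∧
      ∀ s : ℂ, 1 < s.re → LSeries a s = LSeries f s ^ k := by
  induction k with
  | zero =>
    refine ⟨LSeries.delta, 0, fun n _ ↦ ?_, fun s _ ↦ by simp [LSeries_delta]⟩
    rw [pow_zero, LSeries.delta]
    split_ifs <;> simp
  | succ k ih =>
    obtain ⟨a, i, ha, hs⟩ := ih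
    refine ⟨convolution a f, i + j + 1, fun n hn ↦ ?_, fun s h ↦ ?_⟩
    · rw [convolution_def]
      calc _ ≤ ∑ p ∈ n.divisorsAntidiagonal, (n.divisors.card : ℝ) ^ (i + j) := by
            refine norm_sum_le_of_le _ fun p hp ↦ ?_
            obtain ⟨hp', -⟩ := Nat.mem_divisorsAntidiagonal.mp hp
            have h1 : p.1 ≠ 0 := by rintro h; simp [h] at hp'; omega
            have h2 : p.2 ≠ 0 := by rintro h; simp [h] at hp'; omega
            have h3 : p.1.divisors.card ≤ n.divisors.card := Finset.card_le_card
              (Nat.divisors_subset_of_dvd hn (Dvd.intro _ hp'))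
            have h4 : p.2.divisors.card ≤ n.divisors.card := Finset.card_le_card
              (Nat.divisors_subset_of_dvd hn (Dvd.intro_left _ hp'))
            rw [norm_mul, pow_add]
            exact mul_le_mul ((ha _ h1).trans (by gcongr)) ((hf _ h2).trans (by gcongr))
              (norm_nonneg _) (by positivity)
        _ = _ := by
            rw [Finset.sum_const, nsmul_eq_mul, pow_succ', ← Nat.map_div_right_divisors,
              Finset.card_map]
    · rw [LSeries_convolution' (lseriesSummable_of_norm_le ha h).1
        (lseriesSummable_of_norm_le hf h).1, hs s h, pow_succ]

end DivisorPower

section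
open NumberField Filter Topology LSeries

theorem cpow_neg_eq_zero_of_zero {s : ℂ} (hs : 1 < s.re) : ((0 : ℕ) : ℂ) ^ (-s) = 0 := by
  rw [Nat.cast_zero, zero_cpow]
  intro h
  have := congrArg re h
  simp at this
  linarith

theorem norm_tsum_fiber_le {ι : Type*} {N : ι → ℕ} {g : ι → ℂ} (hg : ∀ i, ‖g i‖ ≤ 1) (n : ℕ)
    [Finite {i // N i = n}] :
    ‖∑' i : {i // N i = n}, g i‖ ≤ Nat.card {i // N i = n} := by
  have := Fintype.ofFinite {i // N i = n}
  rw [tsum_fintype]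
  refine (norm_sum_le_of_le _ fun i _ ↦ hg i.1).trans ?_
  simp [Nat.card_eq_fintype_card]

theorem hasSum_mul_cpow_of_card_fiber_le {ι : Type*} {N : ι → ℕ} {g : ι → ℂ} {j : ℕ}
    (hg : ∀ i, ‖g i‖ ≤ 1) (hfin : ∀ n ≠ 0, Finite {i // N i = n})
    (hcard : ∀ n ≠ 0, Nat.card {i // N i = n} ≤ n.divisors.card ^ j) {s : ℂ} (hs : 1 < s.re) :
    HasSum (fun i ↦ g i * (N i : ℂ) ^ (-s)) (LSeries (fun n ↦ ∑' i : {i // N i = n}, g i) s) := by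
  have hs0 : s ≠ 0 := by rintro rfl; simp at hs; linarith
  have hval (n : ℕ) (i : {i // N i = n}) : g i * (N i : ℂ) ^ (-s) = g i * (n : ℂ) ^ (-s) := by
    rw [i.2]
  have hterm (n : ℕ) : HasSum (fun i : {i // N i = n} ↦ g i * (N i : ℂ) ^ (-s))
      (term (fun n ↦ ∑' i : {i // N i = n}, g i) s n) := by
    simp_rw [hval]
    rcases eq_or_ne n 0 with rfl | hn
    · simp only [cpow_neg_eq_zero_of_zero hs, mul_zero, term_zero]
      exact hasSum_zero
    · have := hfin n hn
      have := Fintype.ofFinite {i // N i = n}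
      rw [term_of_ne_zero hn, div_eq_mul_inv, ← cpow_neg, tsum_fintype, Finset.sum_mul]
      exact hasSum_fintype _
  have hn1 (n : ℕ) : Summable (fun i : {i // N i = n} ↦ ‖g i * (N i : ℂ) ^ (-s)‖) ∧
      ∑' i : {i // N i = n}, ‖g i * (N i : ℂ) ^ (-s)‖ ≤
        ‖term (fun n ↦ (n.divisors.card : ℂ) ^ j) s n‖ := by
    simp_rw [hval]
    rcases eq_or_ne n 0 with rfl | hn
    · simp only [cpow_neg_eq_zero_of_zero hs, mul_zero, term_zero, norm_zero, tsum_zero, le_refl,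
        and_true]
      exact summable_zero
    · have := hfin n hn
      have := Fintype.ofFinite {i // N i = n}
      refine ⟨(hasSum_fintype _).summable, ?_⟩
      rw [term_of_ne_zero hn, div_eq_mul_inv, ← cpow_neg, tsum_fintype, norm_mul]
      simp_rw [norm_mul]
      rw [← Finset.sum_mul]
      gcongr
      refine (Finset.sum_le_sum fun i _ ↦ hg i.1).trans ?_
      have := hcard n hn
      rw [Nat.card_eq_fintype_card] at this
      simp only [Finset.sum_const, Finset.card_univ, nsmul_eq_mul, mul_one, norm_pow,
        Complex.norm_natCast]
      exact_mod_cast this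
  have hsum : Summable fun n ↦ ‖term (fun n ↦ (n.divisors.card : ℂ) ^ j) s n‖ :=
    (lseriesSummable_of_norm_le (j := j) (fun n _ ↦ by simp) hs).1.norm
  have h1 : Summable fun x : Σ n, {i // N i = n} ↦ ‖g x.2 * (N x.2 : ℂ) ^ (-s)‖ := by
    rw [summable_sigma_of_nonneg fun _ ↦ norm_nonneg _]
    exact ⟨fun n ↦ (hn1 n).1, hsum.of_nonneg_of_le (fun n ↦ tsum_nonneg fun _ ↦ norm_nonneg _)
      fun n ↦ (hn1 n).2⟩
  have h2 := h1.of_norm.hasSum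
  have h3 := h2.sigma hterm
  rw [LSeries, h3.tsum_eq]
  rw [← (Equiv.sigmaFiberEquiv N).hasSum_iff]
  exact h2

variable (K : Type*) [Field K] [NumberField K]

theorem dedekindZetaSeries_eq_lseries {s : ℂ} (hs : 1 < s.re) :
    HasSum (fun I : Ideal (𝓞 K) ↦ (Ideal.absNorm I : ℂ) ^ (-s))
      (LSeries (fun n ↦ (Nat.card {I : Ideal (𝓞 K) // Ideal.absNorm I = n} : ℂ)) s) := by
  have h := hasSum_mul_cpow_of_card_fiber_le (ι := Ideal (𝓞 K)) (N := fun I ↦ Ideal.absNorm I)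
    (g := fun _ ↦ 1) (by simp) (fun n _ ↦ (Ideal.finite_setOfPred_absNorm_eq n).to_subtype)
    (card_absNorm_eq_le K) hs
  simp only [one_mul] at h
  convert h using 2
  ext n
  rw [tsum_const, nsmul_eq_mul, mul_one]

/-- The completely multiplicative function `I ↦ N(I)^{-s}` on ideals, for `s ≠ 0`. -/
noncomputable def absNormCpow {s : ℂ} (hs : s ≠ 0) : Ideal (𝓞 K) →*₀ ℂ where
  toFun I := (Ideal.absNorm I : ℂ) ^ (-s)
  map_zero' := by simp [hs]
  map_one' := by simp
  map_mul' I J := by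
    rw [map_mul, Nat.cast_mul, natCast_mul_natCast_cpow]

theorem exists_lseries_inv :
    ∃ m : ℕ → ℂ, (∀ n ≠ 0, ‖m n‖ ≤ (n.divisors.card : ℝ) ^ Module.finrank ℚ K) ∧
      ∀ s : ℂ, 1 < s.re → LSeries m s =
        (LSeries (fun n ↦ (Nat.card {I : Ideal (𝓞 K) // Ideal.absNorm I = n} : ℂ)) s)⁻¹ := by
  let N : Finset {P : Ideal (𝓞 K) // Prime P} → ℕ := fun S ↦ Ideal.absNorm (∏ P ∈ S, P.1)
  have hf (n : ℕ) : Finite {I : Ideal (𝓞 K) // Ideal.absNorm I = n} :=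
    (Ideal.finite_setOfPred_absNorm_eq n).to_subtype
  have hinj (n : ℕ) : Function.Injective fun S : {S // N S = n} ↦
      (⟨∏ P ∈ S.1, P.1, S.2⟩ : {I : Ideal (𝓞 K) // Ideal.absNorm I = n}) := fun S T h ↦
    Subtype.ext (prod_prime_injective (Subtype.mk.inj h))
  have hN (n : ℕ) : Finite {S // N S = n} := Finite.of_injective _ (hinj n)
  have hcard (n : ℕ) (hn : n ≠ 0) :
      Nat.card {S // N S = n} ≤ n.divisors.card ^ Module.finrank ℚ K :=
    (Nat.card_le_card_of_injective _ (hinj n)).trans (card_absNorm_eq_le K n hn)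
  have hg (S : Finset {P : Ideal (𝓞 K) // Prime P}) : ‖(-1 : ℂ) ^ S.card‖ ≤ 1 := by simp
  refine ⟨fun n ↦ ∑' S : {S // N S = n}, (-1) ^ S.1.card, fun n hn ↦
    (norm_tsum_fiber_le (N := N) hg n).trans (by exact_mod_cast hcard n hn), fun s hs ↦ ?_⟩
  have hs0 : s ≠ 0 := by rintro rfl; simp at hs; linarith
  have h := dedekindZetaSeries_eq_lseries K hs
  have h1 := hasSum_inv_tsum (absNormCpow K hs0) h.summable
  have h2 := hasSum_mul_cpow_of_card_fiber_le (N := N) hg (fun n _ ↦ hN n) hcard hs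
  rw [← h.tsum_eq]
  exact h2.unique h1

theorem one_le_norm_dedekind_product {σ t : ℝ} (hσ : 1 < σ) :
    1 ≤ ‖LSeries (fun n ↦ (Nat.card {I : Ideal (𝓞 K) // Ideal.absNorm I = n} : ℂ)) σ‖ ^ 3 *
      ‖LSeries (fun n ↦ (Nat.card {I : Ideal (𝓞 K) // Ideal.absNorm I = n} : ℂ))
        (σ + t * I)‖ ^ 4 *
      ‖LSeries (fun n ↦ (Nat.card {I : Ideal (𝓞 K) // Ideal.absNorm I = n} : ℂ))
        (σ + 2 * t * I)‖ := by
  have hp {s : ℂ} (hs : 1 < s.re) : LSeries (fun n ↦ (Nat.card {I : Ideal (𝓞 K) //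
        Ideal.absNorm I = n} : ℂ)) s ≠ 0 ∧
      Tendsto (fun S : Finset {P : Ideal (𝓞 K) // Prime P} ↦
        ∏ P ∈ S, ‖1 - (Ideal.absNorm P.1 : ℂ) ^ (-s)‖) atTop (𝓝 ‖LSeries (fun n ↦
          (Nat.card {I : Ideal (𝓞 K) // Ideal.absNorm I = n} : ℂ)) s‖⁻¹) := by
    have hs0 : s ≠ 0 := by rintro rfl; simp at hs; linarith
    have h := dedekindZetaSeries_eq_lseries K hs
    have h1 := hasProd_one_sub_prime (absNormCpow K hs0) h.summable
    have h2 := tsum_ne_zero_of_summable (absNormCpow K hs0) h.summable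
    rw [← h.tsum_eq]
    refine ⟨h2, ?_⟩
    rw [← norm_inv]
    have h3 := h1.norm
    exact h3
  obtain ⟨a1, b1⟩ := hp (s := σ) (by simpa using hσ)
  obtain ⟨a2, b2⟩ := hp (s := σ + t * I) (by simpa using hσ)
  obtain ⟨a3, b3⟩ := hp (s := σ + 2 * t * I) (by simpa using hσ)
  have h := le_of_tendsto (((b1.pow 3).mul (b2.pow 4)).mul b3) (b := 1) (.of_forall fun S ↦ by
    rw [← Finset.prod_pow, ← Finset.prod_pow, ← Finset.prod_mul_distrib, ← Finset.prod_mul_distrib]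
    refine Finset.prod_le_one (fun P _ ↦ by positivity) fun P _ ↦ ?_
    have hn0 : Ideal.absNorm P.1 ≠ 0 := by
      rw [Ne, Ideal.absNorm_eq_zero_iff]
      exact P.2.ne_zero
    have hn1 : Ideal.absNorm P.1 ≠ 1 := by
      rw [Ne, Ideal.absNorm_eq_one_iff, ← Ideal.isUnit_iff]
      exact P.2.not_isUnit
    set n := Ideal.absNorm P.1
    have hn2 : 1 < (n : ℝ) := by exact_mod_cast (show 1 < n by omega)
    have hnc : (n : ℂ) ≠ 0 := by exact_mod_cast hn0
    have e1 : (n : ℂ) ^ (-(σ : ℂ)) = ((n : ℝ) ^ (-σ) : ℝ) := by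
      rw [ofReal_cpow (by positivity)]; simp
    have e2 : (n : ℂ) ^ (-(σ + t * I : ℂ)) = ((n : ℝ) ^ (-σ) : ℝ) * (n : ℂ) ^ (-(t * I) : ℂ) := by
      rw [neg_add, cpow_add _ _ hnc, e1]
    have e3 : (n : ℂ) ^ (-(σ + 2 * t * I : ℂ)) =
        ((n : ℝ) ^ (-σ) : ℝ) * ((n : ℂ) ^ (-(t * I) : ℂ)) ^ 2 := by
      rw [neg_add, cpow_add _ _ hnc, e1, ← cpow_nat_mul]
      congr 2; push_cast; ring
    rw [e1, e2, e3]
    refine one_le_norm_product_of_norm_lt_one (by positivity)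
      (Real.rpow_lt_one_of_one_lt_of_neg hn2 (by linarith)) ?_
    rw [norm_natCast_cpow_of_pos (by omega)]
    simp)
  have p1 := norm_pos_iff.mpr a1
  have p2 := norm_pos_iff.mpr a2
  have p3 := norm_pos_iff.mpr a3
  rw [inv_pow, inv_pow, ← mul_inv, ← mul_inv, inv_le_one₀ (by positivity)] at h
  exact h

end

section MeanValue
open MeasureTheory Filter Topology ComplexConjugate

theorem sum_range_inv_sq_one_add_mul_abs_le {α : ℝ} (hα : 0 < α) (n N : ℕ) :
    ∑ m ∈ Finset.range N, ((1 + α * |(m : ℝ) - n|) ^ 2)⁻¹ ≤ 1 + 2 / α := by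
  let g : ℝ → ℝ := fun x ↦ if x ≤ 0 then α⁻¹ * (1 - α * x)⁻¹
    else 1 + 2 / α - α⁻¹ * (1 + α * (x - 1))⁻¹
  have hstep (m : ℕ) : ((1 + α * |(m : ℝ) - n|) ^ 2)⁻¹ ≤
      g ((m + 1 : ℕ) - n) - g ((m : ℝ) - n) := by
    have key (y : ℝ) (hy : 1 ≤ y) :
        ((1 + α * y) ^ 2)⁻¹ ≤ α⁻¹ * (1 + α * (y - 1))⁻¹ - α⁻¹ * (1 + α * y)⁻¹ := by
      have h1 : 0 < 1 + α * y := by nlinarith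
      have h2 : 0 < 1 + α * (y - 1) := by nlinarith
      have : α⁻¹ * (1 + α * (y - 1))⁻¹ - α⁻¹ * (1 + α * y)⁻¹ =
          ((1 + α * (y - 1)) * (1 + α * y))⁻¹ := by
        field_simp; ring
      rw [this]
      refine inv_anti₀ (by positivity) ?_
      nlinarith
    rcases lt_trichotomy m n with h | h | h
    · have h1 : (m : ℝ) + 1 ≤ n := by exact_mod_cast h
      have h2 : ((m + 1 : ℕ) : ℝ) - n ≤ 0 := by push_cast; linarith
      have h3 : (m : ℝ) - n ≤ 0 := by linarith
      simp only [g, if_pos h2, if_pos h3, abs_of_nonpos h3]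
      convert key (-((m : ℝ) - n)) (by linarith) using 4
      · push_cast; ring
      · ring
    · subst h
      have e1 : ((m + 1 : ℕ) : ℝ) - m = 1 := by push_cast; ring
      have e2 : ¬ (1 : ℝ) ≤ 0 := by norm_num
      simp only [g, e1, sub_self, if_neg e2, le_refl, if_true]
      apply le_of_eq
      simp
      field_simp; ring
    · have h1 : (n : ℝ) + 1 ≤ m := by exact_mod_cast h
      have h2 : ¬ ((m + 1 : ℕ) : ℝ) - n ≤ 0 := by push_cast; linarith
      have h3 : ¬ (m : ℝ) - n ≤ 0 := by linarith
      simp only [g, if_neg h2, if_neg h3]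
      rw [abs_of_nonneg (by linarith)]
      refine (key ((m : ℝ) - n) (by linarith)).trans (le_of_eq ?_)
      have : ((m + 1 : ℕ) : ℝ) - n - 1 = m - n := by push_cast; ring
      rw [this]; ring
  have h1 : ∑ m ∈ Finset.range N, ((1 + α * |(m : ℝ) - n|) ^ 2)⁻¹ ≤
      g (N - n) - g ((0 : ℕ) - n) := by
    refine (Finset.sum_le_sum fun m _ ↦ hstep m).trans (le_of_eq ?_)
    exact Finset.sum_range_sub (fun m : ℕ ↦ g (m - n)) N
  have h2 : 0 ≤ g ((0 : ℕ) - n) := by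
    have : ((0 : ℕ) : ℝ) - n ≤ 0 := by simp
    simp only [g, if_pos this]
    have : 0 ≤ α * n := by positivity
    have : 0 ≤ 1 - α * (((0 : ℕ) : ℝ) - n) := by push_cast; linarith
    positivity
  have h3 : g (N - n) ≤ 1 + 2 / α := by
    simp only [g]
    split_ifs with h
    · have : α⁻¹ * (1 - α * ((N : ℝ) - n))⁻¹ ≤ α⁻¹ * 1 := by
        gcongr
        exact inv_le_one_of_one_le₀ (by nlinarith)
      have h5 : 0 < α⁻¹ := by positivity
      rw [div_eq_mul_inv]; linarith
    · have h6 : (1 : ℝ) ≤ N - n := by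
        have : (n : ℝ) < N := by linarith
        have : n + 1 ≤ N := by exact_mod_cast this
        have : (n : ℝ) + 1 ≤ N := by exact_mod_cast this
        linarith
      have : 0 ≤ 1 + α * ((N : ℝ) - n - 1) := by
        have : 0 ≤ α * ((N : ℝ) - n - 1) := mul_nonneg hα.le (by linarith)
        linarith
      have : 0 ≤ α⁻¹ * (1 + α * ((N : ℝ) - n - 1))⁻¹ := by positivity
      linarith
  push_cast at h1 h2
  linarith

theorem exp_neg_sq_log_sub_log_le {T : ℝ} (hT : 2 ≤ T) (m n : ℕ) :
    Real.exp (-(T * (Real.log (m + 1) - Real.log (n + 1))) ^ 2 / 4) ≤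
      Real.exp 1 * ((1 + T / (2 * (n + 1)) * |(m : ℝ) - n|) ^ 2)⁻¹ := by
  have hy (y : ℝ) : -y ^ 2 / 4 ≤ 1 - |y| := by
    have := sq_abs y
    nlinarith [sq_nonneg (|y| - 2)]
  have h1 : Real.exp (-(T * (Real.log (m + 1) - Real.log (n + 1))) ^ 2 / 4) ≤
      Real.exp 1 * Real.exp (-(T * |Real.log (m + 1) - Real.log (n + 1)|)) := by
    rw [← Real.exp_add]
    refine Real.exp_le_exp.mpr ((hy _).trans (le_of_eq ?_))
    rw [abs_mul, abs_of_nonneg (by linarith : 0 ≤ T)]; ring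
  refine h1.trans ?_
  gcongr
  rw [Real.exp_neg]
  refine inv_anti₀ (by positivity) ?_
  have key (p q : ℝ) (hp : 0 < p) (hpq : p ≤ q) :
      1 + T / 2 * ((q - p) / p) ≤ Real.exp (T / 2 * (Real.log q - Real.log p)) := by
    rw [← Real.log_div (by linarith) hp.ne', mul_comm (T / 2) (Real.log _),
      ← Real.rpow_def_of_pos (div_pos (by linarith) hp)]
    have := one_add_mul_self_le_rpow_one_add (s := (q - p) / p) (p := T / 2)
      (by have : 0 ≤ (q - p) / p := div_nonneg (by linarith) hp.le
          linarith) (by linarith)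
    convert this using 2
    field_simp; ring
  have h2 : 1 + T / (2 * (n + 1)) * |(m : ℝ) - n| ≤
      Real.exp (T / 2 * |Real.log (m + 1) - Real.log (n + 1)|) := by
    rcases le_total m n with h | h
    · have h' : (m : ℝ) ≤ n := by exact_mod_cast h
      rw [abs_sub_comm, abs_of_nonneg (sub_nonneg.mpr h'), abs_sub_comm, abs_of_nonneg
        (sub_nonneg.mpr (Real.log_le_log (by positivity) (by linarith)))]
      refine le_trans ?_ (key (m + 1) (n + 1) (by positivity) (by linarith))
      have : ((n : ℝ) - m) / (n + 1) ≤ (n - m) / (m + 1) :=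
        div_le_div_of_nonneg_left (by linarith) (by positivity) (by linarith)
      have e1 : T / (2 * ((n : ℝ) + 1)) * (n - m) = T / 2 * ((n - m) / (n + 1)) := by
        field_simp
      rw [e1]
      have e2 : ((n : ℝ) + 1 - (m + 1)) = n - m := by ring
      rw [e2]
      gcongr
    · have h' : (n : ℝ) ≤ m := by exact_mod_cast h
      rw [abs_of_nonneg (sub_nonneg.mpr h'), abs_of_nonneg
        (sub_nonneg.mpr (Real.log_le_log (by positivity) (by linarith)))]
      refine le_trans (le_of_eq ?_) (key (n + 1) (m + 1) (by positivity) (by linarith))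
      field_simp; ring
  calc (1 + T / (2 * (n + 1)) * |(m : ℝ) - n|) ^ 2
      ≤ Real.exp (T / 2 * |Real.log (m + 1) - Real.log (n + 1)|) ^ 2 := by
        have : 0 ≤ T / (2 * ((n : ℝ) + 1)) * |(m : ℝ) - n| := by positivity
        gcongr
    _ = _ := by
      rw [← Real.exp_nat_mul]; congr 1; push_cast; ring

theorem integrable_exp_neg_sq_div {T : ℝ} (hT : 0 < T) :
    Integrable fun t : ℝ ↦ Real.exp (-(t / T) ^ 2) := by
  convert integrable_exp_neg_mul_sq (b := (T ^ 2)⁻¹) (by positivity) using 3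
  field_simp

theorem integral_gaussian_mul_cexp {T : ℝ} (hT : 0 < T) (y : ℝ) :
    Integrable (fun t : ℝ ↦ Real.exp (-(t / T) ^ 2) * cexp (I * y * t)) ∧
    ‖∫ t : ℝ, Real.exp (-(t / T) ^ 2) * cexp (I * y * t)‖ =
      T * √Real.pi * Real.exp (-(T * y) ^ 2 / 4) := by
  have hb : 0 < ((T : ℂ) ^ 2)⁻¹.re := by
    rw [← ofReal_pow, ← ofReal_inv, ofReal_re]; positivity
  have e (t : ℝ) : Real.exp (-(t / T) ^ 2) * cexp (I * y * t) =
      cexp (I * y * t) * cexp (-((T : ℂ) ^ 2)⁻¹ * t ^ 2) := by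
    rw [mul_comm, ofReal_exp]
    congr 2
    push_cast
    field_simp
  constructor
  · refine (integrable_exp_neg_sq_div hT).mono' (by fun_prop) (.of_forall fun t ↦ le_of_eq ?_)
    rw [norm_mul, norm_real, Real.norm_of_nonneg (Real.exp_pos _).le, norm_exp]
    simp
  simp_rw [e]
  rw [fourierIntegral_gaussian hb, norm_mul, norm_exp]
  congr 1
  · rw [show (Real.pi : ℂ) / ((T : ℂ) ^ 2)⁻¹ = ((Real.pi * T ^ 2 : ℝ) : ℂ) by push_cast; field_simp,
      show (1 / 2 : ℂ) = ((1 / 2 : ℝ) : ℂ) by push_cast; rfl, ← ofReal_cpow (by positivity),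
      norm_real, ← Real.sqrt_eq_rpow, Real.sqrt_mul' _ (by positivity), Real.sqrt_sq hT.le,
      Real.norm_of_nonneg (by positivity), mul_comm]
  · congr 1
    rw [show (-(y : ℂ) ^ 2 / (4 * ((T : ℂ) ^ 2)⁻¹)) = ((-(T * y) ^ 2 / 4 : ℝ) : ℂ) by
      push_cast; field_simp, ofReal_re]

end MeanValue

section MeanValue
open MeasureTheory Filter Topology ComplexConjugate

theorem continuous_tsum_mul_cexp {c : ℕ → ℂ} (l : ℕ → ℝ) (hc : Summable fun n ↦ ‖c n‖) :
    Continuous fun t : ℝ ↦ ∑' n, c n * cexp (-(I * l n * t)) := by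
  refine continuous_tsum (fun n ↦ by fun_prop) hc fun n t ↦ le_of_eq ?_
  rw [norm_mul, norm_exp]
  simp

theorem norm_tsum_mul_cexp_le {c : ℕ → ℂ} (l : ℕ → ℝ) (hc : Summable fun n ↦ ‖c n‖) (t : ℝ) :
    ‖∑' n, c n * cexp (-(I * l n * t))‖ ≤ ∑' n, ‖c n‖ := by
  refine tsum_of_norm_bounded hc.hasSum fun n ↦ le_of_eq ?_
  rw [norm_mul, norm_exp]
  simp

theorem integrable_gaussian_mul_normSq_tsum {c : ℕ → ℂ} (l : ℕ → ℝ)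
    (hc : Summable fun n ↦ ‖c n‖) {T : ℝ} (hT : 0 < T) :
    Integrable fun t : ℝ ↦ Real.exp (-(t / T) ^ 2) * ‖∑' n, c n * cexp (-(I * l n * t))‖ ^ 2 := by
  refine (integrable_exp_neg_sq_div hT).mul_bdd (c := (∑' n, ‖c n‖) ^ 2)
    ((continuous_tsum_mul_cexp l hc).norm.pow 2).aestronglyMeasurable (.of_forall fun t ↦ ?_)
  rw [norm_pow, norm_norm]
  exact pow_le_pow_left₀ (norm_nonneg _) (norm_tsum_mul_cexp_le l hc t) 2

theorem integral_gaussian_mul_normSq_tsum_le {c : ℕ → ℂ} (l : ℕ → ℝ)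
    (hc : Summable fun n ↦ ‖c n‖) {T : ℝ} (hT : 0 < T) :
    Summable (fun p : ℕ × ℕ ↦ ‖c p.1‖ * ‖c p.2‖ *
      (T * √Real.pi * Real.exp (-(T * (l p.1 - l p.2)) ^ 2 / 4))) ∧
    ∫ t : ℝ, Real.exp (-(t / T) ^ 2) * ‖∑' n, c n * cexp (-(I * l n * t))‖ ^ 2 ≤
      ∑' p : ℕ × ℕ, ‖c p.1‖ * ‖c p.2‖ *
        (T * √Real.pi * Real.exp (-(T * (l p.1 - l p.2)) ^ 2 / 4)) := by
  have hcc : Summable fun p : ℕ × ℕ ↦ ‖c p.1‖ * ‖c p.2‖ :=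
    hc.mul_of_nonneg hc (fun _ ↦ norm_nonneg _) fun _ ↦ norm_nonneg _
  have hsum : Summable (fun p : ℕ × ℕ ↦ ‖c p.1‖ * ‖c p.2‖ *
      (T * √Real.pi * Real.exp (-(T * (l p.1 - l p.2)) ^ 2 / 4))) := by
    refine (hcc.mul_right (T * √Real.pi)).of_nonneg_of_le (fun p ↦ by positivity) fun p ↦ ?_
    refine mul_le_mul_of_nonneg_left ?_ (by positivity)
    refine mul_le_of_le_one_right (by positivity) (Real.exp_le_one_iff.mpr ?_)
    have := sq_nonneg (T * (l p.1 - l p.2))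
    linarith
  refine ⟨hsum, ?_⟩
  let G : ℕ × ℕ → ℝ → ℂ := fun p t ↦ c p.1 * conj (c p.2) *
    (Real.exp (-(t / T) ^ 2) * cexp (I * (l p.2 - l p.1 : ℝ) * t))
  have hGn (p : ℕ × ℕ) (t : ℝ) : ‖G p t‖ = ‖c p.1‖ * ‖c p.2‖ * Real.exp (-(t / T) ^ 2) := by
    simp only [G, norm_mul, norm_real, Real.norm_of_nonneg (Real.exp_pos _).le, norm_exp,
      RCLike.norm_conj]
    simp
  have hGi (p : ℕ × ℕ) : Integrable (G p) :=
    (integral_gaussian_mul_cexp hT _).1.const_mul _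
  have hGs : Summable fun p ↦ ∫ t, ‖G p t‖ := by
    simp_rw [hGn, integral_const_mul]
    exact hcc.mul_right _
  have hG := hasSum_integral_of_summable_integral_norm hGi hGs
  have hF (t : ℝ) : ∑' p, G p t =
      ((Real.exp (-(t / T) ^ 2) * ‖∑' n, c n * cexp (-(I * l n * t))‖ ^ 2 : ℝ) : ℂ) := by
    have hs : Summable fun n ↦ ‖c n * cexp (-(I * l n * t))‖ := by
      refine hc.congr fun n ↦ ?_
      rw [norm_mul, norm_exp]
      simp
    have hs' : Summable fun n ↦ ‖conj (c n * cexp (-(I * l n * t)))‖ := by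
      simpa only [RCLike.norm_conj] using hs
    push_cast
    rw [← Complex.mul_conj', conj_tsum, tsum_mul_tsum_of_summable_norm hs hs', ← tsum_mul_left]
    refine tsum_congr fun p ↦ ?_
    simp only [G, map_mul, ← exp_conj, map_neg, conj_I, conj_ofReal]
    have : cexp (I * (l p.2 - l p.1 : ℝ) * t) =
        cexp (-(I * l p.1 * t)) * cexp (-(-I * l p.2 * t)) := by
      rw [← Complex.exp_add]; congr 1; push_cast; ring
    rw [this]
    push_cast
    ring
  simp_rw [hF] at hG
  rw [integral_complex_ofReal] at hG
  have h1 := hG.norm_le_of_bounded hsum.hasSum fun p ↦ by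
    simp only [G]
    rw [integral_const_mul, norm_mul, (integral_gaussian_mul_cexp hT _).2, norm_mul,
      RCLike.norm_conj]
    apply le_of_eq
    congr 4
    ring
  rw [norm_real] at h1
  exact (le_abs_self _).trans h1

theorem tsum_mul_mul_kernel_le {b : ℕ → ℝ} {k : ℕ → ℕ → ℝ} {W : ℕ → ℝ}
    (hk : ∀ m n, 0 ≤ k m n) (hsymm : ∀ m n, k m n = k n m)
    (hW : ∀ n N, ∑ m ∈ Finset.range N, k m n ≤ W n) (hs : Summable fun n ↦ b n ^ 2 * W n)
    (hbs : Summable fun p : ℕ × ℕ ↦ b p.1 * b p.2 * k p.1 p.2) :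
    ∑' p : ℕ × ℕ, b p.1 * b p.2 * k p.1 p.2 ≤ ∑' n, b n ^ 2 * W n := by
  have hk1 (n : ℕ) : Summable fun m ↦ k m n := summable_of_sum_range_le (fun m ↦ hk m n) (hW n)
  have hk2 (n : ℕ) : ∑' m, k m n ≤ W n := Real.tsum_le_of_sum_range_le (fun m ↦ hk m n) (hW n)
  have h0 : Summable fun p : ℕ × ℕ ↦ b p.1 ^ 2 * k p.1 p.2 := by
    rw [summable_prod_of_nonneg fun p ↦ mul_nonneg (sq_nonneg _) (hk _ _)]
    refine ⟨fun n ↦ ?_, ?_⟩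
    · simp_rw [hsymm n]
      exact (hk1 n).mul_left _
    · refine hs.of_nonneg_of_le (fun n ↦ tsum_nonneg fun m ↦ mul_nonneg (sq_nonneg _) (hk _ _))
        fun n ↦ ?_
      simp_rw [hsymm n]
      rw [tsum_mul_left]
      exact mul_le_mul_of_nonneg_left (hk2 n) (sq_nonneg _)
  have h0' : Summable fun p : ℕ × ℕ ↦ b p.2 ^ 2 * k p.1 p.2 := by
    have := (Equiv.prodComm ℕ ℕ).summable_iff.mpr h0
    refine this.congr fun p ↦ ?_
    simp [hsymm p.1 p.2]
  have e1 : ∑' p : ℕ × ℕ, b p.1 ^ 2 * k p.1 p.2 ≤ ∑' n, b n ^ 2 * W n := by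
    rw [h0.tsum_prod]
    refine h0.prod.tsum_le_tsum (fun n ↦ ?_) hs
    simp_rw [hsymm n]
    rw [tsum_mul_left]
    exact mul_le_mul_of_nonneg_left (hk2 n) (sq_nonneg _)
  have e2 : ∑' p : ℕ × ℕ, b p.2 ^ 2 * k p.1 p.2 = ∑' p : ℕ × ℕ, b p.1 ^ 2 * k p.1 p.2 := by
    rw [← (Equiv.prodComm ℕ ℕ).tsum_eq]
    refine tsum_congr fun p ↦ ?_
    simp [hsymm p.1 p.2]
  have e3 : ∑' p : ℕ × ℕ, b p.1 * b p.2 * k p.1 p.2 ≤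
      ∑' p : ℕ × ℕ, (b p.1 ^ 2 * k p.1 p.2 + b p.2 ^ 2 * k p.1 p.2) / 2 :=
    hbs.tsum_le_tsum (fun p ↦ by nlinarith [sq_nonneg (b p.1 - b p.2), hk p.1 p.2])
      ((h0.add h0').div_const 2)
  rw [tsum_div_const, h0.tsum_add h0', e2] at e3
  linarith

theorem integral_normSq_lseries_le {a : ℕ → ℂ} {i : ℕ}
    (ha : ∀ n ≠ 0, ‖a n‖ ≤ (n.divisors.card : ℝ) ^ i) :
    ∃ C : ℝ, ∀ T : ℝ, 2 ≤ T → ∀ σ : ℝ, 1 < σ → σ ≤ 2 →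
      ∫ t in (0 : ℝ)..T, ‖LSeries a (σ + t * I)‖ ^ 2 ≤
        C * (T + (σ - 1)⁻¹ ^ 2 ^ (2 * i)) := by
  let E : ℝ := Real.exp 1 * √Real.pi * Real.exp 1
  refine ⟨E * (4 * (3 / 2) ^ 2 ^ (2 * i) + 2 ^ 2 ^ (2 * i)), fun T hT σ hσ hσ' ↦ ?_⟩
  have hT0 : 0 < T := by linarith
  let c : ℕ → ℂ := fun n ↦ LSeries.term a σ (n + 1)
  let l : ℕ → ℝ := fun n ↦ Real.log (n + 1)
  have hcσ : LSeriesSummable a σ := (lseriesSummable_of_norm_le ha (by simpa using hσ)).1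
  have hc : Summable fun n ↦ ‖c n‖ :=
    (summable_nat_add_iff (f := fun n ↦ ‖LSeries.term a σ n‖) 1).mpr hcσ.norm
  have hF (t : ℝ) : LSeries a (σ + t * I) = ∑' n, c n * cexp (-(I * l n * t)) := by
    have h1 : LSeriesSummable a (σ + t * I) :=
      (lseriesSummable_of_norm_le ha (by simpa using hσ)).1
    rw [LSeries, h1.tsum_eq_zero_add, LSeries.term_zero, zero_add]
    refine tsum_congr fun n ↦ ?_
    have hn : ((n + 1 : ℕ) : ℂ) ≠ 0 := by exact_mod_cast n.succ_ne_zero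
    simp only [c, l]
    rw [LSeries.term_of_ne_zero n.succ_ne_zero, LSeries.term_of_ne_zero n.succ_ne_zero,
      cpow_add _ _ hn, div_mul_eq_div_div, div_eq_mul_inv _ (_ ^ (t * I : ℂ)), ← cpow_neg,
      cpow_def_of_ne_zero hn (-(t * I : ℂ))]
    congr 2
    rw [← natCast_log]
    push_cast
    ring
  let k : ℕ → ℕ → ℝ := fun m n ↦ T * √Real.pi * Real.exp (-(T * (l m - l n)) ^ 2 / 4)
  let W : ℕ → ℝ := fun n ↦ √Real.pi * Real.exp 1 * (T + 4 * ((n + 1 : ℕ) : ℝ))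
  have hW (n N : ℕ) : ∑ m ∈ Finset.range N, k m n ≤ W n := by
    have hα : 0 < T / (2 * ((n : ℝ) + 1)) := by positivity
    have h1 := sum_range_inv_sq_one_add_mul_abs_le hα n N
    calc ∑ m ∈ Finset.range N, k m n ≤ ∑ m ∈ Finset.range N, T * √Real.pi * (Real.exp 1 *
          ((1 + T / (2 * (n + 1)) * |(m : ℝ) - n|) ^ 2)⁻¹) := by
          refine Finset.sum_le_sum fun m _ ↦ ?_
          refine mul_le_mul_of_nonneg_left (exp_neg_sq_log_sub_log_le hT m n) (by positivity)
      _ = T * √Real.pi * Real.exp 1 * ∑ m ∈ Finset.range N,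
          ((1 + T / (2 * (n + 1)) * |(m : ℝ) - n|) ^ 2)⁻¹ := by
          simp_rw [← mul_assoc]; rw [← Finset.mul_sum]
      _ ≤ T * √Real.pi * Real.exp 1 * (1 + 2 / (T / (2 * ((n : ℝ) + 1)))) := by gcongr
      _ = W n := by
        simp only [W]; push_cast; field_simp; ring
  have ha2 : ∀ n ≠ 0, ‖(‖a n‖ ^ 2 : ℂ)‖ ≤ (n.divisors.card : ℝ) ^ (2 * i) := fun n hn ↦ by
    rw [norm_pow, norm_real, norm_norm, mul_comm, pow_mul]
    exact pow_le_pow_left₀ (norm_nonneg _) (ha n hn) 2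
  have hL (x : ℝ) (hx : 1 < x) := lseriesSummable_of_norm_le ha2 (s := (x : ℂ)) (by simpa using hx)
  have hcn (n : ℕ) : ‖c n‖ ^ 2 * T ≤ T * ‖LSeries.term (fun n ↦ (‖a n‖ ^ 2 : ℂ)) (2 : ℝ) (n + 1)‖ ∧
      ‖c n‖ ^ 2 * ((n + 1 : ℕ) : ℝ) =
        ‖LSeries.term (fun n ↦ (‖a n‖ ^ 2 : ℂ)) (2 * σ - 1 : ℝ) (n + 1)‖ := by
    have hn : (1 : ℝ) ≤ ((n + 1 : ℕ) : ℝ) := by exact_mod_cast n.succ_pos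
    have hn0 : (0 : ℝ) < ((n + 1 : ℕ) : ℝ) := by linarith
    simp only [c, LSeries.norm_term_eq, if_neg n.succ_ne_zero, ofReal_re, norm_pow, norm_real,
      norm_norm]
    have e : ((((n + 1 : ℕ) : ℝ) ^ σ) ^ 2) = ((n + 1 : ℕ) : ℝ) ^ (2 * σ) := by
      rw [mul_comm, Real.rpow_mul hn0.le]; norm_cast
    constructor
    · rw [mul_comm, div_pow, e]
      gcongr
      linarith
    · rw [div_pow, e, Real.rpow_sub_one hn0.ne']
      field_simp
  have hs2 := (summable_nat_add_iff (f := fun n ↦ ‖LSeries.term (fun n ↦ (‖a n‖ ^ 2 : ℂ))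
    (2 : ℝ) n‖) 1).mpr (hL 2 (by norm_num)).1.norm
  have hs3 := (summable_nat_add_iff (f := fun n ↦ ‖LSeries.term (fun n ↦ (‖a n‖ ^ 2 : ℂ))
    (2 * σ - 1 : ℝ) n‖) 1).mpr (hL (2 * σ - 1) (by linarith)).1.norm
  have hsh (x : ℝ) (hx : 1 < x) : ∑' n, ‖LSeries.term (fun n ↦ (‖a n‖ ^ 2 : ℂ)) (x : ℝ) (n + 1)‖ ≤
      (x / (x - 1)) ^ 2 ^ (2 * i) := by
    have := (hL x hx).2
    rw [(hL x hx).1.norm.tsum_eq_zero_add, LSeries.term_zero, norm_zero, zero_add, ofReal_re] at this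
    exact this
  have hb (n : ℕ) : ‖c n‖ ^ 2 * W n ≤ √Real.pi * Real.exp 1 *
      (T * ‖LSeries.term (fun n ↦ (‖a n‖ ^ 2 : ℂ)) (2 : ℝ) (n + 1)‖ +
        4 * ‖LSeries.term (fun n ↦ (‖a n‖ ^ 2 : ℂ)) (2 * σ - 1 : ℝ) (n + 1)‖) := by
    rw [← (hcn n).2]
    have := (hcn n).1
    simp only [W]
    have e : ‖c n‖ ^ 2 * (√Real.pi * Real.exp 1 * (T + 4 * ((n + 1 : ℕ) : ℝ))) =
      √Real.pi * Real.exp 1 * (‖c n‖ ^ 2 * T + 4 * (‖c n‖ ^ 2 * ((n + 1 : ℕ) : ℝ))) := by ring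
    rw [e]
    gcongr
  have hbs := ((hs2.mul_left T).add (hs3.mul_left 4)).mul_left (√Real.pi * Real.exp 1)
  have hs : Summable fun n ↦ ‖c n‖ ^ 2 * W n :=
    hbs.of_nonneg_of_le (fun n ↦ by simp only [W]; positivity) hb
  have htot : ∑' n, ‖c n‖ ^ 2 * W n ≤ √Real.pi * Real.exp 1 *
      (T * 2 ^ 2 ^ (2 * i) + 4 * ((3 / 2) ^ 2 ^ (2 * i) * (σ - 1)⁻¹ ^ 2 ^ (2 * i))) := by
    refine (hs.tsum_le_tsum hb hbs).trans ?_
    rw [tsum_mul_left, (hs2.mul_left T).tsum_add (hs3.mul_left 4), tsum_mul_left, tsum_mul_left]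
    have h2 := hsh 2 (by norm_num)
    have h3 := hsh (2 * σ - 1) (by linarith)
    gcongr
    · refine h2.trans (le_of_eq ?_); norm_num
    · refine h3.trans ?_
      rw [← mul_pow]
      have : 0 < σ - 1 := by linarith
      refine pow_le_pow_left₀ (div_nonneg (by linarith) (by linarith)) ?_ _
      rw [show (2 * σ - 1 - 1) = 2 * (σ - 1) by ring]
      rw [div_le_iff₀ (by positivity)]
      field_simp
      linarith
  obtain ⟨g1, g2⟩ := integral_gaussian_mul_normSq_tsum_le l hc hT0
  have g3 := tsum_mul_mul_kernel_le (b := fun n ↦ ‖c n‖) (k := k) (W := W)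
    (fun m n ↦ by simp only [k]; positivity)
    (fun m n ↦ by simp only [k]; congr 4; ring) hW hs g1
  have gi := integrable_gaussian_mul_normSq_tsum l hc hT0
  have g4 : ∫ t in (0 : ℝ)..T, ‖LSeries a (σ + t * I)‖ ^ 2 ≤ Real.exp 1 *
      ∫ t : ℝ, Real.exp (-(t / T) ^ 2) * ‖∑' n, c n * cexp (-(I * l n * t))‖ ^ 2 := by
    rw [intervalIntegral.integral_of_le hT0.le, ← integral_const_mul]
    refine le_trans ?_ (setIntegral_le_integral (s := Set.Ioc 0 T) (gi.const_mul _)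
      (.of_forall fun t ↦ by positivity))
    simp_rw [hF]
    refine setIntegral_mono_on ?_ (gi.const_mul _).integrableOn measurableSet_Ioc fun t ht ↦ ?_
    · exact ((continuous_tsum_mul_cexp l hc).norm.pow 2).integrableOn_Ioc
    · rw [← mul_assoc, ← Real.exp_add]
      refine le_mul_of_one_le_left (by positivity) (Real.one_le_exp ?_)
      have h1 : t / T ≤ 1 := (div_le_one hT0).mpr ht.2
      have h2 : 0 ≤ t / T := div_nonneg ht.1.le hT0.le
      nlinarith
  have hx : 0 ≤ (σ - 1)⁻¹ ^ 2 ^ (2 * i) := pow_nonneg (inv_nonneg.mpr (by linarith)) _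
  calc _ ≤ Real.exp 1 * (√Real.pi * Real.exp 1 *
      (T * 2 ^ 2 ^ (2 * i) + 4 * ((3 / 2) ^ 2 ^ (2 * i) * (σ - 1)⁻¹ ^ 2 ^ (2 * i)))) := by
        refine g4.trans ?_
        gcongr
        exact (g2.trans g3).trans htot
    _ = E * (2 ^ 2 ^ (2 * i) * T + 4 * (3 / 2) ^ 2 ^ (2 * i) * (σ - 1)⁻¹ ^ 2 ^ (2 * i)) := by
      simp only [E]; ring
    _ ≤ E * (4 * (3 / 2) ^ 2 ^ (2 * i) + 2 ^ 2 ^ (2 * i)) * (T + (σ - 1)⁻¹ ^ 2 ^ (2 * i)) := by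
      rw [mul_assoc E]
      have hE : 0 ≤ E := by positivity
      have p1 : (0 : ℝ) ≤ 4 * (3 / 2) ^ 2 ^ (2 * i) := by positivity
      have p2 : (0 : ℝ) ≤ 2 ^ 2 ^ (2 * i) := by positivity
      refine mul_le_mul_of_nonneg_left ?_ hE
      nlinarith [mul_nonneg p1 hT0.le, mul_nonneg p2 hx]

end MeanValue

section LatticeSum
open MeasureTheory Module Submodule
open scoped Pointwise

variable {E : Type*} [NormedAddCommGroup E] [NormedSpace ℝ E] [FiniteDimensional ℝ E]
  {ι : Type*} [Fintype ι] (b : Basis ι ℝ E)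

theorem finite_support_comp_smul {f : E → ℝ} {B : ℝ} (hB : ∀ x, B ≤ ‖x‖ → f x = 0) {R : ℝ}
    (hR : 0 < R) :
    (Function.support fun v : span ℤ (Set.range b) ↦ f (R⁻¹ • (v : E))).Finite := by
  have h := ZSpan.setFinite_inter b (Metric.isBounded_ball (x := (0 : E)) (r := B * R))
  refine Set.Finite.of_finite_image (f := ((↑) : span ℤ (Set.range b) → E)) (h.subset ?_)
    Subtype.val_injective.injOn
  rintro _ ⟨v, hv, rfl⟩
  refine ⟨?_, v.2⟩
  rw [mem_ball_zero_iff]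
  by_contra! hh
  refine hv (hB _ ?_)
  rw [norm_smul, norm_inv, Real.norm_of_nonneg hR.le, ← div_eq_inv_mul]
  exact (le_div_iff₀ hR).mpr hh

theorem exists_abs_tsum_lattice_sub_le {f : E → ℝ} {A B : ℝ} (hB : ∀ x, B ≤ ‖x‖ → f x = 0)
    (hA : ∀ x y, |f x - f y| ≤ A * ‖x - y‖) :
    ∃ c C : ℝ, ∀ R : ℝ, 1 ≤ R →
      |∑' v : span ℤ (Set.range b), f (R⁻¹ • (v : E)) - c * R ^ finrank ℝ E| ≤
        C * (R ^ finrank ℝ E / R) := by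
  borelize E
  let μ : Measure E := Measure.addHaar
  have : VAddInvariantMeasure (span ℤ (Set.range b)) E μ :=
    ⟨fun v s _ ↦ measure_preimage_add μ (v : E) s⟩
  have hfund := ZSpan.isAddFundamentalDomain b μ
  set F := ZSpan.fundamentalDomain b
  obtain ⟨ρ, hρ0, hρ⟩ := (ZSpan.fundamentalDomain_isBounded b).exists_pos_norm_le
  have hF0 : μ F ≠ 0 := ZSpan.measure_fundamentalDomain_ne_zero b
  have hFtop : μ F ≠ ⊤ := (ZSpan.fundamentalDomain_isBounded b).measure_lt_top.ne
  have hFpos : 0 < μ.real F := ENNReal.toReal_pos hF0 hFtop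
  have hFm : MeasurableSet F := ZSpan.fundamentalDomain_measurableSet b
  have hA' : 0 ≤ |A| := abs_nonneg A
  have hA2 (x y : E) : |f x - f y| ≤ |A| * ‖x - y‖ :=
    (hA x y).trans (mul_le_mul_of_nonneg_right (le_abs_self A) (norm_nonneg _))
  have hfc : Continuous f := by
    have : LipschitzWith (Real.toNNReal |A|) f :=
      LipschitzWith.of_dist_le_mul fun x y ↦ by
        rw [Real.dist_eq, dist_eq_norm, Real.coe_toNNReal _ hA']; exact hA2 x y
    exact this.continuous
  have hcs {g : E → ℝ} {r : ℝ} (hg : ∀ x, r ≤ ‖x‖ → g x = 0) : HasCompactSupport g :=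
    HasCompactSupport.intro (isCompact_closedBall (0 : E) r) fun x hx ↦ hg x <| by
      rw [mem_closedBall_zero_iff, not_le] at hx; exact hx.le
  let B' := max B 0 + ρ
  have hB'0 : 0 ≤ B' := by positivity
  refine ⟨(∫ x, f x ∂μ) / μ.real F, |A| * ρ * (μ.real (Metric.ball 0 B')) / μ.real F,
    fun R hR ↦ ?_⟩
  have hR0 : 0 < R := by linarith
  have hRn : ‖R⁻¹‖ = R⁻¹ := Real.norm_of_nonneg (by positivity)
  let g : E → ℝ := fun x ↦ f (R⁻¹ • x)
  have hgc : Continuous g := hfc.comp (continuous_const_smul _)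
  have hg0 (x : E) (hx : B * R ≤ ‖x‖) : g x = 0 := hB _ <| by
    rw [norm_smul, hRn, ← div_eq_inv_mul]; exact (le_div_iff₀ hR0).mpr hx
  have hgi : Integrable g μ := hgc.integrable_of_hasCompactSupport (hcs hg0)
  let U : Set E := Metric.ball 0 (B' * R)
  have hUm : MeasurableSet U := Metric.isOpen_ball.measurableSet
  have hUi : Integrable (U.indicator (fun _ ↦ (1 : ℝ))) μ :=
    (integrable_indicator_iff hUm).mpr (integrableOn_const measure_ball_lt_top.ne)
  have e1 := hfund.integral_eq_tsum'' g hgi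
  have e2 := hfund.integral_eq_tsum'' _ hUi
  have hsf : (Function.support fun v : span ℤ (Set.range b) ↦ g (v : E)).Finite :=
    finite_support_comp_smul b hB hR0
  have hkey (v : span ℤ (Set.range b)) (x : E) (hx : x ∈ F) :
      |g (v +ᵥ x) - g v| ≤ |A| * ρ / R * U.indicator (fun _ ↦ (1 : ℝ)) (v +ᵥ x) := by
    have hxρ : ‖x‖ ≤ ρ := hρ x hx
    have hv : (v +ᵥ x : E) = v + x := rfl
    rw [hv]
    by_cases hU : (v : E) + x ∈ U
    · rw [Set.indicator_of_mem hU, mul_one]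
      refine (hA2 _ _).trans ?_
      rw [← smul_sub, add_sub_cancel_left, norm_smul, hRn, div_eq_mul_inv, mul_assoc,
        mul_comm R⁻¹]
      gcongr
    · rw [Set.indicator_of_notMem hU, mul_zero]
      simp only [U, mem_ball_zero_iff, not_lt] at hU
      have h1 : B * R ≤ (max B 0) * R := by gcongr; exact le_max_left _ _
      have h2 : ρ ≤ ρ * R := le_mul_of_one_le_right hρ0.le hR
      have h3 : ‖(v : E) + x‖ ≤ ‖(v : E)‖ + ‖x‖ := norm_add_le _ _
      have h4 : B' * R = max B 0 * R + ρ * R := by simp only [B']; ring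
      rw [hg0 _ (by linarith), hg0 _ (by linarith), sub_zero, abs_zero]
  have hfin1 : (Function.support fun v : span ℤ (Set.range b) ↦ ∫ x in F, g (v +ᵥ x) ∂μ).Finite ∧
      (Function.support fun v : span ℤ (Set.range b) ↦
        ∫ x in F, U.indicator (fun _ ↦ (1 : ℝ)) (v +ᵥ x) ∂μ).Finite := by
    have h := ZSpan.setFinite_inter b (Metric.isBounded_ball (x := (0 : E)) (r := B' * R + ρ))
    have h' : {v : span ℤ (Set.range b) | ‖(v : E)‖ < B' * R + ρ}.Finite := by
      refine Set.Finite.of_finite_image (f := ((↑) : span ℤ (Set.range b) → E)) (h.subset ?_)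
        Subtype.val_injective.injOn
      rintro _ ⟨v, hv, rfl⟩
      exact ⟨mem_ball_zero_iff.mpr hv, v.2⟩
    have hbig (v : span ℤ (Set.range b)) (hv : ¬ ‖(v : E)‖ < B' * R + ρ) (x : E) (hx : x ∈ F) :
        B' * R ≤ ‖(v : E) + x‖ := by
      have h3 : ‖(v : E)‖ ≤ ‖(v : E) + x‖ + ‖x‖ := by
        have := norm_sub_le ((v : E) + x) x
        rwa [add_sub_cancel_right] at this
      have := hρ x hx
      linarith
    have hBB : B * R ≤ B' * R := by
      gcongr
      simp only [B']
      linarith [le_max_left B 0]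
    constructor
    · refine h'.subset fun v hv ↦ by_contra fun hh ↦ hv ?_
      refine setIntegral_eq_zero_of_forall_eq_zero fun x hx ↦ hg0 _ ?_
      exact hBB.trans (hbig v hh x hx)
    · refine h'.subset fun v hv ↦ by_contra fun hh ↦ hv ?_
      refine setIntegral_eq_zero_of_forall_eq_zero fun x hx ↦ Set.indicator_of_notMem ?_ _
      simp only [U, mem_ball_zero_iff, not_lt]
      exact hbig v hh x hx
  have s0 : Summable fun v : span ℤ (Set.range b) ↦ g (v : E) := summable_of_hasFiniteSupport hsf
  have s1 : Summable fun v : span ℤ (Set.range b) ↦ ∫ x in F, g (v +ᵥ x) ∂μ :=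
    summable_of_hasFiniteSupport hfin1.1
  have s2 : Summable fun v : span ℤ (Set.range b) ↦
      ∫ x in F, U.indicator (fun _ ↦ (1 : ℝ)) (v +ᵥ x) ∂μ :=
    summable_of_hasFiniteSupport hfin1.2
  have hD (v : span ℤ (Set.range b)) : |∫ x in F, g (v +ᵥ x) ∂μ - μ.real F * g v| ≤
      |A| * ρ / R * ∫ x in F, U.indicator (fun _ ↦ (1 : ℝ)) (v +ᵥ x) ∂μ := by
    have i1 : IntegrableOn (fun x ↦ g (v +ᵥ x)) F μ :=
      (hgi.comp_add_left (v : E)).integrableOn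
    have i2 : IntegrableOn (fun x ↦ U.indicator (fun _ ↦ (1 : ℝ)) (v +ᵥ x)) F μ :=
      (hUi.comp_add_left (v : E)).integrableOn
    have i3 : ∫ x in F, g v ∂μ = μ.real F * g v := by
      rw [setIntegral_const, smul_eq_mul]
    rw [← i3, ← integral_sub i1 (integrableOn_const hFtop), ← integral_const_mul,
      ← Real.norm_eq_abs]
    refine norm_integral_le_of_norm_le (i2.const_mul _) ?_
    exact (ae_restrict_iff' hFm).mpr (.of_forall fun x hx ↦ hkey v x hx)
  have hsum : |∑' v : span ℤ (Set.range b), (∫ x in F, g (v +ᵥ x) ∂μ - μ.real F * g v)| ≤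
      |A| * ρ / R * ∫ x, U.indicator (fun _ ↦ (1 : ℝ)) x ∂μ := by
    rw [e2, ← tsum_mul_left]
    rw [← Real.norm_eq_abs]
    exact tsum_of_norm_bounded (s2.mul_left _).hasSum fun v ↦ by
      rw [Real.norm_eq_abs]; exact hD v
  rw [s1.tsum_sub (s0.mul_left _), ← e1, tsum_mul_left, integral_indicator hUm,
    setIntegral_const, smul_eq_mul, mul_one] at hsum
  have e3 : ∫ x, g x ∂μ = R ^ finrank ℝ E * ∫ x, f x ∂μ := by
    simp only [g]
    rw [Measure.integral_comp_inv_smul_of_nonneg μ f hR0.le, smul_eq_mul]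
  have e4 : μ.real U = R ^ finrank ℝ E * μ.real (Metric.ball 0 B') := by
    have h1 : U = R • Metric.ball (0 : E) B' := by
      rw [smul_ball hR0.ne', smul_zero, Real.norm_of_nonneg hR0.le, mul_comm]
    rw [h1, measureReal_def, Measure.addHaar_smul_of_nonneg μ hR0.le, ENNReal.toReal_mul,
      ENNReal.toReal_ofReal (by positivity)]
    rfl
  rw [e3, e4] at hsum
  have e5 : ∑' v : span ℤ (Set.range b), g v - (∫ x, f x ∂μ) / μ.real F * R ^ finrank ℝ E =
      -(R ^ finrank ℝ E * ∫ x, f x ∂μ - μ.real F * ∑' v : span ℤ (Set.range b), g v) /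
        μ.real F := by
    field_simp
    ring
  rw [e5, abs_div, abs_neg, abs_of_pos hFpos, div_le_iff₀ hFpos]
  refine hsum.trans (le_of_eq ?_)
  field_simp

end LatticeSum

section Cutoff

/-- The cutoff function `u ↦ u (1 - u)₊`. -/
noncomputable def cutoff (u : ℝ) : ℝ := u * max 0 (1 - u)

theorem cutoff_nonneg {u : ℝ} (hu : 0 ≤ u) : 0 ≤ cutoff u :=
  mul_nonneg hu (le_max_left _ _)

theorem cutoff_le_self {u : ℝ} (hu : 0 ≤ u) : cutoff u ≤ u :=
  mul_le_of_le_one_right hu (max_le zero_le_one (by linarith))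

theorem cutoff_eq_zero {u : ℝ} (hu : 1 ≤ u) : cutoff u = 0 := by
  rw [cutoff, max_eq_left (by linarith), mul_zero]

theorem cutoff_le_one {u : ℝ} (hu : 0 ≤ u) : cutoff u ≤ 1 := by
  rcases le_total 1 u with h | h
  · rw [cutoff_eq_zero h]; exact zero_le_one
  · exact (cutoff_le_self hu).trans h

theorem abs_cutoff_sub_le {u v : ℝ} (hu : 0 ≤ u) (hv : 0 ≤ v) :
    |cutoff u - cutoff v| ≤ |u - v| := by
  wlog huv : u ≤ v generalizing u v
  · rw [abs_sub_comm, abs_sub_comm u]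
    exact this hv hu (le_of_not_ge huv)
  rw [abs_sub_comm u, abs_of_nonneg (sub_nonneg.mpr huv), abs_le]
  rcases le_total 1 v with h1 | h1
  · rw [cutoff_eq_zero h1]
    have := cutoff_nonneg hu
    rcases le_total 1 u with h2 | h2
    · rw [cutoff_eq_zero h2]; constructor <;> linarith
    · rw [cutoff, max_eq_right (by linarith)]
      constructor <;> nlinarith
  · rw [cutoff, cutoff, max_eq_right (by linarith), max_eq_right (by linarith)]
    constructor <;> nlinarith

theorem exists_abs_prod_pow_sub_le {W : Type*} (m : W → ℕ) (M : ℝ) (s : Finset W) :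
    ∃ C, 0 ≤ C ∧ ∀ (p q : W → ℝ) (δ : ℝ), (∀ w, |p w| ≤ M) → (∀ w, |q w| ≤ M) →
      (∀ w, |p w - q w| ≤ δ) → |∏ w ∈ s, p w ^ m w - ∏ w ∈ s, q w ^ m w| ≤ C * δ := by
  classical
  have hmul (F G : (W → ℝ) → ℝ) (hF : ∃ C, 0 ≤ C ∧ ∀ (p q : W → ℝ) (δ : ℝ), (∀ w, |p w| ≤ M) →
      (∀ w, |q w| ≤ M) → (∀ w, |p w - q w| ≤ δ) → |F p - F q| ≤ C * δ)
      (hG : ∃ C, 0 ≤ C ∧ ∀ (p q : W → ℝ) (δ : ℝ), (∀ w, |p w| ≤ M) →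
      (∀ w, |q w| ≤ M) → (∀ w, |p w - q w| ≤ δ) → |G p - G q| ≤ C * δ)
      (hFb : ∃ B, 0 ≤ B ∧ ∀ p : W → ℝ, (∀ w, |p w| ≤ M) → |F p| ≤ B)
      (hGb : ∃ B, 0 ≤ B ∧ ∀ p : W → ℝ, (∀ w, |p w| ≤ M) → |G p| ≤ B) :
      ∃ C, 0 ≤ C ∧ ∀ (p q : W → ℝ) (δ : ℝ), (∀ w, |p w| ≤ M) →
      (∀ w, |q w| ≤ M) → (∀ w, |p w - q w| ≤ δ) → |F p * G p - F q * G q| ≤ C * δ := by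
    obtain ⟨C1, h1, hF⟩ := hF
    obtain ⟨C2, h2, hG⟩ := hG
    obtain ⟨B1, h3, hFb⟩ := hFb
    obtain ⟨B2, h4, hGb⟩ := hGb
    refine ⟨C1 * B2 + B1 * C2, by positivity, fun p q δ hp hq hpq ↦ ?_⟩
    have e : F p * G p - F q * G q = (F p - F q) * G p + F q * (G p - G q) := by ring
    rw [e]
    refine (abs_add_le _ _).trans ?_
    rw [abs_mul, abs_mul]
    have a1 := hF p q δ hp hq hpq
    have a2 := hG p q δ hp hq hpq
    have a3 := mul_le_mul a1 (hGb p hp) (abs_nonneg _) ((abs_nonneg _).trans a1)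
    have a4 := mul_le_mul (hFb q hq) a2 (abs_nonneg _) h3
    nlinarith
  have hb (t : Finset W) : ∃ B, 0 ≤ B ∧ ∀ p : W → ℝ, (∀ w, |p w| ≤ M) →
      |∏ w ∈ t, p w ^ m w| ≤ B := by
    refine ⟨∏ w ∈ t, |M| ^ m w, by positivity, fun p hp ↦ ?_⟩
    rw [Finset.abs_prod]
    refine Finset.prod_le_prod (fun _ _ ↦ abs_nonneg _) fun w _ ↦ ?_
    rw [abs_pow]
    exact pow_le_pow_left₀ (abs_nonneg _) ((hp w).trans (le_abs_self M)) _
  have hpb (w : W) (k : ℕ) : ∃ B, 0 ≤ B ∧ ∀ p : W → ℝ, (∀ w, |p w| ≤ M) → |p w ^ k| ≤ B := by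
    refine ⟨|M| ^ k, by positivity, fun p hp ↦ ?_⟩
    rw [abs_pow]
    exact pow_le_pow_left₀ (abs_nonneg _) ((hp w).trans (le_abs_self M)) _
  have hpow (w : W) (k : ℕ) : ∃ C, 0 ≤ C ∧ ∀ (p q : W → ℝ) (δ : ℝ), (∀ w, |p w| ≤ M) →
      (∀ w, |q w| ≤ M) → (∀ w, |p w - q w| ≤ δ) → |p w ^ k - q w ^ k| ≤ C * δ := by
    induction k with
    | zero => exact ⟨0, le_rfl, fun p q δ _ _ _ ↦ by simp⟩
    | succ k ih =>
      simp_rw [pow_succ]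
      refine hmul (fun p ↦ p w ^ k) (fun p ↦ p w) ih ⟨1, zero_le_one, fun p q δ _ _ h ↦ ?_⟩
        (hpb w k) ?_
      · simpa using h w
      · simpa using hpb w 1
  induction s using Finset.induction_on with
  | empty => exact ⟨0, le_rfl, fun p q δ _ _ _ ↦ by simp⟩
  | insert w s hw ih =>
    simp_rw [Finset.prod_insert hw]
    exact hmul (fun p ↦ p w ^ m w) (fun p ↦ ∏ w ∈ s, p w ^ m w) (hpow w _) ih (hpb w _) (hb s)

end Cutoff

section LogCutoff

variable {W : Type*} [Fintype W] (m : W → ℕ) (w₀ : W) [Fintype {w // w ≠ w₀}]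

/-- Logarithmic coordinates, normalized to be invariant under scaling. -/
noncomputable def logCoord (p : W → ℝ) : {w // w ≠ w₀} → ℝ := fun w ↦
  m w * (Real.log (p w) - Real.log (∏ w, p w ^ m w) * ((∑ w, m w : ℕ) : ℝ)⁻¹)

/-- The cutoff of the norm multiplied by a function of the logarithmic coordinates. -/
noncomputable def logCutoff (ψ : ({w // w ≠ w₀} → ℝ) → ℝ) (p : W → ℝ) : ℝ :=
  cutoff (∏ w, p w ^ m w) * ψ (logCoord m w₀ p)

theorem abs_log_sub_log_le_of_norm_logCoord_le (hm : ∀ w, 1 ≤ m w) {p : W → ℝ}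
    (hp : ∀ w, 0 < p w) {B : ℝ} (hB : ‖logCoord m w₀ p‖ ≤ B) (w : W) :
    |Real.log (p w) - Real.log (∏ w, p w ^ m w) * ((∑ w, m w : ℕ) : ℝ)⁻¹| ≤
      (Fintype.card W + 1) * B := by
  classical
  have hB0 : 0 ≤ B := (norm_nonneg _).trans hB
  set L := Real.log (∏ w, p w ^ m w) * ((∑ w, m w : ℕ) : ℝ)⁻¹ with hL
  have hn : (0 : ℝ) < ((∑ w, m w : ℕ) : ℝ) := by
    have : m w ≤ ∑ w, m w := Finset.single_le_sum (fun _ _ ↦ Nat.zero_le _) (Finset.mem_univ w)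
    exact_mod_cast (hm w).trans this
  have hsum : ∑ w, m w * (Real.log (p w) - L) = 0 := by
    simp_rw [mul_sub]
    rw [Finset.sum_sub_distrib, ← Finset.sum_mul, hL, Real.log_prod (fun w _ ↦ (pow_pos (hp w) _).ne')]
    simp_rw [Real.log_pow]
    push_cast at hn ⊢
    field_simp
    ring
  have h1 (w : W) (hw : w ≠ w₀) : |m w * (Real.log (p w) - L)| ≤ B :=
    (norm_le_pi_norm (logCoord m w₀ p) ⟨w, hw⟩).trans hB
  have hle (w : W) : |Real.log (p w) - L| ≤ |m w * (Real.log (p w) - L)| := by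
    rw [abs_mul, Nat.abs_cast]
    exact le_mul_of_one_le_left (abs_nonneg _) (by exact_mod_cast hm w)
  refine (hle w).trans ?_
  by_cases hw : w = w₀
  · subst hw
    rw [← Finset.add_sum_erase _ _ (Finset.mem_univ w), add_eq_zero_iff_eq_neg] at hsum
    rw [hsum, abs_neg]
    refine (Finset.abs_sum_le_sum_abs _ _).trans ?_
    refine (Finset.sum_le_card_nsmul _ _ B fun v hv ↦ h1 v (Finset.ne_of_mem_erase hv)).trans ?_
    rw [nsmul_eq_mul]
    gcongr
    have := Finset.card_erase_le (s := (Finset.univ : Finset W)) (a := w)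
    rw [Finset.card_univ] at this
    have : (((Finset.univ : Finset W).erase w).card : ℝ) ≤ Fintype.card W := by exact_mod_cast this
    linarith
  · refine (h1 w hw).trans (le_mul_of_one_le_left hB0 ?_)
    have : (0 : ℝ) ≤ Fintype.card W := by positivity
    linarith

theorem bounds_of_logCutoff_ne_zero (hm : ∀ w, 1 ≤ m w) {ψ : ({w // w ≠ w₀} → ℝ) → ℝ} {B : ℝ}
    (hψB : ∀ u, ψ u ≠ 0 → ‖u‖ ≤ B) {p : W → ℝ} (hp : ∀ w, 0 ≤ p w)
    (h : logCutoff m w₀ ψ p ≠ 0) (w : W) :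
    0 < p w ∧ p w ≤ Real.exp ((Fintype.card W + 1) * B) ∧
      ∏ w, p w ^ m w ≤ Real.exp ((Fintype.card W + 1) * B) * p w := by
  obtain ⟨h1, h2⟩ := mul_ne_zero_iff.mp h
  have hN0 : ∏ w, p w ^ m w ≠ 0 := by
    intro h0; rw [h0] at h1; simp [cutoff] at h1
  have hN1 : ∏ w, p w ^ m w ≤ 1 := by
    by_contra! hh; exact h1 (cutoff_eq_zero hh.le)
  have hNpos : 0 < ∏ w, p w ^ m w :=
    lt_of_le_of_ne (Finset.prod_nonneg fun w _ ↦ pow_nonneg (hp w) _) hN0.symm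
  have hpos (w : W) : 0 < p w := by
    refine lt_of_le_of_ne (hp w) fun h0 ↦ hN0 (Finset.prod_eq_zero (Finset.mem_univ w) ?_)
    rw [← h0, zero_pow (by have := hm w; omega)]
  have hab := abs_le.mp (abs_log_sub_log_le_of_norm_logCoord_le m w₀ hm hpos (hψB _ h2) w)
  have hlog : Real.log (∏ w, p w ^ m w) ≤ 0 := Real.log_nonpos hNpos.le hN1
  have hn : (1 : ℝ) ≤ ((∑ w, m w : ℕ) : ℝ) := by
    have : m w ≤ ∑ w, m w := Finset.single_le_sum (fun _ _ ↦ Nat.zero_le _) (Finset.mem_univ w)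
    exact_mod_cast (hm w).trans this
  have hinv : ((∑ w, m w : ℕ) : ℝ)⁻¹ ≤ 1 := inv_le_one_of_one_le₀ hn
  have hinv0 : 0 ≤ ((∑ w, m w : ℕ) : ℝ)⁻¹ := by positivity
  refine ⟨hpos w, ?_, ?_⟩
  · rw [← Real.log_le_iff_le_exp (hpos w)]
    nlinarith
  · rw [← Real.log_le_log_iff hNpos (mul_pos (Real.exp_pos _) (hpos w)), Real.log_mul
      (Real.exp_pos _).ne' (hpos w).ne', Real.log_exp]
    nlinarith

theorem abs_log_sub_log_le_of_half_le {a b : ℝ} (ha : 0 < a) (hab : a / 2 ≤ b) :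
    |Real.log a - Real.log b| ≤ 2 / a * |a - b| := by
  have hb : 0 < b := by linarith
  have h1 : Real.log a - Real.log b ≤ (a - b) / b := by
    rw [← Real.log_div ha.ne' hb.ne']
    have := Real.log_le_sub_one_of_pos (div_pos ha hb)
    rw [sub_div, div_self hb.ne']; linarith
  have h2 : Real.log b - Real.log a ≤ (b - a) / a := by
    rw [← Real.log_div hb.ne' ha.ne']
    have := Real.log_le_sub_one_of_pos (div_pos hb ha)
    rw [sub_div, div_self ha.ne']; linarith
  have h3 : (a - b) / b ≤ 2 / a * |a - b| := by
    have : (a - b) / b ≤ |a - b| / b := by gcongr; exact le_abs_self _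
    refine this.trans ?_
    rw [div_eq_inv_mul]
    gcongr
    rw [inv_le_comm₀ hb (by positivity), inv_div]
    exact hab
  have h4 : (b - a) / a ≤ 2 / a * |a - b| := by
    rw [abs_sub_comm, div_eq_inv_mul]
    have : b - a ≤ |b - a| := le_abs_self _
    have h5 : a⁻¹ ≤ 2 / a := by rw [div_eq_mul_inv]; nlinarith [inv_pos.mpr ha]
    have : a⁻¹ * (b - a) ≤ a⁻¹ * |b - a| := by gcongr
    refine this.trans (by gcongr)
  rw [abs_le]; constructor <;> linarith

theorem exists_abs_logCutoff_sub_le (hm : ∀ w, 1 ≤ m w) {ψ : ({w // w ≠ w₀} → ℝ) → ℝ} {A B : ℝ}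
    (hψ0 : ∀ u, 0 ≤ ψ u) (hψ1 : ∀ u, ψ u ≤ 1) (hψB : ∀ u, ψ u ≠ 0 → ‖u‖ ≤ B)
    (hψA : ∀ u v, |ψ u - ψ v| ≤ A * ‖u - v‖) :
    ∃ C, ∀ (p q : W → ℝ) (δ : ℝ), (∀ w, 0 ≤ p w) → (∀ w, 0 ≤ q w) → (∀ w, |p w - q w| ≤ δ) →
      |logCutoff m w₀ ψ p - logCutoff m w₀ ψ q| ≤ C * δ := by
  classical
  set D := Real.exp ((Fintype.card W + 1) * B) with hD
  have hDpos : 0 < D := Real.exp_pos _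
  obtain ⟨C₁, hC₁, hN⟩ := exists_abs_prod_pow_sub_le m (D + 1) (Finset.univ : Finset W)
  set n : ℝ := ((∑ w, m w : ℕ) : ℝ) with hn
  have hmn (w : W) : (m w : ℝ) ≤ n :=
    Nat.cast_le.mpr (Finset.single_le_sum (f := m) (fun _ _ ↦ Nat.zero_le _) (Finset.mem_univ w))
  have hn1 : (1 : ℝ) ≤ n := (Nat.one_le_cast.mpr (hm w₀)).trans (hmn w₀)
  set C := 1 + C₁ + |A| * (n * (4 * D)) + 2 * D with hC
  have hNn {p : W → ℝ} (hp : ∀ w, 0 ≤ p w) : 0 ≤ ∏ w, p w ^ m w :=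
    Finset.prod_nonneg fun w _ ↦ pow_nonneg (hp w) _
  have hf01 {p : W → ℝ} (hp : ∀ w, 0 ≤ p w) : 0 ≤ logCutoff m w₀ ψ p ∧ logCutoff m w₀ ψ p ≤ 1 :=
    ⟨mul_nonneg (cutoff_nonneg (hNn hp)) (hψ0 _),
      mul_le_one₀ (cutoff_le_one (hNn hp)) (hψ0 _) (hψ1 _)⟩
  have key (p q : W → ℝ) (δ : ℝ) (hp : ∀ w, 0 ≤ p w) (hq : ∀ w, 0 ≤ q w)
      (hpq : ∀ w, |p w - q w| ≤ δ) (hf : logCutoff m w₀ ψ p ≠ 0) :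
      |logCutoff m w₀ ψ p - logCutoff m w₀ ψ q| ≤ C * δ := by
    have hδ : 0 ≤ δ := (abs_nonneg _).trans (hpq w₀)
    have hb := bounds_of_logCutoff_ne_zero m w₀ hm hψB hp hf
    rw [← hD] at hb
    rcases le_or_gt 1 δ with h1 | h1
    · have a1 := hf01 hp
      have a2 := hf01 hq
      have : |logCutoff m w₀ ψ p - logCutoff m w₀ ψ q| ≤ 1 := by
        rw [abs_le]; constructor <;> linarith
      have h0 : 0 ≤ |A| * (n * (4 * D)) := by positivity
      have : 1 ≤ C := by rw [hC]; linarith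
      nlinarith
    set P := ∏ w, p w ^ m w
    set Q := ∏ w, q w ^ m w
    have e : logCutoff m w₀ ψ p - logCutoff m w₀ ψ q = (cutoff P - cutoff Q) *
      ψ (logCoord m w₀ q) + cutoff P * (ψ (logCoord m w₀ p) - ψ (logCoord m w₀ q)) := by
      simp only [logCutoff, P, Q]; ring
    have t1 : |(cutoff P - cutoff Q) * ψ (logCoord m w₀ q)| ≤ C₁ * δ := by
      rw [abs_mul, abs_of_nonneg (hψ0 _)]
      refine (mul_le_of_le_one_right (abs_nonneg _) (hψ1 _)).trans ?_
      refine (abs_cutoff_sub_le (hNn hp) (hNn hq)).trans ?_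
      refine hN p q δ (fun w ↦ ?_) (fun w ↦ ?_) hpq
      · rw [abs_of_nonneg (hp w)]; linarith [(hb w).2.1]
      · rw [abs_of_nonneg (hq w)]
        have := (abs_le.mp (hpq w)).1
        linarith [(hb w).2.1]
    have hP0 : 0 ≤ P := hNn hp
    have t2 : |cutoff P * (ψ (logCoord m w₀ p) - ψ (logCoord m w₀ q))| ≤
        |A| * (n * (4 * D)) * δ + 2 * D * δ := by
      rw [abs_mul, abs_of_nonneg (cutoff_nonneg hP0)]
      have hcP := cutoff_le_self hP0
      by_cases hall : ∀ w, p w / 2 ≤ q w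
      · have hl (w : W) : P * |Real.log (p w) - Real.log (q w)| ≤ 2 * D * δ := by
          have h3 := abs_log_sub_log_le_of_half_le (hb w).1 (hall w)
          calc P * |Real.log (p w) - Real.log (q w)| ≤ (D * p w) * (2 / p w * δ) := by
                refine mul_le_mul (hb w).2.2 (h3.trans ?_) (abs_nonneg _)
                  (mul_nonneg hDpos.le (hp w))
                have := (hb w).1
                gcongr
                exact hpq w
            _ = 2 * D * δ := by
              have := (hb w).1.ne'
              field_simp
        have hqpos (w : W) : 0 < q w := by have := hall w; have := (hb w).1; linarith
        have hL : P * |Real.log P - Real.log Q| ≤ n * (2 * D * δ) := by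
          have e1 : Real.log P - Real.log Q = ∑ w, m w * (Real.log (p w) - Real.log (q w)) := by
            simp only [P, Q]
            rw [Real.log_prod (fun w _ ↦ (pow_pos (hb w).1 _).ne'),
              Real.log_prod (fun w _ ↦ (pow_pos (hqpos w) _).ne'), ← Finset.sum_sub_distrib]
            simp_rw [Real.log_pow, mul_sub]
          rw [e1]
          calc _ ≤ P * ∑ w, |m w * (Real.log (p w) - Real.log (q w))| := by
                gcongr; exact Finset.abs_sum_le_sum_abs _ _
            _ = ∑ w, m w * (P * |Real.log (p w) - Real.log (q w)|) := by
                rw [Finset.mul_sum]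
                refine Finset.sum_congr rfl fun w _ ↦ ?_
                rw [abs_mul, Nat.abs_cast]; ring
            _ ≤ ∑ w, m w * (2 * D * δ) := Finset.sum_le_sum fun w _ ↦ mul_le_mul_of_nonneg_left (hl w) (Nat.cast_nonneg _)
            _ = n * (2 * D * δ) := by rw [← Finset.sum_mul, hn]; push_cast; rfl
        have hco : P * ‖logCoord m w₀ p - logCoord m w₀ q‖ ≤ n * (4 * D) * δ := by
          rcases hP0.eq_or_lt with h0 | h0
          · rw [← h0, zero_mul]; positivity
          rw [← le_div_iff₀' h0, pi_norm_le_iff_of_nonneg (by positivity)]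
          intro w
          rw [le_div_iff₀' h0, Pi.sub_apply, Real.norm_eq_abs]
          have e2 : logCoord m w₀ p w - logCoord m w₀ q w = m w * ((Real.log (p w) -
              Real.log (q w)) - (Real.log P - Real.log Q) * n⁻¹) := by
            simp only [logCoord, P, Q, hn]; ring
          rw [e2, abs_mul, Nat.abs_cast]
          have h5 : P * |(Real.log (p w) - Real.log (q w)) - (Real.log P - Real.log Q) * n⁻¹| ≤
              2 * D * δ + 2 * D * δ := by
            refine (mul_le_mul_of_nonneg_left (abs_sub _ _) hP0).trans ?_
            rw [mul_add, abs_mul, ← mul_assoc, abs_of_nonneg (by positivity : 0 ≤ n⁻¹)]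
            refine add_le_add (hl w) ?_
            rw [← div_eq_mul_inv, div_le_iff₀ (by linarith)]
            linarith
          calc _ = m w * (P * |(Real.log (p w) - Real.log (q w)) -
              (Real.log P - Real.log Q) * n⁻¹|) := by ring
            _ ≤ n * (2 * D * δ + 2 * D * δ) :=
                mul_le_mul (hmn w) h5 (by positivity) (by linarith)
            _ = _ := by ring
        calc _ ≤ P * (|A| * ‖logCoord m w₀ p - logCoord m w₀ q‖) := by
              refine mul_le_mul hcP ((hψA _ _).trans ?_) (abs_nonneg _) hP0
              gcongr; exact le_abs_self A
          _ = |A| * (P * ‖logCoord m w₀ p - logCoord m w₀ q‖) := by ring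
          _ ≤ |A| * (n * (4 * D) * δ) := by gcongr
          _ ≤ _ := by
            have : 0 ≤ 2 * D * δ := by positivity
            linarith
      · push Not at hall
        obtain ⟨w, hw⟩ := hall
        have h3 : p w ≤ 2 * δ := by have := (abs_le.mp (hpq w)).2; linarith
        have h4 : |ψ (logCoord m w₀ p) - ψ (logCoord m w₀ q)| ≤ 1 := by
          have := hψ0 (logCoord m w₀ p); have := hψ1 (logCoord m w₀ p)
          have := hψ0 (logCoord m w₀ q); have := hψ1 (logCoord m w₀ q)
          rw [abs_le]; constructor <;> linarith
        calc _ ≤ P * 1 := mul_le_mul hcP h4 (abs_nonneg _) hP0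
          _ ≤ D * (2 * δ) := by
            rw [mul_one]
            exact (hb w).2.2.trans (by gcongr)
          _ ≤ _ := by
            have : 0 ≤ |A| * (n * (4 * D)) * δ := by positivity
            linarith
    rw [e]
    refine (abs_add_le _ _).trans ((add_le_add t1 t2).trans ?_)
    rw [hC]; linarith
  refine ⟨C, fun p q δ hp hq hpq ↦ ?_⟩
  have hδ : 0 ≤ δ := (abs_nonneg _).trans (hpq w₀)
  by_cases h1 : logCutoff m w₀ ψ p = 0
  · by_cases h2 : logCutoff m w₀ ψ q = 0
    · rw [h1, h2, sub_zero, abs_zero]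
      have : 0 ≤ |A| * (n * (4 * D)) := by positivity
      have : 0 ≤ C := by rw [hC]; linarith
      positivity
    · rw [abs_sub_comm]
      exact key q p δ hq hp (fun w ↦ by rw [abs_sub_comm]; exact hpq w) h2
  · exact key p q δ hp hq hpq h1

end LogCutoff

section Tent

/-- The tent function `u ↦ (1 - |u|)₊`. -/
noncomputable def tent (u : ℝ) : ℝ := max 0 (1 - |u|)

theorem tent_nonneg (u : ℝ) : 0 ≤ tent u := le_max_left _ _

theorem tent_le_one (u : ℝ) : tent u ≤ 1 := max_le zero_le_one (by linarith [abs_nonneg u])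

theorem abs_lt_one_of_tent_ne_zero {u : ℝ} (h : tent u ≠ 0) : |u| < 1 := by
  by_contra! hu
  exact h (max_eq_left (by linarith))

theorem abs_tent_sub_le (u v : ℝ) : |tent u - tent v| ≤ |u - v| := by
  refine (abs_max_sub_max_le_max _ _ _ _).trans (max_le (by simp) ?_)
  rw [sub_sub_sub_cancel_left, abs_sub_comm u]
  exact abs_abs_sub_abs_le _ _

theorem tent_add_tent (y : ℝ) : tent (y + (-⌊y⌋ : ℤ)) + tent (y + (-⌊y⌋ - 1 : ℤ)) = 1 := by
  have h1 := Int.floor_le y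
  have h2 := Int.lt_floor_add_one y
  push_cast
  rw [tent, tent, abs_of_nonneg (by linarith), abs_of_nonpos (by linarith),
    max_eq_right (by linarith), max_eq_right (by linarith)]
  ring

theorem hasSum_prod_tent {r : Type*} [Fintype r] (y : r → ℝ) :
    HasSum (fun e : r → ℤ ↦ ∏ i, tent (y i + e i)) 1 := by
  classical
  let S (i : r) : Finset ℤ := {-⌊y i⌋, -⌊y i⌋ - 1}
  have h : ∑ e ∈ Fintype.piFinset S, ∏ i, tent (y i + e i) = 1 := by
    rw [← Finset.prod_univ_sum (f := fun i (k : ℤ) ↦ tent (y i + k))]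
    refine Finset.prod_eq_one fun i _ ↦ ?_
    rw [Finset.sum_pair (by omega)]
    exact tent_add_tent (y i)
  rw [← h]
  refine hasSum_sum_of_ne_finset_zero fun e he ↦ ?_
  rw [Fintype.mem_piFinset] at he
  push Not at he
  obtain ⟨i, hi⟩ := he
  refine Finset.prod_eq_zero (Finset.mem_univ i) ?_
  by_contra h0
  have h1 := abs_lt.mp (abs_lt_one_of_tent_ne_zero h0)
  have h2 := Int.floor_le (y i)
  have h3 := Int.lt_floor_add_one (y i)
  refine hi ?_
  have h4 : -⌊y i⌋ - 2 < e i := by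
    have : ((-⌊y i⌋ - 2 : ℤ) : ℝ) < e i := by push_cast; linarith
    exact_mod_cast this
  have h5 : e i < -⌊y i⌋ + 1 := by
    have : (e i : ℝ) < ((-⌊y i⌋ + 1 : ℤ) : ℝ) := by push_cast; linarith
    exact_mod_cast this
  simp only [S, Finset.mem_insert, Finset.mem_singleton]
  omega

/-- The product of the tent functions of the coordinates in a basis. -/
noncomputable def basisTent {E r : Type*} [Fintype r] [AddCommGroup E] [Module ℝ E]
    (b : Module.Basis r ℝ E) (y : E) : ℝ := ∏ i, tent (b.repr y i)

variable {E r : Type*} [Fintype r] [NormedAddCommGroup E] [NormedSpace ℝ E]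
  (b : Module.Basis r ℝ E)

theorem basisTent_nonneg (y : E) : 0 ≤ basisTent b y := Finset.prod_nonneg fun _ _ ↦ tent_nonneg _

theorem basisTent_le_one (y : E) : basisTent b y ≤ 1 :=
  Finset.prod_le_one (fun _ _ ↦ tent_nonneg _) fun _ _ ↦ tent_le_one _

theorem norm_le_of_basisTent_ne_zero {y : E} (h : basisTent b y ≠ 0) : ‖y‖ ≤ ∑ i, ‖b i‖ := by
  rw [← b.sum_repr y]
  refine (norm_sum_le _ _).trans (Finset.sum_le_sum fun i _ ↦ ?_)
  rw [norm_smul]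
  have := abs_lt_one_of_tent_ne_zero (Finset.prod_ne_zero_iff.mp h i (Finset.mem_univ i))
  exact mul_le_of_le_one_left (norm_nonneg _) this.le

theorem exists_abs_basisTent_sub_le [FiniteDimensional ℝ E] :
    ∃ A, ∀ x y, |basisTent b x - basisTent b y| ≤ A * ‖x - y‖ := by
  obtain ⟨C, hC, h⟩ := exists_abs_prod_pow_sub_le (fun _ : r ↦ 1) 1 Finset.univ
  have hL (i : r) (x : E) : |b.repr x i| ≤ ‖(b.coord i).toContinuousLinearMap‖ * ‖x‖ :=
    (b.coord i).toContinuousLinearMap.le_opNorm x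
  refine ⟨C * ∑ i, ‖(b.coord i).toContinuousLinearMap‖, fun x y ↦ ?_⟩
  have h1 (u : ℝ) : |tent u| ≤ 1 := by rw [abs_of_nonneg (tent_nonneg u)]; exact tent_le_one u
  have := h (fun i ↦ tent (b.repr x i)) (fun i ↦ tent (b.repr y i))
    ((∑ i, ‖(b.coord i).toContinuousLinearMap‖) * ‖x - y‖) (fun _ ↦ h1 _) (fun _ ↦ h1 _)
    fun i ↦ ?_
  · simp only [pow_one] at this
    rw [mul_assoc]
    exact this
  · refine (abs_tent_sub_le _ _).trans ?_
    have h2 := hL i (x - y)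
    rw [map_sub, Finsupp.sub_apply] at h2
    refine h2.trans ?_
    gcongr
    exact Finset.single_le_sum (f := fun i ↦ ‖(b.coord i).toContinuousLinearMap‖)
      (fun _ _ ↦ norm_nonneg _) (Finset.mem_univ i)

end Tent

section MixedCutoff

open NumberField InfinitePlace mixedEmbedding fundamentalCone NumberField.Units
  NumberField.Units.dirichletUnitTheorem

open scoped Classical

variable (K : Type*) [Field K] [NumberField K]

theorem mixedEmbedding_norm_eq_prod (x : mixedSpace K) :
    mixedEmbedding.norm x = ∏ w, normAtPlace w x ^ mult w := rfl

/-- A partition of unity for the action of the units, cut off to norm at most one. -/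
noncomputable def mixedCutoff (x : mixedSpace K) : ℝ :=
  logCutoff mult w₀ (basisTent ((basisUnitLattice K).ofZLatticeBasis ℝ))
    fun w ↦ normAtPlace w x

theorem mixedCutoff_eq (x : mixedSpace K) : mixedCutoff K x =
    cutoff (mixedEmbedding.norm x) *
      basisTent ((basisUnitLattice K).ofZLatticeBasis ℝ) (logMap x) := by
  have : (logCoord mult w₀ fun w ↦ normAtPlace w x) = logMap x := by
    ext w
    rw [logCoord, logMap_apply, mixedEmbedding_norm_eq_prod, sum_mult_eq]
  rw [mixedCutoff, logCutoff, this, ← mixedEmbedding_norm_eq_prod]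

theorem abs_normAtPlace_sub_le (w : InfinitePlace K) (x y : mixedSpace K) :
    |normAtPlace w x - normAtPlace w y| ≤ ‖x - y‖ := by
  have h (z : mixedSpace K) : normAtPlace w z ≤ ‖z‖ := by
    rw [norm_eq_sup'_normAtPlace]
    exact Finset.le_sup' (fun w ↦ normAtPlace w z) (Finset.mem_univ w)
  rw [abs_le]
  have h1 := normAtPlace_add_le w (x - y) y
  have h2 := normAtPlace_add_le w (y - x) x
  have h3 := h (x - y)
  have h4 := h (y - x)
  rw [sub_add_cancel] at h1 h2
  rw [norm_sub_rev] at h4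
  constructor <;> linarith

theorem exists_mixedCutoff_eq_zero : ∃ B, ∀ x, B ≤ ‖x‖ → mixedCutoff K x = 0 := by
  refine ⟨Real.exp ((Fintype.card (InfinitePlace K) + 1) *
    ∑ i, ‖(basisUnitLattice K).ofZLatticeBasis ℝ _ i‖) + 1, fun x hx ↦ ?_⟩
  by_contra h
  have := bounds_of_logCutoff_ne_zero mult w₀ (fun w ↦ mult_pos)
    (fun u hu ↦ norm_le_of_basisTent_ne_zero _ hu) (fun w ↦ normAtPlace_nonneg w x) h
  rw [norm_eq_sup'_normAtPlace] at hx
  have h2 := Finset.sup'_le (Finset.univ_nonempty (α := InfinitePlace K))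
    (fun w ↦ normAtPlace w x) (fun w _ ↦ (this w).2.1)
  linarith

theorem exists_abs_mixedCutoff_sub_le :
    ∃ A, ∀ x y, |mixedCutoff K x - mixedCutoff K y| ≤ A * ‖x - y‖ := by
  obtain ⟨A, hA⟩ := exists_abs_basisTent_sub_le ((basisUnitLattice K).ofZLatticeBasis ℝ)
  obtain ⟨C, hC⟩ := exists_abs_logCutoff_sub_le (W := InfinitePlace K) mult w₀ (fun w ↦ mult_pos)
    (basisTent_nonneg ((basisUnitLattice K).ofZLatticeBasis ℝ)) (basisTent_le_one _)
    (fun u hu ↦ norm_le_of_basisTent_ne_zero _ hu) hA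
  exact ⟨C, fun x y ↦ hC _ _ _ (fun w ↦ normAtPlace_nonneg w x) (fun w ↦ normAtPlace_nonneg w y)
    fun w ↦ abs_normAtPlace_sub_le K w x y⟩

theorem hasSum_basisTent_units (y : logSpace K) :
    HasSum (fun u : (𝓞 K)ˣ ↦ basisTent ((basisUnitLattice K).ofZLatticeBasis ℝ)
      (logEmbedding K (Additive.ofMul u) + y)) (torsionOrder K) := by
  set b := (basisUnitLattice K).ofZLatticeBasis ℝ with hb
  let g : torsion K × (Fin (rank K) → ℤ) → (𝓞 K)ˣ :=
    fun p ↦ p.1 * ∏ i, fundSystem K i ^ p.2 i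
  have hg : Function.Bijective g := by
    rw [Function.bijective_iff_existsUnique]
    intro u
    obtain ⟨p, hp, hu⟩ := exist_unique_eq_mul_prod K u
    exact ⟨p, hp.symm, fun q hq ↦ hu q hq.symm⟩
  have : Fintype (torsion K) := Fintype.ofFinite _
  rw [← (Equiv.ofBijective g hg).hasSum_iff]
  have hlog (p : torsion K × (Fin (rank K) → ℤ)) :
      logEmbedding K (Additive.ofMul (g p)) = ∑ i, p.2 i • b i := by
    have h1 : logEmbedding K (Additive.ofMul ((p.1 : (𝓞 K)ˣ))) = 0 :=
      logEmbedding_eq_zero_iff.mpr p.1.2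
    simp only [g, ofMul_mul, map_add, h1, zero_add, ofMul_prod, map_sum, ofMul_zpow, map_zsmul,
      logEmbedding_fundSystem, hb, Module.Basis.ofZLatticeBasis_apply]
  have heq : (fun u : (𝓞 K)ˣ ↦ basisTent b (logEmbedding K (Additive.ofMul u) + y)) ∘
      (Equiv.ofBijective g hg) = fun p ↦ ∏ i, tent (b.repr y i + p.2 i) := by
    ext p
    simp only [Function.comp_apply, Equiv.ofBijective_apply, hlog, basisTent]
    refine Finset.prod_congr rfl fun i _ ↦ ?_
    congr 1
    rw [map_add, add_comm, Finsupp.add_apply]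
    congr 1
    simp_rw [← Int.cast_smul_eq_zsmul ℝ]
    exact b.repr_sum_self (fun i ↦ (p.2 i : ℝ)) ▸ rfl
  rw [heq]
  have h1 := hasSum_prod_tent fun i ↦ b.repr y i
  have h2 : Summable fun p : torsion K × (Fin (rank K) → ℤ) ↦
      ∏ i, tent (b.repr y i + p.2 i) := by
    rw [summable_prod_of_nonneg fun p ↦ Finset.prod_nonneg fun _ _ ↦ tent_nonneg _]
    exact ⟨fun _ ↦ h1.summable, (hasSum_fintype _).summable⟩
  have h3 := h2.hasSum.prod_fiberwise fun _ ↦ h1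
  have h4 : (∑' p : torsion K × (Fin (rank K) → ℤ), ∏ i, tent (b.repr y i + p.2 i)) =
      torsionOrder K := by
    refine h3.unique ?_
    have := hasSum_fintype fun _ : torsion K ↦ (1 : ℝ)
    simpa [torsionOrder, Nat.card_eq_fintype_card] using this
  rw [← h4]
  exact h2.hasSum

end MixedCutoff

section Unfolding

open NumberField InfinitePlace mixedEmbedding fundamentalCone NumberField.Units
  NumberField.Units.dirichletUnitTheorem nonZeroDivisors Ideal

open scoped Classical

variable (K : Type*) [Field K] [NumberField K]

theorem norm_mixedEmbedding_eq_absNorm (x : 𝓞 K) :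
    mixedEmbedding.norm (mixedEmbedding K (x : K)) = absNorm (span {x}) := by
  rw [norm_eq_norm, absNorm_span_singleton, Nat.cast_natAbs, ← Algebra.coe_norm_int]
  push_cast
  rfl

theorem hasSum_mixedCutoff_units {x : 𝓞 K} (hx : x ≠ 0) {R : ℝ} (hR : 0 < R) :
    HasSum (fun u : (𝓞 K)ˣ ↦ mixedCutoff K (R⁻¹ • mixedEmbedding K ((u * x : 𝓞 K) : K)))
      (torsionOrder K * cutoff (absNorm (span {x}) / R ^ Module.finrank ℚ K)) := by
  have hN : mixedEmbedding.norm (mixedEmbedding K (x : K)) ≠ 0 := by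
    rw [norm_mixedEmbedding_eq_absNorm, Nat.cast_ne_zero, Ne, absNorm_eq_zero_iff,
      span_singleton_eq_bot]
    exact hx
  have h1 (u : (𝓞 K)ˣ) : mixedCutoff K (R⁻¹ • mixedEmbedding K ((u * x : 𝓞 K) : K)) =
      cutoff (absNorm (span {x}) / R ^ Module.finrank ℚ K) *
        basisTent ((basisUnitLattice K).ofZLatticeBasis ℝ)
          (logEmbedding K (Additive.ofMul u) + logMap (mixedEmbedding K (x : K))) := by
    have e : mixedEmbedding K ((u * x : 𝓞 K) : K) = u • mixedEmbedding K (x : K) := by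
      rw [unitSMul_smul, ← map_mul]; simp
    have hN' : mixedEmbedding.norm (u • mixedEmbedding K (x : K)) ≠ 0 := by
      rwa [norm_unit_smul]
    rw [e, mixedCutoff_eq, logMap_real_smul hN' (inv_pos.mpr hR).ne', logMap_unit_smul u hN,
      mixedEmbedding.norm_smul, norm_unit_smul, norm_mixedEmbedding_eq_absNorm, abs_of_pos (inv_pos.mpr hR),
      inv_pow, inv_mul_eq_div]
  simp_rw [h1]
  rw [mul_comm (torsionOrder K : ℝ)]
  exact (hasSum_basisTent_units K _).mul_left _

theorem exists_generator_of_mk0_eq_inv {C : ClassGroup (𝓞 K)} {J : (Ideal (𝓞 K))⁰}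
    (hJ : ClassGroup.mk0 J = C⁻¹) (I : {I : (Ideal (𝓞 K))⁰ // ClassGroup.mk0 I = C}) :
    ∃ g : 𝓞 K, g ≠ 0 ∧ span {g} = (I : (Ideal (𝓞 K))⁰) * (J : Ideal (𝓞 K)) := by
  have h : ClassGroup.mk0 (I.1 * J) = 1 := by rw [map_mul, I.2, hJ, mul_inv_cancel]
  obtain ⟨g, hg⟩ := (ClassGroup.mk0_eq_one_iff (SetLike.coe_mem (I.1 * J))).mp h
  rw [← Ideal.span, Submonoid.coe_mul] at hg
  refine ⟨g, fun h0 ↦ ?_, hg.symm⟩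
  rw [h0, span_singleton_zero] at hg
  exact nonZeroDivisors.ne_zero (I.1 * J).2 hg

set_option maxHeartbeats 1000000 in
theorem hasSum_cutoff_class {C : ClassGroup (𝓞 K)} {J : (Ideal (𝓞 K))⁰}
    (hJ : ClassGroup.mk0 J = C⁻¹) {R X : ℝ} (hR : 0 < R)
    (hRX : R ^ Module.finrank ℚ K = X * absNorm (J : Ideal (𝓞 K))) :
    HasSum (fun I : {I : (Ideal (𝓞 K))⁰ // ClassGroup.mk0 I = C} ↦
      torsionOrder K * cutoff (absNorm (I.1 : Ideal (𝓞 K)) / X))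
      (∑' v : Submodule.span ℤ (Set.range
        (fractionalIdealLatticeBasis K (FractionalIdeal.mk0 K J))),
          mixedCutoff K (R⁻¹ • (v : mixedSpace K))) := by
  choose g hg0 hg using exists_generator_of_mk0_eq_inv K hJ
  obtain ⟨B, hB⟩ := exists_mixedCutoff_eq_zero K
  have hfin := finite_support_comp_smul (fractionalIdealLatticeBasis K (FractionalIdeal.mk0 K J))
    hB hR
  have hmem (p : {I : (Ideal (𝓞 K))⁰ // ClassGroup.mk0 I = C} × (𝓞 K)ˣ) :
      mixedEmbedding K ((p.2 * g p.1 : 𝓞 K) : K) ∈ Submodule.span ℤ (Set.range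
        (fractionalIdealLatticeBasis K (FractionalIdeal.mk0 K J))) := by
    rw [mem_span_fractionalIdealLatticeBasis]
    refine ⟨_, ?_, rfl⟩
    rw [FractionalIdeal.coe_mk0]
    refine ⟨p.2 * g p.1, ?_, rfl⟩
    refine Ideal.mul_mem_left _ _ ?_
    have : g p.1 ∈ ((p.1 : (Ideal (𝓞 K))⁰) * (J : Ideal (𝓞 K)) : Ideal (𝓞 K)) := by
      rw [← hg]; exact mem_span_singleton_self _
    exact Ideal.mul_le_right this
  let Φ (p : {I : (Ideal (𝓞 K))⁰ // ClassGroup.mk0 I = C} × (𝓞 K)ˣ) : Submodule.span ℤ (Set.range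
        (fractionalIdealLatticeBasis K (FractionalIdeal.mk0 K J))) := ⟨_, hmem p⟩
  have hJ0 : (J : Ideal (𝓞 K)) ≠ ⊥ := nonZeroDivisors.ne_zero J.2
  have hinj : Function.Injective Φ := by
    rintro ⟨I, u⟩ ⟨I', u'⟩ h
    have h1 : mixedEmbedding K ((u * g I : 𝓞 K) : K) = mixedEmbedding K ((u' * g I' : 𝓞 K) : K) :=
      congrArg Subtype.val h
    have h2 : (u * g I : 𝓞 K) = u' * g I' :=
      RingOfIntegers.ext (mixedEmbedding_injective K h1)
    have h3 : (I.1 : Ideal (𝓞 K)) * J = I'.1 * J := by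
      rw [← hg, ← hg, ← span_singleton_mul_left_unit u.isUnit, h2,
        span_singleton_mul_left_unit u'.isUnit]
    have h4 : I = I' := Subtype.ext (Subtype.ext (mul_right_cancel₀ hJ0 h3))
    subst h4
    rw [mul_left_inj' (hg0 I)] at h2
    rw [Units.ext h2]
  have hsupp : ∀ v, v ∉ Set.range Φ → mixedCutoff K (R⁻¹ • (v : mixedSpace K)) = 0 := by
    intro v hv
    by_cases hv0 : (v : mixedSpace K) = 0
    · rw [hv0, smul_zero, mixedCutoff_eq, map_zero, cutoff, zero_mul, zero_mul]
    refine absurd ?_ hv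
    obtain ⟨y, hy, hyv⟩ := (mem_span_fractionalIdealLatticeBasis K _).mp v.2
    rw [FractionalIdeal.coe_mk0] at hy
    obtain ⟨x, hx, rfl⟩ := hy
    have hx0 : x ≠ 0 := by
      rintro rfl
      apply hv0; rw [← hyv]; simp
    obtain ⟨I, hI⟩ := (dvd_span_singleton.mpr hx : (J : Ideal (𝓞 K)) ∣ span {x})
    have hI0 : I ≠ ⊥ := by
      rintro rfl
      rw [Ideal.mul_bot, span_singleton_eq_bot] at hI
      exact hx0 hI
    have hxm : span {x} ∈ (Ideal (𝓞 K))⁰ := by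
      rw [mem_nonZeroDivisors_iff_ne_zero, Ne, zero_eq_bot, span_singleton_eq_bot]; exact hx0
    let I' : (Ideal (𝓞 K))⁰ := ⟨I, mem_nonZeroDivisors_iff_ne_zero.mpr hI0⟩
    have hmk : ClassGroup.mk0 I' = C := by
      have h1 : ClassGroup.mk0 (J * I') = 1 := by
        have h2 : (J * I' : (Ideal (𝓞 K))⁰) = ⟨span {x}, hxm⟩ := Subtype.ext hI.symm
        rw [h2, ClassGroup.mk0_eq_one_iff]
        exact ⟨x, rfl⟩
      rw [map_mul, hJ, inv_mul_eq_one] at h1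
      exact h1.symm
    have hass : span {g ⟨I', hmk⟩} = span {x} := by
      rw [hg, hI, mul_comm]
    rw [span_singleton_eq_span_singleton] at hass
    obtain ⟨u, hu⟩ := hass
    refine ⟨⟨⟨I', hmk⟩, u⟩, Subtype.ext ?_⟩
    simp only [Φ]
    rw [mul_comm, hu]
    exact hyv
  have hs : Summable fun v : Submodule.span ℤ (Set.range
        (fractionalIdealLatticeBasis K (FractionalIdeal.mk0 K J))) ↦
          mixedCutoff K (R⁻¹ • (v : mixedSpace K)) := summable_of_hasFiniteSupport hfin
  have h := (hinj.hasSum_iff hsupp).mpr hs.hasSum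
  refine HasSum.prod_fiberwise h fun I ↦ ?_
  have := hasSum_mixedCutoff_units K (hg0 I) hR
  rw [hg, hRX, map_mul, Nat.cast_mul, mul_div_mul_right] at this
  · exact this
  · exact Nat.cast_ne_zero.mpr (absNorm_ne_zero_of_nonZeroDivisors J)

theorem exists_abs_tsum_cutoff_sub_le : ∃ c B, ∀ X : ℝ, 1 ≤ X →
    Summable (fun I : (Ideal (𝓞 K))⁰ ↦ cutoff (absNorm (I : Ideal (𝓞 K)) / X)) ∧
    |∑' I : (Ideal (𝓞 K))⁰, cutoff (absNorm (I : Ideal (𝓞 K)) / X) - c * X| ≤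
      B * X ^ (1 - (Module.finrank ℚ K : ℝ)⁻¹) := by
  have hn : 0 < Module.finrank ℚ K := Module.finrank_pos
  have hclass (C : ClassGroup (𝓞 K)) : ∃ c B, 0 ≤ B ∧ ∀ X : ℝ, 1 ≤ X →
      Summable (fun I : {I : (Ideal (𝓞 K))⁰ // ClassGroup.mk0 I = C} ↦
        cutoff (absNorm (I.1 : Ideal (𝓞 K)) / X)) ∧
      |∑' I : {I : (Ideal (𝓞 K))⁰ // ClassGroup.mk0 I = C},
        cutoff (absNorm (I.1 : Ideal (𝓞 K)) / X) - c * X| ≤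
        B * X ^ (1 - (Module.finrank ℚ K : ℝ)⁻¹) := by
    obtain ⟨J, hJ⟩ := ClassGroup.mk0_surjective C⁻¹
    obtain ⟨B, hB⟩ := exists_mixedCutoff_eq_zero K
    obtain ⟨A, hA⟩ := exists_abs_mixedCutoff_sub_le K
    obtain ⟨c, D, hcD⟩ := exists_abs_tsum_lattice_sub_le
      (fractionalIdealLatticeBasis K (FractionalIdeal.mk0 K J)) hB hA
    rw [mixedEmbedding.finrank] at hcD
    set N : ℝ := (absNorm (J : Ideal (𝓞 K)) : ℝ) with hN
    have hN1 : 1 ≤ N := by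
      rw [hN, Nat.one_le_cast, Nat.one_le_iff_ne_zero]
      exact absNorm_ne_zero_of_nonZeroDivisors J
    set τ : ℝ := (torsionOrder K : ℝ) with hτ
    have hτ0 : 0 < τ := by rw [hτ, Nat.cast_pos]; exact torsionOrder_pos K
    refine ⟨τ⁻¹ * c * N, τ⁻¹ * |D| * N, by positivity, fun X hX ↦ ?_⟩
    have hXN : 1 ≤ X * N := one_le_mul_of_one_le_of_one_le hX hN1
    set R := (X * N) ^ ((Module.finrank ℚ K : ℝ)⁻¹) with hR
    have hR1 : 1 ≤ R := Real.one_le_rpow hXN (by positivity)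
    have hRn : R ^ Module.finrank ℚ K = X * N :=
      Real.rpow_inv_natCast_pow (by positivity) hn.ne'
    have hsum := (hasSum_cutoff_class K hJ (by linarith) hRn).mul_left τ⁻¹
    simp_rw [← hτ, inv_mul_cancel_left₀ hτ0.ne'] at hsum
    refine ⟨hsum.summable, ?_⟩
    rw [hsum.tsum_eq]
    have h1 := hcD R hR1
    rw [hRn] at h1
    have h2 : X * N / R ≤ N * X ^ (1 - (Module.finrank ℚ K : ℝ)⁻¹) := by
      rw [Real.rpow_sub (by linarith), Real.rpow_one, ← mul_div_assoc, mul_comm X]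
      gcongr
      rw [hR]
      gcongr
      exact le_mul_of_one_le_right (by linarith) hN1
    calc _ = τ⁻¹ * |∑' v : Submodule.span ℤ (Set.range
          (fractionalIdealLatticeBasis K (FractionalIdeal.mk0 K J))),
          mixedCutoff K (R⁻¹ • (v : mixedSpace K)) - c * (X * N)| := by
          rw [← abs_of_pos (inv_pos.mpr hτ0), ← abs_mul, abs_of_pos (inv_pos.mpr hτ0)]
          ring_nf
      _ ≤ τ⁻¹ * (|D| * (N * X ^ (1 - (Module.finrank ℚ K : ℝ)⁻¹))) := by
          gcongr
          refine h1.trans ?_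
          have : 0 ≤ X * N / R := by positivity
          gcongr
          exact le_abs_self D
      _ = _ := by ring
  choose c B hB h using hclass
  refine ⟨∑ C, c C, ∑ C, B C, fun X hX ↦ ?_⟩
  have hs : HasSum (fun I : (Ideal (𝓞 K))⁰ ↦ cutoff (absNorm (I : Ideal (𝓞 K)) / X))
      (∑ C, ∑' I : {I : (Ideal (𝓞 K))⁰ // ClassGroup.mk0 I = C},
        cutoff (absNorm (I.1 : Ideal (𝓞 K)) / X)) := by
    rw [← (Equiv.sigmaFiberEquiv fun I : (Ideal (𝓞 K))⁰ ↦ ClassGroup.mk0 I).hasSum_iff]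
    have hsm : Summable ((fun I : (Ideal (𝓞 K))⁰ ↦ cutoff (absNorm (I : Ideal (𝓞 K)) / X)) ∘
        (Equiv.sigmaFiberEquiv fun I : (Ideal (𝓞 K))⁰ ↦ ClassGroup.mk0 I)) := by
      rw [summable_sigma_of_nonneg fun I ↦ by
        rw [Function.comp_apply]; exact cutoff_nonneg (by positivity)]
      exact ⟨fun C ↦ (h C X hX).1, (hasSum_fintype _).summable⟩
    have h1 := hsm.hasSum.sigma fun C ↦ (h C X hX).1.hasSum
    rw [← h1.unique (hasSum_fintype _)]
    exact hsm.hasSum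
  refine ⟨hs.summable, ?_⟩
  rw [hs.tsum_eq, Finset.sum_mul, ← Finset.sum_sub_distrib, Finset.sum_mul]
  exact (Finset.abs_sum_le_sum_abs _ _).trans (Finset.sum_le_sum fun C _ ↦ (h C X hX).2)

end Unfolding

section Mellin

open MeasureTheory Set Filter Asymptotics

theorem cutoff_div_mul_cpow_eq {N X : ℝ} (hN : 0 < N) (hX : N < X) (s : ℂ) :
    (cutoff (N / X) : ℂ) * (X : ℂ) ^ (-s - 1) =
      N * (X : ℂ) ^ (-s - 2) - N ^ 2 * (X : ℂ) ^ (-s - 3) := by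
  have hX0 : 0 < X := hN.trans hX
  have hXC : (X : ℂ) ≠ 0 := ofReal_ne_zero.mpr hX0.ne'
  have h1 : N / X ≤ 1 := (div_le_one hX0).mpr hX.le
  rw [cutoff, max_eq_right (by linarith), show -s - 1 = -s - 3 + (2 : ℕ) by push_cast; ring,
    show -s - 2 = -s - 3 + 1 by ring, cpow_add _ _ hXC, cpow_add _ _ hXC, cpow_natCast, cpow_one]
  push_cast
  field_simp

theorem integrableOn_cutoff_div_mul_cpow {N : ℝ} (hN : 1 ≤ N) {s : ℂ} (hs : 0 < s.re) :
    IntegrableOn (fun X : ℝ ↦ (cutoff (N / X) : ℂ) * (X : ℂ) ^ (-s - 1)) (Ioi 1) := by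
  have hN0 : 0 < N := by linarith
  have h1 : IntegrableOn (fun X : ℝ ↦ (N : ℂ) * (X : ℂ) ^ (-s - 2) - N ^ 2 * (X : ℂ) ^ (-s - 3))
      (Ioi N) :=
    ((integrableOn_Ioi_cpow_of_lt (by simp; linarith) hN0).const_mul _).sub
      ((integrableOn_Ioi_cpow_of_lt (by simp; linarith) hN0).const_mul _)
  have h2 : IntegrableOn (fun X : ℝ ↦ (cutoff (N / X) : ℂ) * (X : ℂ) ^ (-s - 1)) (Ioi N) :=
    h1.congr_fun (fun X hX ↦ (cutoff_div_mul_cpow_eq hN0 hX s).symm) measurableSet_Ioi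
  refine IntegrableOn.of_forall_sdiff_eq_zero h2 measurableSet_Ioi fun X hX ↦ ?_
  have hX1 : 1 < X := hX.1
  have hX2 : X ≤ N := not_lt.mp hX.2
  rw [cutoff_eq_zero ((one_le_div (by linarith)).mpr hX2), ofReal_zero, zero_mul]

theorem integral_cutoff_div_mul_cpow {N : ℝ} (hN : 1 ≤ N) {s : ℂ} (hs : 0 < s.re) :
    ∫ X in Ioi (1 : ℝ), (cutoff (N / X) : ℂ) * (X : ℂ) ^ (-s - 1) =
      (N : ℂ) ^ (-s) / ((s + 1) * (s + 2)) := by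
  have hN0 : 0 < N := by linarith
  have hNC : (N : ℂ) ≠ 0 := ofReal_ne_zero.mpr hN0.ne'
  have e : ∫ X in Ioi (1 : ℝ), (cutoff (N / X) : ℂ) * (X : ℂ) ^ (-s - 1) =
      ∫ X in Ioi N, (cutoff (N / X) : ℂ) * (X : ℂ) ^ (-s - 1) := by
    refine (setIntegral_eq_of_subset_of_forall_sdiff_eq_zero measurableSet_Ioi
      (Ioi_subset_Ioi hN) (f := fun X : ℝ ↦ (cutoff (N / X) : ℂ) * (X : ℂ) ^ (-s - 1))
      fun X hX ↦ ?_)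
    have hX1 : 1 < X := hX.1
    have hX2 : X ≤ N := not_lt.mp hX.2
    rw [cutoff_eq_zero ((one_le_div (by linarith)).mpr hX2), ofReal_zero, zero_mul]
  rw [e, setIntegral_congr_fun measurableSet_Ioi fun X hX ↦ cutoff_div_mul_cpow_eq hN0 hX s,
    integral_sub ((integrableOn_Ioi_cpow_of_lt (by simp; linarith) hN0).const_mul _)
      ((integrableOn_Ioi_cpow_of_lt (by simp; linarith) hN0).const_mul _),
    integral_const_mul, integral_const_mul, integral_Ioi_cpow_of_lt (by simp; linarith) hN0,
    integral_Ioi_cpow_of_lt (by simp; linarith) hN0]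
  have hs1 : s + 1 ≠ 0 := fun h ↦ by have := congrArg re h; simp at this; linarith
  have hs2 : s + 2 ≠ 0 := fun h ↦ by have := congrArg re h; simp at this; linarith
  rw [show -s - 2 + 1 = -s - 1 by ring, show -s - 3 + 1 = -s - (2 : ℕ) by push_cast; ring,
    cpow_sub _ _ hNC, cpow_sub _ _ hNC, cpow_natCast, cpow_one]
  have h3 : -s - 1 ≠ 0 := fun h ↦ hs1 (by linear_combination -h)
  have h4 : -s - (2 : ℕ) ≠ 0 := fun h ↦ hs2 (by push_cast at h; linear_combination -h)
  rw [show -s - 1 = -(s + 1) by ring, show -s - (2 : ℕ) = -(s + 2) by push_cast; ring]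
  field_simp
  ring

theorem integral_norm_cutoff_div_mul_cpow_le {N : ℝ} (hN : 1 ≤ N) {s : ℂ} (hs : 0 < s.re) :
    ∫ X in Ioi (1 : ℝ), ‖(cutoff (N / X) : ℂ) * (X : ℂ) ^ (-s - 1)‖ ≤
      ‖(N : ℂ) ^ (-(s.re : ℂ))‖ := by
  have hσ : 0 < ((s.re : ℂ)).re := hs
  have e : ∫ X in Ioi (1 : ℝ), ‖(cutoff (N / X) : ℂ) * (X : ℂ) ^ (-s - 1)‖ =
      ∫ X in Ioi (1 : ℝ), re ((cutoff (N / X) : ℂ) * (X : ℂ) ^ (-(s.re : ℂ) - 1)) := by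
    refine setIntegral_congr_fun measurableSet_Ioi fun X hX ↦ ?_
    have hX0 : 0 < X := zero_lt_one.trans hX
    have h1 : 0 ≤ cutoff (N / X) := cutoff_nonneg (by positivity)
    rw [norm_mul, norm_cpow_eq_rpow_re_of_pos hX0, norm_real, Real.norm_of_nonneg h1,
      re_ofReal_mul, show (-(s.re : ℂ) - 1) = ((-s.re - 1 : ℝ) : ℂ) by push_cast; ring,
      ← ofReal_cpow hX0.le, ofReal_re]
    simp
  have h2 := (reCLM.integral_comp_comm (integrableOn_cutoff_div_mul_cpow hN hσ))
  simp only [reCLM_apply] at h2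
  rw [e, h2, integral_cutoff_div_mul_cpow hN hσ]
  refine (re_le_norm _).trans ?_
  rw [norm_div]
  refine div_le_self (norm_nonneg _) ?_
  have h3 : ((s.re : ℂ) + 1) * (s.re + 2) = (((s.re + 1) * (s.re + 2) : ℝ) : ℂ) := by push_cast; ring
  rw [h3, norm_real, Real.norm_of_nonneg (by positivity)]
  nlinarith

theorem exists_integral_eq_of_abs_sub_le {S : ℝ → ℝ} (hS : Measurable S) {c B δ : ℝ}
    (hδ : 0 < δ) (h : ∀ X, 1 ≤ X → |S X - c * X| ≤ B * X ^ (1 - δ)) :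
    ∃ G : ℂ → ℂ, (∀ s : ℂ, 1 - δ < s.re → DifferentiableAt ℂ G s) ∧
      (∀ s : ℂ, 1 - δ / 2 ≤ s.re → ‖G s‖ ≤ B * (2 / δ)) ∧
      ∀ s : ℂ, 1 < s.re →
        ∫ X in Ioi (1 : ℝ), (S X : ℂ) * (X : ℂ) ^ (-s - 1) = c / (s - 1) + G s := by
  set E : ℝ → ℂ := (Ioi 1).indicator fun X ↦ ((S X - c * X : ℝ) : ℂ) with hE
  have hB : 0 ≤ B := by simpa using (abs_nonneg _).trans (h 1 le_rfl)
  have hEm : Measurable E := by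
    refine Measurable.indicator ?_ measurableSet_Ioi
    exact measurable_ofReal.comp (hS.sub (measurable_const.mul measurable_id))
  have hEb (X : ℝ) (hX : 0 < X) : ‖E X‖ ≤ B * X ^ (1 - δ) := by
    by_cases h1 : X ∈ Ioi 1
    · rw [hE, indicator_of_mem h1, norm_real]; exact h X (le_of_lt h1)
    · rw [hE, indicator_of_notMem h1, norm_zero]; positivity
  have hmel (s : ℂ) : mellin E (-s) = ∫ X in Ioi (1 : ℝ), ((S X - c * X : ℝ) : ℂ) *
      (X : ℂ) ^ (-s - 1) := by
    have e : (fun t : ℝ ↦ (t : ℂ) ^ (-s - 1) • E t) = (Ioi 1).indicator fun X : ℝ ↦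
        ((S X - c * X : ℝ) : ℂ) * (X : ℂ) ^ (-s - 1) := by
      ext t
      by_cases h1 : t ∈ Ioi 1
      · rw [hE, indicator_of_mem h1, indicator_of_mem h1, smul_eq_mul, mul_comm]
      · rw [hE, indicator_of_notMem h1, indicator_of_notMem h1, smul_zero]
    rw [mellin, e, setIntegral_indicator measurableSet_Ioi,
      inter_eq_self_of_subset_right (Ioi_subset_Ioi zero_le_one)]
  have hnorm (s : ℂ) (X : ℝ) (hX : 1 < X) :
      ‖((S X - c * X : ℝ) : ℂ) * (X : ℂ) ^ (-s - 1)‖ ≤ B * X ^ (-δ - s.re) := by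
    have hX0 : 0 < X := by linarith
    rw [norm_mul, norm_real, norm_cpow_eq_rpow_re_of_pos hX0]
    calc _ ≤ B * X ^ (1 - δ) * X ^ ((-s - 1).re) := by gcongr; exact h X hX.le
      _ = _ := by rw [mul_assoc, ← Real.rpow_add hX0]; congr 2; simp; ring
  have hint (s : ℂ) (hs : 1 - δ < s.re) : IntegrableOn (fun X : ℝ ↦
      ((S X - c * X : ℝ) : ℂ) * (X : ℂ) ^ (-s - 1)) (Ioi 1) := by
    refine Integrable.mono' (g := fun X ↦ B * X ^ (-δ - s.re))
      ((integrableOn_Ioi_rpow_of_lt (by linarith) zero_lt_one).const_mul B) ?_ ?_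
    · refine Measurable.aestronglyMeasurable ?_
      have := measurable_ofReal.comp (hS.sub (measurable_const.mul measurable_id : Measurable fun X ↦ c * X))
      exact this.mul (measurable_ofReal.pow_const _)
    · filter_upwards [ae_restrict_mem measurableSet_Ioi] with X hX
      exact hnorm s X hX
  refine ⟨fun s ↦ mellin E (-s), fun s hs ↦ ?_, fun s hs ↦ ?_, fun s hs ↦ ?_⟩
  · have : DifferentiableAt ℂ (mellin E) (-s) := by
      refine mellin_differentiableAt_of_isBigO_rpow (a := δ - 1) (b := -s.re - 1) ?_ ?_ ?_ ?_ ?_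
      · rw [locallyIntegrableOn_iff isOpen_Ioi.isLocallyClosed]
        intro k hk hkc
        have hcont : ContinuousOn (fun X : ℝ ↦ B * X ^ (1 - δ)) k := fun X hX ↦
          (((Real.continuousAt_rpow_const _ _ (Or.inl (hk hX).ne')).const_mul B)).continuousWithinAt
        refine Integrable.mono' (hcont.integrableOn_compact hkc) hEm.aestronglyMeasurable ?_
        filter_upwards [ae_restrict_mem hkc.measurableSet] with X hX
        exact hEb X (hk hX)
      · refine IsBigO.of_bound B ?_
        filter_upwards [eventually_gt_atTop 0] with X hX
        rw [Real.norm_of_nonneg (by positivity), neg_sub]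
        exact hEb X hX
      · rw [neg_re]; linarith
      · refine IsBigO.of_bound 0 ?_
        filter_upwards [mem_nhdsWithin_of_mem_nhds (Iio_mem_nhds zero_lt_one)] with X hX
        rw [hE, indicator_of_notMem (by simpa using le_of_lt hX), norm_zero, zero_mul]
      · rw [neg_re]; linarith
    exact DifferentiableAt.fun_comp' s this differentiableAt_id.neg
  · simp only [hmel]
    refine (norm_integral_le_of_norm_le (g := fun X : ℝ ↦ B * X ^ (-1 - δ / 2))
      ((integrableOn_Ioi_rpow_of_lt (by linarith) zero_lt_one).const_mul B) ?_).trans ?_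
    · filter_upwards [ae_restrict_mem measurableSet_Ioi] with X hX
      exact (hnorm s X hX).trans (mul_le_mul_of_nonneg_left
        (Real.rpow_le_rpow_of_exponent_le (le_of_lt hX) (by linarith)) hB)
    · rw [integral_const_mul, integral_Ioi_rpow_of_lt (by linarith) zero_lt_one, Real.one_rpow]
      apply le_of_eq
      congr 1
      rw [show -1 - δ / 2 + 1 = -(δ / 2) by ring, neg_div_neg_eq, one_div_div]
  · simp only [hmel]
    have h1 : ∀ X ∈ Ioi (1 : ℝ), (S X : ℂ) * (X : ℂ) ^ (-s - 1) =
        c * (X : ℂ) ^ (-s) + ((S X - c * X : ℝ) : ℂ) * (X : ℂ) ^ (-s - 1) := by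
      intro X hX
      have hXC : (X : ℂ) ≠ 0 := ofReal_ne_zero.mpr (zero_lt_one.trans hX).ne'
      rw [cpow_sub _ _ hXC, cpow_one]
      push_cast
      field_simp
      ring
    rw [setIntegral_congr_fun measurableSet_Ioi h1, integral_add
      ((integrableOn_Ioi_cpow_of_lt (by simpa using hs) zero_lt_one).const_mul _)
      (hint s (by linarith)), integral_const_mul,
      integral_Ioi_cpow_of_lt (by simpa using hs) zero_lt_one]
    rw [ofReal_one, one_cpow, show -s + 1 = -(s - 1) by ring, neg_div_neg_eq, mul_one_div]

open NumberField nonZeroDivisors Ideal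

variable (K : Type*) [Field K] [NumberField K]

theorem hasSum_nonZeroDivisors_absNorm_cpow {s : ℂ} (hs : 1 < s.re) :
    HasSum (fun I : (Ideal (𝓞 K))⁰ ↦ (absNorm (I : Ideal (𝓞 K)) : ℂ) ^ (-s))
      (∑' I : Ideal (𝓞 K), (absNorm I : ℂ) ^ (-s)) := by
  have h := (dedekindZetaSeries_eq_lseries K hs).summable.hasSum
  refine (Function.Injective.hasSum_iff Subtype.val_injective fun I hI ↦ ?_).mpr h
  have hI0 : I = ⊥ := by
    by_contra h0
    exact hI ⟨⟨I, mem_nonZeroDivisors_iff_ne_zero.mpr h0⟩, rfl⟩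
  rw [hI0, absNorm_bot, Nat.cast_zero, zero_cpow]
  exact neg_ne_zero.mpr fun h0 ↦ by rw [h0] at hs; norm_num at hs

theorem one_le_absNorm_of_nonZeroDivisors (I : (Ideal (𝓞 K))⁰) :
    (1 : ℝ) ≤ absNorm (I : Ideal (𝓞 K)) := by
  rw [Nat.one_le_cast, Nat.one_le_iff_ne_zero]
  exact absNorm_ne_zero_of_nonZeroDivisors I

theorem countable_nonZeroDivisors_ideal : Countable (Ideal (𝓞 K))⁰ := by
  have h := (hasSum_nonZeroDivisors_absNorm_cpow K (s := 2) (by norm_num)).summable.countable_support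
  refine Set.countable_univ_iff.mp (h.mono fun I _ ↦ ?_)
  rw [Function.mem_support]
  have := one_le_absNorm_of_nonZeroDivisors K I
  have h0 : (absNorm (I : Ideal (𝓞 K)) : ℂ) ≠ 0 :=
    Nat.cast_ne_zero.mpr (absNorm_ne_zero_of_nonZeroDivisors I)
  simp [cpow_eq_zero_iff, h0]

theorem measurable_tsum_of_nonneg {ι : Type*} [Countable ι] {f : ι → ℝ → ℝ}
    (hf : ∀ i, Measurable (f i)) (hf0 : ∀ i x, 0 < x → 0 ≤ f i x) :
    Measurable ((Ioi 0).indicator fun x ↦ ∑' i, f i x) := by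
  have e : ((Ioi 0).indicator fun x ↦ ∑' i, f i x) =
      (Ioi 0).indicator fun x ↦ (∑' i, ENNReal.ofReal (f i x)).toReal := by
    ext x
    by_cases hx : x ∈ Ioi (0 : ℝ)
    · rw [indicator_of_mem hx, indicator_of_mem hx, ENNReal.tsum_toReal_eq fun _ ↦ ENNReal.ofReal_ne_top]
      exact tsum_congr fun i ↦ (ENNReal.toReal_ofReal (hf0 i x hx)).symm
    · rw [indicator_of_notMem hx, indicator_of_notMem hx]
  rw [e]
  exact (Measurable.tsum fun i ↦ (hf i).ennreal_ofReal).ennreal_toReal.indicator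
    measurableSet_Ioi

theorem measurable_cutoff : Measurable cutoff :=
  measurable_id.mul (measurable_const.max (measurable_const.sub measurable_id))

theorem exists_dedekindZetaSeries_eq : ∃ (c : ℝ) (G : ℂ → ℂ) (δ B : ℝ), 0 < δ ∧
    (∀ s : ℂ, 1 - δ < s.re → DifferentiableAt ℂ G s) ∧
    (∀ s : ℂ, 1 - δ ≤ s.re → ‖G s‖ ≤ B) ∧
    ∀ s : ℂ, 1 < s.re → ∑' I : Ideal (𝓞 K), (absNorm I : ℂ) ^ (-s) =
      (s + 1) * (s + 2) * (c / (s - 1) + G s) := by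
  have := countable_nonZeroDivisors_ideal K
  obtain ⟨c, B, hcB⟩ := exists_abs_tsum_cutoff_sub_le K
  set δ : ℝ := (Module.finrank ℚ K : ℝ)⁻¹ with hδ
  have hδ0 : 0 < δ := by
    have : 0 < Module.finrank ℚ K := Module.finrank_pos
    positivity
  set S : ℝ → ℝ := (Ioi 0).indicator fun X ↦
    ∑' I : (Ideal (𝓞 K))⁰, cutoff (absNorm (I : Ideal (𝓞 K)) / X) with hS
  have hSX {X : ℝ} (hX : 0 < X) : S X = ∑' I : (Ideal (𝓞 K))⁰,
      cutoff (absNorm (I : Ideal (𝓞 K)) / X) := indicator_of_mem (mem_Ioi.mpr hX) _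
  have hSm : Measurable S := measurable_tsum_of_nonneg
    (fun I ↦ measurable_cutoff.comp (measurable_const.div measurable_id))
    fun I X hX ↦ cutoff_nonneg (by positivity)
  obtain ⟨G, hG1, hG2, hG3⟩ := exists_integral_eq_of_abs_sub_le hSm hδ0 (c := c) (B := B)
    fun X hX ↦ by rw [hSX (by linarith)]; exact (hcB X hX).2
  refine ⟨c, G, δ / 2, B * (2 / δ), by positivity, fun s hs ↦ hG1 s (by linarith), hG2,
    fun s hs ↦ ?_⟩
  have hs0 : 0 < s.re := by linarith
  rw [← hG3 s hs]
  have h1 := hasSum_integral_of_summable_integral_norm (μ := volume.restrict (Ioi (1 : ℝ)))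
    (F := fun (I : (Ideal (𝓞 K))⁰) (X : ℝ) ↦
      (cutoff (absNorm (I : Ideal (𝓞 K)) / X) : ℂ) * (X : ℂ) ^ (-s - 1))
    (fun I ↦ integrableOn_cutoff_div_mul_cpow (one_le_absNorm_of_nonZeroDivisors K I) hs0) ?_
  · have h2 : ∫ X in Ioi (1 : ℝ), ∑' I : (Ideal (𝓞 K))⁰,
        (cutoff (absNorm (I : Ideal (𝓞 K)) / X) : ℂ) * (X : ℂ) ^ (-s - 1) =
        ∫ X in Ioi (1 : ℝ), (S X : ℂ) * (X : ℂ) ^ (-s - 1) := by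
      refine setIntegral_congr_fun measurableSet_Ioi fun X hX ↦ ?_
      have hX0 : 0 < X := zero_lt_one.trans hX
      rw [hSX hX0, tsum_mul_right, ofReal_tsum]
    rw [h2] at h1
    simp_rw [integral_cutoff_div_mul_cpow (one_le_absNorm_of_nonZeroDivisors K _) hs0] at h1
    have h3 := (hasSum_nonZeroDivisors_absNorm_cpow K hs).div_const ((s + 1) * (s + 2))
    simp_rw [ofReal_natCast] at h1
    rw [h1.unique h3]
    have hs1 : s + 1 ≠ 0 := fun h ↦ by have := congrArg re h; simp at this; linarith
    have hs2 : s + 2 ≠ 0 := fun h ↦ by have := congrArg re h; simp at this; linarith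
    field_simp
  · refine Summable.of_nonneg_of_le (fun I ↦ integral_nonneg fun _ ↦ norm_nonneg _)
      (fun I ↦ integral_norm_cutoff_div_mul_cpow_le (one_le_absNorm_of_nonZeroDivisors K I) hs0) ?_
    have := (hasSum_nonZeroDivisors_absNorm_cpow K (s := s.re) (by simpa using hs)).summable.norm
    simpa using this

end Mellin

section Convexity

open HadamardThreeLines

lemma one_add_abs_sq_mul_exp_le (x y c : ℝ) (hc : |c| ≤ 2) :
    (1 + |y|) ^ 2 * Real.exp (c ^ 2 - (y - x) ^ 2) ≤ 2 * Real.exp 4 * (1 + |x|) ^ 2 := by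
  have h1 : 1 + |y| ≤ (1 + |x|) * (1 + |y - x|) := by
    have := abs_add_le x (y - x)
    have h2 := mul_nonneg (abs_nonneg x) (abs_nonneg (y - x))
    rw [add_sub_cancel] at this
    nlinarith
  have h2 : (1 + |y - x|) ^ 2 ≤ 2 * Real.exp ((y - x) ^ 2) := by
    have := Real.add_one_le_exp ((y - x) ^ 2)
    nlinarith [sq_nonneg (1 - |y - x|), sq_abs (y - x)]
  have h3 : c ^ 2 ≤ 4 := by
    have := abs_le.mp hc
    nlinarith
  calc (1 + |y|) ^ 2 * Real.exp (c ^ 2 - (y - x) ^ 2)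
      ≤ ((1 + |x|) * (1 + |y - x|)) ^ 2 * Real.exp (4 - (y - x) ^ 2) := by gcongr
    _ = (1 + |x|) ^ 2 * (1 + |y - x|) ^ 2 * Real.exp (4 - (y - x) ^ 2) := by ring
    _ ≤ (1 + |x|) ^ 2 * (2 * Real.exp ((y - x) ^ 2)) * Real.exp (4 - (y - x) ^ 2) := by gcongr
    _ = 2 * (Real.exp ((y - x) ^ 2) * Real.exp (4 - (y - x) ^ 2)) * (1 + |x|) ^ 2 := by ring
    _ = 2 * Real.exp 4 * (1 + |x|) ^ 2 := by rw [← Real.exp_add]; ring_nf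

lemma exists_norm_le_rpow_of_convexity {F : ℂ → ℂ} {δ A : ℝ} (hδ : 0 < δ) (hδ1 : δ ≤ 1)
    (hd : ∀ s : ℂ, 1 - δ ≤ s.re → DifferentiableAt ℂ F s)
    (hA : ∀ s : ℂ, 1 - δ ≤ s.re → s.re ≤ 2 → ‖F s‖ ≤ A * (1 + |s.im|) ^ 2)
    (hM : ∀ u : ℝ, 1 < u → ∃ M : ℝ, ∀ s : ℂ, u ≤ s.re → ‖F s‖ ≤ M) {ε : ℝ} (hε : 0 < ε) :
    ∃ ρ C : ℝ, 0 < ρ ∧ ρ ≤ 1 / 2 ∧ 0 < C ∧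
      ∀ s : ℂ, 1 - ρ ≤ s.re → ‖F s‖ ≤ C * (1 + |s.im|) ^ ε := by
  set η := min (ε * δ / 4) (δ / 2) with hη
  have hη0 : 0 < η := by positivity
  have hη1 : η ≤ ε * δ / 4 := min_le_left _ _
  have hη2 : η ≤ δ / 2 := min_le_right _ _
  obtain ⟨M, hM⟩ := hM (1 + η) (by linarith)
  set a := max 1 (A * (2 * Real.exp 4)) with ha
  set b := max 1 (M * Real.exp 4) with hb
  have ha1 : 1 ≤ a := le_max_left _ _
  have hb1 : 1 ≤ b := le_max_left _ _
  have hM0 : 0 ≤ M := (norm_nonneg _).trans (hM 2 (by simp; linarith))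
  have hA0 : 0 ≤ A := by
    have := (norm_nonneg _).trans (hA 1 (by simp; linarith) (by simp))
    simpa using this
  refine ⟨η, a * b + M, hη0, by linarith, by positivity, fun s hs ↦ ?_⟩
  have ht1 : 1 ≤ 1 + |s.im| := by linarith [abs_nonneg s.im]
  have htε : 1 ≤ (1 + |s.im|) ^ ε := Real.one_le_rpow ht1 hε.le
  rcases le_or_gt (1 + η) s.re with h | h
  · calc ‖F s‖ ≤ M := hM s h
      _ ≤ (a * b + M) * 1 := by nlinarith
      _ ≤ _ := by gcongr
  set g : ℂ → ℂ := fun w ↦ F w * exp ((w - s) ^ 2) with hg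
  have hng : ∀ w, ‖g w‖ = ‖F w‖ * Real.exp ((w.re - s.re) ^ 2 - (w.im - s.im) ^ 2) := by
    intro w
    rw [hg, norm_mul, norm_exp]
    simp [sq]
  have hgd : ∀ w : ℂ, 1 - δ ≤ w.re → DifferentiableAt ℂ g w := fun w hw ↦
    (hd w hw).mul (by fun_prop)
  have hbound : ∀ w : ℂ, 1 - δ ≤ w.re → w.re ≤ 1 + η →
      ‖g w‖ ≤ a * (1 + |s.im|) ^ 2 := by
    intro w hw hw'
    rw [hng]
    calc _ ≤ A * (1 + |w.im|) ^ 2 * Real.exp ((w.re - s.re) ^ 2 - (w.im - s.im) ^ 2) := by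
          gcongr; exact hA w hw (by linarith)
      _ = A * ((1 + |w.im|) ^ 2 * Real.exp ((w.re - s.re) ^ 2 - (w.im - s.im) ^ 2)) := by ring
      _ ≤ A * (2 * Real.exp 4 * (1 + |s.im|) ^ 2) := by
          refine mul_le_mul_of_nonneg_left ?_ hA0
          exact one_add_abs_sq_mul_exp_le _ _ _ (abs_le.mpr ⟨by linarith, by linarith⟩)
      _ = A * (2 * Real.exp 4) * (1 + |s.im|) ^ 2 := by ring
      _ ≤ _ := by gcongr; exact le_max_right _ _
  have key := norm_le_interp_of_mem_verticalClosedStrip' (f := g) (z := s)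
    (a := a * (1 + |s.im|) ^ 2) (b := b) (l := 1 - δ) (u := 1 + η) (by linarith)
    ⟨by linarith, h.le⟩ ?_ ?_ ?_ ?_
  · have hgs : g s = F s := by simp [hg]
    rw [hgs] at key
    set θ := (s.re - (1 - δ)) / (1 + η - (1 - δ)) with hθ
    have hden : 0 < 1 + η - (1 - δ) := by linarith
    have hθ0 : 0 ≤ θ := div_nonneg (by linarith) hden.le
    have hθ1 : θ ≤ 1 := (div_le_one hden).mpr (by linarith)
    have hθ2 : (1 - θ) * 2 ≤ ε := by
      have : 1 - θ = (1 + η - s.re) / (1 + η - (1 - δ)) := by rw [hθ]; field_simp; ring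
      rw [this, div_mul_eq_mul_div, div_le_iff₀ hden]
      nlinarith
    calc ‖F s‖ ≤ _ := key
      _ = a ^ (1 - θ) * (1 + |s.im|) ^ (2 * (1 - θ)) * b ^ θ := by
        rw [Real.mul_rpow (by positivity) (by positivity), Real.rpow_mul (by positivity)]
        norm_num
      _ ≤ a ^ (1 : ℝ) * (1 + |s.im|) ^ ε * b ^ (1 : ℝ) := by
        gcongr
        · linarith
        · linarith
      _ = a * b * (1 + |s.im|) ^ ε := by simp only [Real.rpow_one]; ring
      _ ≤ _ := by gcongr; linarith
  · refine DifferentiableOn.diffContOnCl fun w hw ↦ ?_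
    have : closure (verticalStrip (1 - δ) (1 + η)) ⊆ re ⁻¹' Set.Ici (1 - δ) :=
      closure_minimal (fun w hw ↦ hw.1.le) (isClosed_Ici.preimage continuous_re)
    exact (hgd w (this hw)).differentiableWithinAt
  · refine ⟨a * (1 + |s.im|) ^ 2, ?_⟩
    rintro _ ⟨w, hw, rfl⟩
    exact hbound w hw.1 hw.2
  · intro w hw
    have hw : w.re = 1 - δ := hw
    exact hbound w (by linarith) (by linarith)
  · intro w hw
    have hw : w.re = 1 + η := hw
    rw [hng]
    calc _ ≤ M * Real.exp 4 := by
          gcongr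
          · exact hM w hw.ge
          · nlinarith [sq_nonneg (w.im - s.im), hw]
      _ ≤ b := le_max_right _ _

end Convexity

section Growth

variable {Z G : ℂ → ℂ} {c δ B : ℝ}

lemma eq_of_eq_of_one_lt_re (hδ : 0 < δ) (hZd : ∀ s : ℂ, s ≠ 1 → DifferentiableAt ℂ Z s)
    (hG : ∀ s : ℂ, 1 - δ < s.re → DifferentiableAt ℂ G s)
    (hZ : ∀ s : ℂ, 1 < s.re → Z s = (s + 1) * (s + 2) * (c / (s - 1) + G s))
    {s : ℂ} (hs : 1 - δ < s.re) (hs' : 0 < s.im) :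
    Z s = (s + 1) * (s + 2) * (c / (s - 1) + G s) := by
  set U : Set ℂ := re ⁻¹' Set.Ioi (1 - δ) ∩ im ⁻¹' Set.Ioi 0 with hU
  have hUo : IsOpen U := (isOpen_Ioi.preimage continuous_re).inter (isOpen_Ioi.preimage continuous_im)
  have hUc : IsPreconnected U :=
    (((convex_Ioi _).linear_preimage reLm).inter ((convex_Ioi _).linear_preimage imLm)).isPreconnected
  have hne : ∀ w ∈ U, w ≠ 1 := fun w hw h ↦ by
    have : 0 < w.im := hw.2
    simp [h] at this
  have h1 : AnalyticOnNhd ℂ Z U :=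
    DifferentiableOn.analyticOnNhd (fun w hw ↦ (hZd w (hne w hw)).differentiableWithinAt) hUo
  have h2 : AnalyticOnNhd ℂ (fun s ↦ (s + 1) * (s + 2) * (c / (s - 1) + G s)) U := by
    refine DifferentiableOn.analyticOnNhd (fun w hw ↦ DifferentiableAt.differentiableWithinAt ?_) hUo
    have hw1 : w - 1 ≠ 0 := sub_ne_zero.mpr (hne w hw)
    have := hG w hw.1
    fun_prop (disch := assumption)
  refine h1.eqOn_of_preconnected_of_eventuallyEq h2 hUc (z₀ := 2 + I)
    ⟨by simp; linarith, by simp⟩ ?_ ⟨hs, hs'⟩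
  filter_upwards [(isOpen_Ioi.preimage continuous_re).mem_nhds
    (show (2 + I : ℂ) ∈ re ⁻¹' Set.Ioi 1 by simp)] with w hw using hZ w hw

lemma norm_poly_factor_le {s g : ℂ} (h0 : 0 ≤ s.re) (h2 : s.re ≤ 2) (hg : ‖g‖ ≤ B) :
    ‖(s + 1) * (c + (s - 1) * g)‖ ≤ 3 * (|c| + B) * (1 + |s.im|) ^ 2 := by
  have hB : 0 ≤ B := (norm_nonneg _).trans hg
  have h1 : ‖s + 1‖ ≤ 3 * (1 + |s.im|) := by
    refine (norm_le_abs_re_add_abs_im _).trans ?_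
    have : |(s + 1).re| ≤ 3 := by simp; rw [abs_le]; constructor <;> linarith
    simp only [add_im, one_im, add_zero]
    linarith [abs_nonneg s.im]
  have h3 : ‖s - 1‖ ≤ 1 + |s.im| := by
    refine (norm_le_abs_re_add_abs_im _).trans ?_
    have : |(s - 1).re| ≤ 1 := by simp; rw [abs_le]; constructor <;> linarith
    simp only [sub_im, one_im, sub_zero]
    linarith
  have ht : 1 ≤ 1 + |s.im| := by linarith [abs_nonneg s.im]
  have h4 : ‖c + (s - 1) * g‖ ≤ (|c| + B) * (1 + |s.im|) := by
    refine (norm_add_le _ _).trans ?_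
    rw [norm_mul, norm_real, Real.norm_eq_abs]
    have : ‖s - 1‖ * ‖g‖ ≤ (1 + |s.im|) * B := by gcongr
    nlinarith [abs_nonneg c]
  rw [norm_mul]
  calc _ ≤ 3 * (1 + |s.im|) * ((|c| + B) * (1 + |s.im|)) := by gcongr
    _ = _ := by ring

lemma exists_norm_le_im_rpow (hδ : 0 < δ) (hZd : ∀ s : ℂ, s ≠ 1 → DifferentiableAt ℂ Z s)
    (hG : ∀ s : ℂ, 1 - δ < s.re → DifferentiableAt ℂ G s) (hB : ∀ s : ℂ, 1 - δ ≤ s.re → ‖G s‖ ≤ B)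
    (hZ : ∀ s : ℂ, 1 < s.re → Z s = (s + 1) * (s + 2) * (c / (s - 1) + G s))
    (hM : ∀ u : ℝ, 1 < u → ∃ M : ℝ, ∀ s : ℂ, u ≤ s.re → ‖Z s‖ ≤ M) {ε : ℝ} (hε : 0 < ε) :
    ∃ ρ C : ℝ, 0 < ρ ∧ ρ ≤ 1 / 2 ∧ 0 < C ∧
      ∀ s : ℂ, 1 - ρ ≤ s.re → 1 / 2 ≤ s.im → ‖Z s‖ ≤ C * s.im ^ ε := by
  set F : ℂ → ℂ := fun s ↦ (s + 1) * (c + (s - 1) * G s) with hF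
  set δ' := min (δ / 2) (1 / 2) with hδ'
  have hδ0 : 0 < δ' := by positivity
  have hδ1 : δ' ≤ δ / 2 := min_le_left _ _
  have hδ2 : δ' ≤ 1 / 2 := min_le_right _ _
  have hFZ : ∀ s : ℂ, s ≠ 1 → Z s = (s + 1) * (s + 2) * (c / (s - 1) + G s) →
      F s * (s + 2) = (s - 1) * Z s := by
    intro s hs h
    have : s - 1 ≠ 0 := sub_ne_zero.mpr hs
    rw [h, hF]
    field_simp
  obtain ⟨ρ, C, hρ0, hρ1, hC, h⟩ := exists_norm_le_rpow_of_convexity (F := F) (δ := δ')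
    (A := 3 * (|c| + B)) hδ0 (by linarith)
    (fun s hs ↦ by
      have := hG s (by linarith)
      fun_prop)
    (fun s hs hs2 ↦ norm_poly_factor_le (by linarith) hs2 (hB s (by linarith)))
    (fun u hu ↦ by
      obtain ⟨M, hM⟩ := hM u hu
      refine ⟨M, fun s hs ↦ ?_⟩
      have hs1 : s ≠ 1 := fun h ↦ by simp [h] at hs; linarith
      have h := congrArg norm (hFZ s hs1 (hZ s (by linarith)))
      rw [norm_mul (F s), norm_mul (s - 1)] at h
      have h2 : ‖s - 1‖ ≤ ‖s + 2‖ := by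
        rw [norm_def, norm_def]
        refine Real.sqrt_le_sqrt ?_
        simp only [normSq_apply, sub_re, sub_im, add_re, add_im, one_re, one_im, re_ofNat, im_ofNat]
        nlinarith
      have h3 : 0 < ‖s + 2‖ := (norm_pos_iff.mpr (sub_ne_zero.mpr hs1)).trans_le h2
      have h4 : ‖F s‖ ≤ ‖Z s‖ := by
        by_contra! h5
        nlinarith [norm_nonneg (Z s)]
      exact h4.trans (hM s hs)) hε
  set ρ' := min ρ δ' with hρ'
  have hρ'1 : ρ' ≤ ρ := min_le_left _ _
  have hρ'2 : ρ' ≤ δ' := min_le_right _ _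
  refine ⟨ρ', 7 * C * 3 ^ ε, by positivity, by linarith, by positivity, fun s hs hs' ↦ ?_⟩
  have hs1 : s ≠ 1 := fun h ↦ by norm_num [h] at hs'
  have h1 := congrArg norm (hFZ s hs1 (eq_of_eq_of_one_lt_re hδ hZd hG hZ (by linarith) (by linarith)))
  rw [norm_mul (F s), norm_mul (s - 1)] at h1
  have h2 : 1 / 2 ≤ ‖s - 1‖ := by
    have := abs_im_le_norm (s - 1)
    simp only [sub_im, one_im, sub_zero] at this
    linarith [le_abs_self s.im]
  have h3 : ‖s + 2‖ ≤ 7 * ‖s - 1‖ := by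
    have : s + 2 = (s - 1) + 3 := by ring
    have h4 := norm_add_le (s - 1) 3
    rw [← this] at h4
    norm_num at h4
    linarith
  have h5 : ‖Z s‖ ≤ 7 * ‖F s‖ := by
    by_contra! h6
    nlinarith [norm_nonneg (F s)]
  have h6 : (1 + |s.im|) ^ ε ≤ (3 * s.im) ^ ε := by
    rw [abs_of_pos (by linarith)]
    gcongr
    linarith
  rw [Real.mul_rpow (by norm_num) (by linarith)] at h6
  calc ‖Z s‖ ≤ 7 * ‖F s‖ := h5
    _ ≤ 7 * (C * (3 ^ ε * s.im ^ ε)) := by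
      gcongr
      exact (h s (by linarith)).trans (by gcongr)
    _ = _ := by ring

lemma norm_sub_le_of_norm_le_im_rpow (hZd : ∀ s : ℂ, s ≠ 1 → DifferentiableAt ℂ Z s)
    {ρ C ε : ℝ} (hρ : 0 < ρ) (hρ1 : ρ ≤ 1 / 2) (hC : 0 < C) (hε : 0 < ε)
    (h : ∀ s : ℂ, 1 - ρ ≤ s.re → 1 / 2 ≤ s.im → ‖Z s‖ ≤ C * s.im ^ ε)
    {x y t : ℝ} (hx : 1 ≤ x) (hy : 1 ≤ y) (ht : 1 ≤ t) :
    ‖Z (x + t * I) - Z (y + t * I)‖ ≤ C * 2 ^ ε / ρ * t ^ ε * |x - y| := by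
  have hne : ∀ s : ℂ, 0 < s.im → s ≠ 1 := fun s hs h ↦ by simp [h] at hs
  set L : Set ℂ := re ⁻¹' Set.Ici 1 ∩ im ⁻¹' {t} with hL
  have hLc : Convex ℝ L :=
    ((convex_Ici _).linear_preimage reLm).inter ((convex_singleton _).linear_preimage imLm)
  have hder : ∀ s ∈ L, ‖deriv Z s‖ ≤ C * 2 ^ ε / ρ * t ^ ε := by
    intro s hs
    have hsre : 1 ≤ s.re := hs.1
    have hsim : s.im = t := hs.2
    have hb : ∀ w ∈ Metric.closedBall s ρ, 1 - ρ ≤ w.re ∧ 1 / 2 ≤ w.im ∧ w.im ≤ 2 * t := by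
      intro w hw
      rw [Metric.mem_closedBall, dist_eq] at hw
      have h1 := (abs_re_le_norm (w - s)).trans hw
      have h2 := (abs_im_le_norm (w - s)).trans hw
      rw [sub_re, abs_le] at h1
      rw [sub_im, abs_le] at h2
      refine ⟨?_, ?_, ?_⟩ <;> linarith
    have h1 := Complex.norm_deriv_le_of_forall_mem_sphere_norm_le (f := Z) (c := s)
      (C := C * (2 * t) ^ ε) hρ
      (DifferentiableOn.diffContOnCl fun w hw ↦ by
        have := hb w (Metric.closure_ball_subset_closedBall hw)
        exact (hZd w (hne w (by linarith))).differentiableWithinAt)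
      (fun w hw ↦ by
        obtain ⟨h1, h2, h3⟩ := hb w (Metric.sphere_subset_closedBall hw)
        refine (h w h1 h2).trans ?_
        gcongr)
    rw [Real.mul_rpow (by norm_num) (by linarith)] at h1
    refine h1.trans (le_of_eq (by ring))
  have h2 := hLc.norm_image_sub_le_of_norm_deriv_le (f := Z) (x := y + t * I) (y := x + t * I)
    (fun s hs ↦ hZd s (hne s (by have : s.im = t := hs.2; linarith))) hder
    ⟨by simpa using hy, by simp⟩ ⟨by simpa using hx, by simp⟩
  have h3 : (x + t * I : ℂ) - (y + t * I) = ((x - y : ℝ) : ℂ) := by push_cast; ring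
  rwa [h3, norm_real, Real.norm_eq_abs] at h2

end Growth

section Comparison

variable {Z G : ℂ → ℂ} {c δ B : ℝ}

lemma exists_lower_bound_near_one_line {D C₁ C ε : ℝ} (hC₁ : 0 < C₁) (hC : 0 < C) (hD : 0 < D)
    (hε : 0 < ε)
    (h1 : ∀ x : ℝ, 1 < x → x ≤ 2 → ‖Z x‖ ≤ D / (x - 1))
    (h2 : ∀ x t : ℝ, 1 ≤ x → 1 ≤ t → ‖Z (x + 2 * t * I)‖ ≤ C₁ * t ^ ε)
    (h3 : ∀ x y t : ℝ, 1 ≤ x → 1 ≤ y → 1 ≤ t →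
      ‖Z (x + t * I) - Z (y + t * I)‖ ≤ C * t ^ ε * |x - y|)
    (h341 : ∀ x t : ℝ, 1 < x → 1 ≤ ‖Z x‖ ^ 3 * ‖Z (x + t * I)‖ ^ 4 * ‖Z (x + 2 * t * I)‖) :
    ∃ κ : ℝ, 0 < κ ∧ κ ≤ 1 ∧ ∀ x t : ℝ, 1 ≤ x → x ≤ 2 → 1 ≤ t →
      C * κ / (t ^ ε) ^ 4 ≤ ‖Z (x + t * I)‖ := by
  set E := D ^ 3 * C₁ with hE
  have hE0 : 0 < E := by positivity
  set κ := min 1 (1 / (E * (16 * C ^ 4))) with hκ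
  have hκ0 : 0 < κ := by positivity
  have hκ1 : κ ≤ 1 := min_le_left _ _
  have hκ2 : κ * (E * (16 * C ^ 4)) ≤ 1 := by
    rw [← le_div_iff₀ (by positivity)]
    exact min_le_right _ _
  refine ⟨κ, hκ0, hκ1, fun x t hx hx2 ht ↦ ?_⟩
  set P := t ^ ε with hP
  have hP1 : 1 ≤ P := Real.one_le_rpow ht hε.le
  have hP0 : 0 < P := by linarith
  set d := κ / P ^ 5 with hd
  have hd0 : 0 < d := by positivity
  have hd1 : d ≤ 1 := (div_le_one (by positivity)).mpr (hκ1.trans (one_le_pow₀ hP1))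
  have far : ∀ y : ℝ, 1 + d ≤ y → y ≤ 2 → 2 * C * κ / P ^ 4 ≤ ‖Z (y + t * I)‖ := by
    intro y hy hy2
    have hy1 : 0 < y - 1 := by linarith
    by_contra! hlt
    have h4 : 1 ≤ (D / (y - 1)) ^ 3 * ‖Z (y + t * I)‖ ^ 4 * (C₁ * P) :=
      (h341 y t (by linarith)).trans (by
        gcongr
        · exact h1 y (by linarith) hy2
        · exact h2 y t (by linarith) ht)
    have h5 : (y - 1) ^ 3 ≤ E * P * ‖Z (y + t * I)‖ ^ 4 := by
      have : (D / (y - 1)) ^ 3 * ‖Z (y + t * I)‖ ^ 4 * (C₁ * P) =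
          E * P * ‖Z (y + t * I)‖ ^ 4 / (y - 1) ^ 3 := by rw [hE]; field_simp
      rwa [this, le_div_iff₀ (by positivity), one_mul] at h4
    have h6 : E * P * ‖Z (y + t * I)‖ ^ 4 < d ^ 3 := by
      calc E * P * ‖Z (y + t * I)‖ ^ 4 < E * P * (2 * C * κ / P ^ 4) ^ 4 := by gcongr
        _ = (κ * (E * (16 * C ^ 4))) * d ^ 3 := by rw [hd]; field_simp; ring
        _ ≤ 1 * d ^ 3 := by gcongr
        _ = d ^ 3 := one_mul _
    have h7 : d ^ 3 ≤ (y - 1) ^ 3 := by gcongr; linarith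
    linarith
  rcases le_or_gt (1 + d) x with h | h
  · refine le_trans ?_ (far x h hx2)
    gcongr
    linarith
  · have h4 := far (1 + d) le_rfl (by linarith)
    have h5 := h3 (1 + d) x t (by linarith) hx ht
    have h6 : C * P * |1 + d - x| ≤ C * κ / P ^ 4 := by
      rw [abs_of_pos (by linarith)]
      calc C * P * (1 + d - x) ≤ C * P * d := by gcongr; linarith
        _ = C * κ / P ^ 4 := by rw [hd]; field_simp
    have h7 := norm_sub_norm_le (Z ((1 + d : ℝ) + t * I)) (Z (x + t * I))
    have h8 : 2 * C * κ / P ^ 4 = C * κ / P ^ 4 + C * κ / P ^ 4 := by ring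
    linarith

lemma exists_norm_comparison (hδ : 0 < δ) (hZd : ∀ s : ℂ, s ≠ 1 → DifferentiableAt ℂ Z s)
    (hG : ∀ s : ℂ, 1 - δ < s.re → DifferentiableAt ℂ G s) (hB : ∀ s : ℂ, 1 - δ ≤ s.re → ‖G s‖ ≤ B)
    (hZ : ∀ s : ℂ, 1 < s.re → Z s = (s + 1) * (s + 2) * (c / (s - 1) + G s))
    (hM : ∀ u : ℝ, 1 < u → ∃ M : ℝ, ∀ s : ℂ, u ≤ s.re → ‖Z s‖ ≤ M)
    (h341 : ∀ x t : ℝ, 1 < x → 1 ≤ ‖Z x‖ ^ 3 * ‖Z (x + t * I)‖ ^ 4 * ‖Z (x + 2 * t * I)‖)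
    {ε : ℝ} (hε : 0 < ε) :
    ∃ κ : ℝ, 0 < κ ∧ κ ≤ 1 ∧ ∀ T t : ℝ, 1 ≤ t → t ≤ T →
      0 < ‖Z (1 + t * I)‖ ∧
      ‖Z (1 + t * I)‖ ≤ 2 * ‖Z ((1 + κ * T ^ (-ε) : ℝ) + t * I)‖ ∧
      ‖Z ((1 + κ * T ^ (-ε) : ℝ) + t * I)‖ ≤ 2 * ‖Z (1 + t * I)‖ := by
  have he : 0 < ε / 5 := by positivity
  obtain ⟨ρ, C₁, hρ0, hρ1, hC₁, hgrow⟩ := exists_norm_le_im_rpow hδ hZd hG hB hZ hM he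
  have hB0 : 0 ≤ B := (norm_nonneg _).trans (hB 1 (by simp; linarith))
  set C := C₁ * 2 ^ (ε / 5) / ρ with hC
  have hC0 : 0 < C := by positivity
  have hdiff : ∀ x y t : ℝ, 1 ≤ x → 1 ≤ y → 1 ≤ t →
      ‖Z (x + t * I) - Z (y + t * I)‖ ≤ C * t ^ (ε / 5) * |x - y| := fun x y t hx hy ht ↦
    norm_sub_le_of_norm_le_im_rpow hZd hρ0 hρ1 hC₁ he hgrow hx hy ht
  obtain ⟨κ, hκ0, hκ1, hlow⟩ := exists_lower_bound_near_one_line (Z := Z)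
    (D := 12 * (|c| + B) + 1) (C₁ := C₁ * 2 ^ (ε / 5)) (C := C)
    (by positivity) hC0 (by positivity) he
    (fun x hx hx2 ↦ by
      have hx0 : 0 < x - 1 := by linarith
      have hg := hB x (by simp; linarith)
      rw [hZ x (by simpa using hx), norm_mul, norm_mul]
      have e1 : ‖(x + 1 : ℂ)‖ = x + 1 := by
        rw [← ofReal_one, ← ofReal_add, Complex.norm_of_nonneg (by linarith)]
      have e2 : ‖(x + 2 : ℂ)‖ = x + 2 := by
        rw [← ofReal_ofNat, ← ofReal_add, Complex.norm_of_nonneg (by linarith)]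
      have e3 : ‖(c / (x - 1) + G x : ℂ)‖ ≤ (|c| + B) / (x - 1) := by
        refine (norm_add_le _ _).trans ?_
        rw [norm_div, ← ofReal_one, ← ofReal_sub, Complex.norm_of_nonneg hx0.le, norm_real,
          Real.norm_eq_abs, add_div]
        gcongr
        rw [le_div_iff₀ hx0]
        nlinarith [norm_nonneg (G x)]
      rw [e1, e2]
      calc (x + 1) * (x + 2) * ‖(c / (x - 1) + G x : ℂ)‖
          ≤ 12 * ((|c| + B) / (x - 1)) := by
            gcongr
            nlinarith
        _ = 12 * (|c| + B) / (x - 1) := by ring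
        _ ≤ _ := by gcongr; linarith)
    (fun x t hx ht ↦ by
      have := hgrow (x + 2 * t * I) (by simp; linarith) (by simp; linarith)
      simp only [add_im, ofReal_im, mul_im, mul_re, re_ofNat, ofReal_re, im_ofNat, I_re, I_im] at this
      norm_num at this
      rw [Real.mul_rpow (by norm_num) (by linarith)] at this
      linarith) hdiff h341
  refine ⟨κ / 2, by positivity, by linarith, fun T t ht htT ↦ ?_⟩
  set P := t ^ (ε / 5) with hP
  have hP0 : 0 < P := Real.rpow_pos_of_pos (by linarith) _
  set L := C * κ / P ^ 4 with hL
  have hL0 : 0 < L := by positivity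
  have hT : T ^ (-ε) ≤ 1 / P ^ 5 := by
    rw [Real.rpow_neg (by linarith), ← one_div, hP, ← Real.rpow_natCast, ← Real.rpow_mul (by linarith)]
    have : ε / 5 * (5 : ℕ) = ε := by push_cast; ring
    rw [this]
    gcongr
  have hT0 : 0 < T ^ (-ε) := Real.rpow_pos_of_pos (by linarith) _
  have hT1 : T ^ (-ε) ≤ 1 := Real.rpow_le_one_of_one_le_of_nonpos (by linarith) (by linarith)
  set x := 1 + κ / 2 * T ^ (-ε) with hx
  have hx1 : 1 ≤ x := by rw [hx]; nlinarith
  have hx2 : x ≤ 2 := by rw [hx]; nlinarith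
  have h1 := hlow 1 t le_rfl (by norm_num) ht
  have h2 := hlow x t hx1 hx2 ht
  have h3 := hdiff x 1 t hx1 le_rfl ht
  have h4 : C * P * |x - 1| ≤ L / 2 := by
    rw [abs_of_nonneg (by linarith)]
    calc C * P * (x - 1) = C * P * (κ / 2) * T ^ (-ε) := by rw [hx]; ring
      _ ≤ C * P * (κ / 2) * (1 / P ^ 5) := by gcongr
      _ = L / 2 := by rw [hL]; field_simp
  rw [ofReal_one] at h1 h3
  have h5 := norm_sub_norm_le (Z (x + t * I)) (Z (1 + t * I))
  have h6 := norm_sub_norm_le (Z (1 + t * I)) (Z (x + t * I))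
  rw [norm_sub_rev] at h6
  refine ⟨by linarith, by linarith, by linarith⟩

end Comparison

section Moment

open NumberField

lemma rpow_two_mul_le_one_add {x p : ℝ} {k : ℕ} (hx : 0 ≤ x) (hp : 0 ≤ p) (hpk : p ≤ k) :
    x ^ (2 * p) ≤ 1 + (x ^ k) ^ 2 := by
  rcases le_total x 1 with h | h
  · have := Real.rpow_le_one hx h (by positivity : 0 ≤ 2 * p)
    nlinarith [sq_nonneg (x ^ k)]
  · have : x ^ (2 * p) ≤ x ^ (2 * k : ℝ) := by gcongr
    have h2 : x ^ (2 * k : ℝ) = (x ^ k) ^ 2 := by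
      rw [mul_comm, Real.rpow_mul hx, Real.rpow_natCast, Real.rpow_ofNat]
    linarith

lemma lseries_norm_le_of_le {f : ℕ → ℂ} {j : ℕ}
    (hf : ∀ n ≠ 0, ‖f n‖ ≤ (n.divisors.card : ℝ) ^ j) {u : ℝ} {s : ℂ} (hu : 1 < u) (hs : u ≤ s.re) :
    ‖LSeries f s‖ ≤ (u / (u - 1)) ^ 2 ^ j := by
  obtain ⟨h1, h2⟩ := lseriesSummable_of_norm_le hf (s := s) (by linarith)
  refine (norm_tsum_le_tsum_norm h1.norm).trans (h2.trans ?_)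
  have hu0 : 0 < u - 1 := by linarith
  have hs0 : 0 < s.re - 1 := by linarith
  refine pow_le_pow_left₀ (div_nonneg (by linarith) hs0.le) ?_ _
  rw [div_le_div_iff₀ hs0 hu0]
  linarith

lemma continuous_lseries_vertical {f : ℕ → ℂ} {j : ℕ}
    (hf : ∀ n ≠ 0, ‖f n‖ ≤ (n.divisors.card : ℝ) ^ j) {σ : ℝ} (hσ : 1 < σ) :
    Continuous fun t : ℝ ↦ LSeries f (σ + t * I) := by
  have h : LSeries.abscissaOfAbsConv f ≤ 1 := by
    refine LSeries.abscissaOfAbsConv_le_of_forall_lt_LSeriesSummable fun y hy ↦ ?_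
    exact (lseriesSummable_of_norm_le hf (by simpa using hy)).1
  refine continuous_iff_continuousAt.mpr fun t ↦ ?_
  refine ContinuousAt.comp (g := LSeries f) (f := fun t : ℝ ↦ (σ + t * I : ℂ)) ?_ (by fun_prop)
  refine (LSeries_hasDerivAt ?_).continuousAt
  simpa using h.trans_lt (by exact_mod_cast hσ)

lemma exists_lseries_majorant (K : Type*) [Field K] [NumberField K] (z : ℝ) :
    ∃ (a : ℕ → ℂ) (i : ℕ) (A : ℝ), 0 ≤ A ∧ (∀ n ≠ 0, ‖a n‖ ≤ (n.divisors.card : ℝ) ^ i) ∧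
      ∀ (s : ℂ) (X : ℝ), 1 < s.re → 0 < X → X ≤ 2 * ‖dedekindZetaSeries K s‖ →
        ‖dedekindZetaSeries K s‖ ≤ 2 * X → X ^ (2 * z) ≤ 1 + A * ‖LSeries a s‖ ^ 2 := by
  obtain ⟨k, hk⟩ := exists_nat_ge |z|
  rcases le_total 0 z with hz | hz
  · obtain ⟨a, i, ha, h⟩ := exists_lseries_pow_eq
      (f := fun n ↦ (Nat.card {I : Ideal (𝓞 K) // Ideal.absNorm I = n} : ℂ))
      (j := Module.finrank ℚ K)
      (fun n hn ↦ by rw [norm_natCast]; exact_mod_cast card_absNorm_eq_le K n hn) k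
    refine ⟨a, i, (2 ^ k) ^ 2, by positivity, ha, fun s X hs hX h1 h2 ↦ ?_⟩
    rw [h s hs, ← (dedekindZetaSeries_eq_lseries K hs).tsum_eq]
    refine (rpow_two_mul_le_one_add hX.le hz ((le_abs_self z).trans hk)).trans ?_
    rw [norm_pow, ← mul_pow, ← mul_pow]
    gcongr
    exact h1
  · obtain ⟨m, hm, hinv⟩ := exists_lseries_inv K
    obtain ⟨a, i, ha, h⟩ := exists_lseries_pow_eq hm k
    refine ⟨a, i, (2 ^ k) ^ 2, by positivity, ha, fun s X hs hX h1 h2 ↦ ?_⟩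
    rw [h s hs, hinv s hs, ← (dedekindZetaSeries_eq_lseries K hs).tsum_eq]
    have h3 : X ^ (2 * z) = X⁻¹ ^ (2 * -z) := by
      rw [Real.inv_rpow hX.le, ← Real.rpow_neg hX.le]
      ring_nf
    rw [h3]
    refine (rpow_two_mul_le_one_add (inv_nonneg.mpr hX.le) (by linarith)
      ((neg_le_abs z).trans hk)).trans ?_
    rw [norm_pow, ← mul_pow, ← mul_pow]
    gcongr
    change X⁻¹ ≤ 2 * ‖(dedekindZetaSeries K s)⁻¹‖
    have h4 : 0 < ‖dedekindZetaSeries K s‖ := by linarith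
    rw [norm_inv, inv_le_iff_one_le_mul₀ hX]
    field_simp
    exact h2

lemma dedekindZetaSeries_norm_bounds (K : Type*) [Field K] [NumberField K] :
    (∀ u : ℝ, 1 < u → ∃ M : ℝ, ∀ s : ℂ, u ≤ s.re → ‖dedekindZetaSeries K s‖ ≤ M) ∧
    (∀ x t : ℝ, 1 < x → 1 ≤ ‖dedekindZetaSeries K x‖ ^ 3 *
      ‖dedekindZetaSeries K (x + t * I)‖ ^ 4 * ‖dedekindZetaSeries K (x + 2 * t * I)‖) := by
  refine ⟨fun u hu ↦ ⟨(u / (u - 1)) ^ 2 ^ Module.finrank ℚ K, fun s hs ↦ ?_⟩, fun x t hx ↦ ?_⟩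
  · rw [dedekindZetaSeries, (dedekindZetaSeries_eq_lseries K (by linarith)).tsum_eq]
    refine lseries_norm_le_of_le (fun n hn ↦ ?_) hu hs
    rw [norm_natCast]
    exact_mod_cast card_absNorm_eq_le K n hn
  · simp only [dedekindZetaSeries]
    rw [(dedekindZetaSeries_eq_lseries K (s := x) (by simpa using hx)).tsum_eq,
      (dedekindZetaSeries_eq_lseries K (s := x + t * I) (by simpa using hx)).tsum_eq,
      (dedekindZetaSeries_eq_lseries K (s := x + 2 * t * I) (by simpa using hx)).tsum_eq]
    exact one_le_norm_dedekind_product K hx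

end Moment

lemma exists_majorant_integral_le {a : ℕ → ℂ} {i : ℕ}
    (ha : ∀ n ≠ 0, ‖a n‖ ≤ (n.divisors.card : ℝ) ^ i) {f : ℝ → ℝ} {A κ : ℝ} (hA : 0 ≤ A)
    (hκ : 0 < κ) (hκ1 : κ ≤ 1)
    (hf : ∀ T t : ℝ, 1 ≤ t → t ≤ T →
      f t ≤ 1 + A * ‖LSeries a ((1 + κ * T ^ (-(1 / 2 ^ (2 * i)) : ℝ) : ℝ) + t * I)‖ ^ 2) :
    ∃ C : ℝ, ∀ T : ℝ, 2 ≤ T → ∫ t in (0 : ℝ)..T, f t ≤ C * T := by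
  obtain ⟨C, hC⟩ := integral_normSq_lseries_le ha
  set N := 2 ^ (2 * i) with hN
  have hN0 : 0 < N := by positivity
  refine ⟨|∫ t in (0 : ℝ)..1, f t| + 1 + A * (|C| * (1 + κ⁻¹ ^ N)), fun T hT ↦ ?_⟩
  by_cases hint : IntervalIntegrable f MeasureTheory.volume 0 T
  swap
  · rw [intervalIntegral.integral_undef hint]
    positivity
  have h01 : IntervalIntegrable f MeasureTheory.volume 0 1 := hint.mono_set (by
    rw [Set.uIcc_of_le (by linarith), Set.uIcc_of_le (by linarith)]
    exact Set.Icc_subset_Icc le_rfl (by linarith))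
  have h1T : IntervalIntegrable f MeasureTheory.volume 1 T := hint.mono_set (by
    rw [Set.uIcc_of_le (by linarith), Set.uIcc_of_le (by linarith)]
    exact Set.Icc_subset_Icc (by linarith) le_rfl)
  rw [← intervalIntegral.integral_add_adjacent_intervals h01 h1T]
  have hT0 : 0 < T := by linarith
  set σ := 1 + κ * T ^ (-(1 / 2 ^ (2 * i)) : ℝ) with hσ
  have hp0 : 0 < T ^ (-(1 / 2 ^ (2 * i)) : ℝ) := Real.rpow_pos_of_pos hT0 _
  have hp1 : T ^ (-(1 / 2 ^ (2 * i)) : ℝ) ≤ 1 :=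
    Real.rpow_le_one_of_one_le_of_nonpos (by linarith) (neg_nonpos.mpr (by positivity))
  have hσ1 : 1 < σ := by rw [hσ]; linarith [mul_pos hκ hp0]
  have hσ2 : σ ≤ 2 := by rw [hσ]; nlinarith
  have hpow : (σ - 1)⁻¹ ^ N = κ⁻¹ ^ N * T := by
    have h1 : σ - 1 = κ * T ^ (-(1 / 2 ^ (2 * i)) : ℝ) := by rw [hσ]; ring
    rw [h1, mul_inv, mul_pow, ← Real.rpow_neg hT0.le, neg_neg, ← Real.rpow_natCast (T ^ _),
      ← Real.rpow_mul hT0.le]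
    have h2 : (1 / 2 ^ (2 * i) : ℝ) * (N : ℕ) = 1 := by rw [hN]; push_cast; field_simp
    rw [h2, Real.rpow_one]
  have hcont : Continuous fun t : ℝ ↦ ‖LSeries a (σ + t * I)‖ ^ 2 :=
    (continuous_lseries_vertical ha hσ1).norm.pow 2
  have hii (x y : ℝ) : IntervalIntegrable (fun t : ℝ ↦ ‖LSeries a (σ + t * I)‖ ^ 2)
    MeasureTheory.volume x y := hcont.intervalIntegrable x y
  have hmain : ∫ t in (0 : ℝ)..T, ‖LSeries a (σ + t * I)‖ ^ 2 ≤ |C| * (1 + κ⁻¹ ^ N) * T := by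
    refine (hC T hT σ hσ1 hσ2).trans ?_
    rw [hpow, show T + κ⁻¹ ^ N * T = (1 + κ⁻¹ ^ N) * T by ring, ← mul_assoc]
    gcongr
    exact le_abs_self C
  have hsub : ∫ t in (1 : ℝ)..T, ‖LSeries a (σ + t * I)‖ ^ 2 ≤
      ∫ t in (0 : ℝ)..T, ‖LSeries a (σ + t * I)‖ ^ 2 := by
    rw [← intervalIntegral.integral_add_adjacent_intervals (hii 0 1) (hii 1 T)]
    have := intervalIntegral.integral_nonneg (a := (0 : ℝ)) (b := 1) (μ := MeasureTheory.volume)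
      (f := fun t : ℝ ↦ ‖LSeries a (σ + t * I)‖ ^ 2) (by norm_num) fun t _ ↦ by positivity
    linarith
  have hle : ∫ t in (1 : ℝ)..T, f t ≤
      ∫ t in (1 : ℝ)..T, (1 + A * ‖LSeries a (σ + t * I)‖ ^ 2) :=
    intervalIntegral.integral_mono_on (by linarith) h1T
      (Continuous.intervalIntegrable (by fun_prop) _ _) fun t ht ↦ hf T t ht.1 ht.2
  rw [intervalIntegral.integral_add (by simp) ((hii 1 T).const_mul A),
    intervalIntegral.integral_const_mul] at hle
  simp only [intervalIntegral.integral_const, smul_eq_mul, mul_one] at hle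
  have h1 : A * ∫ t in (1 : ℝ)..T, ‖LSeries a (σ + t * I)‖ ^ 2 ≤
      A * (|C| * (1 + κ⁻¹ ^ N) * T) := mul_le_mul_of_nonneg_left (hsub.trans hmain) hA
  have h2 : (∫ t in (0 : ℝ)..1, f t) ≤ |∫ t in (0 : ℝ)..1, f t| * T :=
    (le_abs_self _).trans (le_mul_of_one_le_right (abs_nonneg _) (by linarith))
  nlinarith

theorem dedekindZeta_moment_bound_on_one_line (K : Type*) [Field K] [NumberField K]
    (Z : ℂ → ℂ) (hZdiff : ∀ s : ℂ, s ≠ 1 → DifferentiableAt ℂ Z s)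
    (hZeq : ∀ s : ℂ, 1 < s.re → Z s = dedekindZetaSeries K s)
    (z : ℝ) (σ : ℝ) (hσ : 1 ≤ σ) :
    ∃ C : ℝ, ∀ T : ℝ, 2 ≤ T →
      (∫ t in (0:ℝ)..T, ‖Z (σ + t * I)‖ ^ (2 * z)) ≤ C * T := by
  obtain ⟨a, i, A, hA, ha, hmaj⟩ := exists_lseries_majorant K z
  obtain ⟨hM, h341⟩ := dedekindZetaSeries_norm_bounds K
  rcases hσ.eq_or_lt with rfl | hσ
  · obtain ⟨c, G, δ, B, hδ, hG, hB, hZ⟩ := exists_dedekindZetaSeries_eq K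
    obtain ⟨κ, hκ0, hκ1, hcomp⟩ := exists_norm_comparison (Z := Z) (ε := 1 / 2 ^ (2 * i)) hδ hZdiff
      hG hB (fun s hs ↦ (hZeq s hs).trans (hZ s hs))
      (fun u hu ↦ by
        obtain ⟨M, hM⟩ := hM u hu
        exact ⟨M, fun s hs ↦ by rw [hZeq s (hu.trans_le hs)]; exact hM s hs⟩)
      (fun x t hx ↦ by
        rw [hZeq x (by simpa using hx), hZeq (x + t * I) (by simpa using hx),
          hZeq (x + 2 * t * I) (by simpa using hx)]
        exact h341 x t hx) (by positivity)
    refine exists_majorant_integral_le ha hA hκ0 hκ1 fun T t ht htT ↦ ?_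
    obtain ⟨h0, h1, h2⟩ := hcomp T t ht htT
    have hp0 : 0 < T ^ (-(1 / 2 ^ (2 * i)) : ℝ) := Real.rpow_pos_of_pos (by linarith) _
    have hre : 1 < ((1 + κ * T ^ (-(1 / 2 ^ (2 * i)) : ℝ) : ℝ) + t * I : ℂ).re := by
      rw [add_re, ofReal_re]
      simpa using mul_pos hκ0 hp0
    rw [hZeq _ hre] at h1 h2
    rw [ofReal_one]
    exact hmaj _ _ hre h0 h1 h2
  · refine ⟨1 + A * ((σ / (σ - 1)) ^ 2 ^ i) ^ 2, fun T hT ↦ ?_⟩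
    have hbound : ∀ t : ℝ, ‖Z (σ + t * I)‖ ^ (2 * z) ≤ 1 + A * ((σ / (σ - 1)) ^ 2 ^ i) ^ 2 := by
      intro t
      have hre : 1 < (σ + t * I : ℂ).re := by simpa using hσ
      have h1 : 0 < ‖dedekindZetaSeries K (σ + t * I)‖ := by
        refine norm_pos_iff.mpr fun h ↦ ?_
        have := h341 σ t hσ
        norm_num [h] at this
      rw [hZeq _ hre]
      refine (hmaj _ _ hre h1 (by linarith) (by linarith)).trans ?_
      gcongr
      exact lseries_norm_le_of_le ha hσ (by simp)
    have h := intervalIntegral.norm_integral_le_of_norm_le_const (a := (0 : ℝ)) (b := T)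
      (f := fun t : ℝ ↦ ‖Z (σ + t * I)‖ ^ (2 * z)) fun t _ ↦ by
        rw [Real.norm_of_nonneg (by positivity)]
        exact hbound t
    rw [sub_zero, abs_of_pos (by linarith)] at h
    exact (Real.le_norm_self _).trans h
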